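/- Let Ω ⊂ ℝ be an open bounded interval, let f satisfy hypothesis (F), and let the data satisfy hypothesis (I). Then the problem (P) admits at least one global weak solution (u,Θ) which additionally satisfies u ∈ C⁰([0,∞);W₀^{1,2}(Ω)), u_t ∈ C⁰([0,∞);L²(Ω)), and Θ ∈ C⁰([0,∞);L²(Ω)) ∩ L²_loc([0,∞);W^{1,2}(Ω)). -/

import Mathlib

open MeasureTheory Filter Set Function

noncomputable section

/-- Integral over `Ω = (a,b)`. -/
def intOm (a b : ℝ) (g : ℝ → ℝ) : ℝ := ∫ x in Ioo a b, g x

/-- Double integral over `Ω × (0,T)`. -/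
def intOmT (a b T : ℝ) (F : ℝ → ℝ → ℝ) : ℝ :=
  ∫ p in (Ioo a b) ×ˢ (Ioo 0 T), F p.1 p.2

/-- Squared `L²(Ω)` integral of `g`. -/
def sqOm (a b : ℝ) (g : ℝ → ℝ) : ℝ := ∫ x in Ioo a b, (g x) ^ 2

/-- `L²(Ω)` norm. -/
def nrmL2 (a b : ℝ) (g : ℝ → ℝ) : ℝ := (∫ x in Ioo a b, (g x) ^ 2) ^ (1 / 2 : ℝ)

/-- `L¹(Ω)` norm. -/
def nrmL1 (a b : ℝ) (g : ℝ → ℝ) : ℝ := ∫ x in Ioo a b, |g x|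

/-- Membership in `L²(Ω)`. -/
def MemL2 (a b : ℝ) (g : ℝ → ℝ) : Prop :=
  AEStronglyMeasurable g (volume.restrict (Ioo a b)) ∧
    IntegrableOn (fun x => (g x) ^ 2) (Ioo a b)

/-- Zero-trace weak derivative on `(a,b)`: `g ∈ W₀^{1,1}(a,b)` with weak derivative `g'`
(integration by parts against all smooth test functions, with no boundary terms). -/
def WeakDerivZ (a b : ℝ) (g g' : ℝ → ℝ) : Prop :=
  ∀ ψ : ℝ → ℝ, ContDiff ℝ (⊤ : ℕ∞) ψ →
    ∫ x in Ioo a b, g x * deriv ψ x = - ∫ x in Ioo a b, g' x * ψ x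

/-- Interior weak derivative on `(a,b)`: `g ∈ W^{1,1}(a,b)` with weak derivative `g'`. -/
def WeakDerivI (a b : ℝ) (g g' : ℝ → ℝ) : Prop :=
  ∀ ψ : ℝ → ℝ, ContDiff ℝ (⊤ : ℕ∞) ψ → tsupport ψ ⊆ Ioo a b →
    ∫ x in Ioo a b, g x * deriv ψ x = - ∫ x in Ioo a b, g' x * ψ x

/-- Hypothesis (F) on the nonlinearity `f`, where `f'`, `f''` denote its first and second
derivatives on `[0,∞)`: `f ∈ C²([0,∞))`, `f(0)=0`, `f' > 0` on `[0,∞)`,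
and `f' ∈ W^{1,∞}((0,∞))` (i.e. `f'` and `f''` are bounded). -/
structure HypF (f f' f'' : ℝ → ℝ) : Prop where
  hasDeriv₁ : ∀ x ∈ Ici (0 : ℝ), HasDerivWithinAt f (f' x) (Ici 0) x
  hasDeriv₂ : ∀ x ∈ Ici (0 : ℝ), HasDerivWithinAt f' (f'' x) (Ici 0) x
  cont₂ : ContinuousOn f'' (Ici 0)
  zero : f 0 = 0
  pos : ∀ x ∈ Ici (0 : ℝ), 0 < f' x
  bdd : ∃ M : ℝ, ∀ x ∈ Ici (0 : ℝ), |f' x| ≤ M ∧ |f'' x| ≤ M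

/-- Partial derivative in the first (spatial) variable. -/
def pdx (w : ℝ → ℝ → ℝ) : ℝ → ℝ → ℝ := fun x t => deriv (fun y => w y t) x

/-- Partial derivative in the second (time) variable. -/
def pdt (w : ℝ → ℝ → ℝ) : ℝ → ℝ → ℝ := fun x t => deriv (fun s => w x s) t

/-- Test functions in `C₀^∞(Ω × [0,T))`. -/
structure TestU (a b T : ℝ) (φ : ℝ → ℝ → ℝ) : Prop where
  smooth : ContDiff ℝ (⊤ : ℕ∞) (uncurry φ)
  suppx : ∃ K : Set ℝ, IsCompact K ∧ K ⊆ Ioo a b ∧ ∀ x t, x ∉ K → φ x t = 0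
  suppt : ∃ T' : ℝ, T' < T ∧ ∀ x t, T' ≤ t → φ x t = 0

/-- Test functions in `C^∞(Ω̄ × [0,T))`, compactly supported in time. -/
structure TestT (T : ℝ) (φ : ℝ → ℝ → ℝ) : Prop where
  smooth : ContDiff ℝ (⊤ : ℕ∞) (uncurry φ)
  suppt : ∃ T' : ℝ, T' < T ∧ ∀ x t, T' ≤ t → φ x t = 0

/-- Test functions in `C₀^∞(Ω × (0,T))`. -/
structure TestInt (a b T : ℝ) (φ : ℝ → ℝ → ℝ) : Prop where
  smooth : ContDiff ℝ (⊤ : ℕ∞) (uncurry φ)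
  suppx : ∃ K : Set ℝ, IsCompact K ∧ K ⊆ Ioo a b ∧ ∀ x t, x ∉ K → φ x t = 0
  supptime : ∃ K : Set ℝ, IsCompact K ∧ K ⊆ Ioo 0 T ∧ ∀ x t, t ∉ K → φ x t = 0

/-- Definition (W): weak solution of (P) on `Ω × (0,T)`.  Here `ut`, `ux`, `Θx` denote
the weak derivatives of `u` (in time and space) and of `Θ` (in space). -/
structure IsWeakSol (a b T : ℝ) (f f' : ℝ → ℝ) (u0 u0t Θ0 : ℝ → ℝ)
    (u ut ux Θ Θx : ℝ → ℝ → ℝ) : Prop where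
  u_sliceL1 : ∀ t ∈ Icc 0 T, IntegrableOn (fun x => u x t) (Ioo a b)
  u_contL1 : ∀ t₀ ∈ Icc 0 T,
    Tendsto (fun t => ∫ x in Ioo a b, |u x t - u x t₀|) (nhdsWithin t₀ (Icc 0 T)) (nhds 0)
  u_int : IntegrableOn (fun p : ℝ × ℝ => u p.1 p.2) ((Ioo a b) ×ˢ (Ioo 0 T))
  ux_int : IntegrableOn (fun p : ℝ × ℝ => ux p.1 p.2) ((Ioo a b) ×ˢ (Ioo 0 T))
  u_W0 : ∀ᵐ t ∂volume.restrict (Ioo 0 T), WeakDerivZ a b (fun x => u x t) (fun x => ux x t)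
  Θ_int : IntegrableOn (fun p : ℝ × ℝ => Θ p.1 p.2) ((Ioo a b) ×ˢ (Ioo 0 T))
  Θx_int : IntegrableOn (fun p : ℝ × ℝ => Θx p.1 p.2) ((Ioo a b) ×ˢ (Ioo 0 T))
  Θ_W : ∀ᵐ t ∂volume.restrict (Ioo 0 T), WeakDerivI a b (fun x => Θ x t) (fun x => Θx x t)
  Θ_nonneg : ∀ᵐ p ∂volume.restrict ((Ioo a b) ×ˢ (Ioo 0 T)), 0 ≤ Θ p.1 p.2
  ut_weak : ∀ φ : ℝ → ℝ → ℝ, TestInt a b T φ →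
    intOmT a b T (fun x t => u x t * pdt φ x t) = - intOmT a b T (fun x t => ut x t * φ x t)
  ut_int : IntegrableOn (fun p : ℝ × ℝ => ut p.1 p.2) ((Ioo a b) ×ˢ (Ioo 0 T))
  g1_int : IntegrableOn (fun p : ℝ × ℝ => f' (Θ p.1 p.2) * Θx p.1 p.2)
    ((Ioo a b) ×ˢ (Ioo 0 T))
  g2_int : IntegrableOn (fun p : ℝ × ℝ => f' (Θ p.1 p.2) * Θx p.1 p.2 * ut p.1 p.2)
    ((Ioo a b) ×ˢ (Ioo 0 T))
  g3_int : IntegrableOn (fun p : ℝ × ℝ => f (Θ p.1 p.2) * ut p.1 p.2)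
    ((Ioo a b) ×ˢ (Ioo 0 T))
  weak_u : ∀ φ : ℝ → ℝ → ℝ, TestU a b T φ →
    intOmT a b T (fun x t => u x t * pdt (pdt φ) x t)
        - intOm a b (fun x => u0t x * φ x 0) + intOm a b (fun x => u0 x * pdt φ x 0)
      = - intOmT a b T (fun x t => ux x t * pdx φ x t)
        - intOmT a b T (fun x t => f' (Θ x t) * Θx x t * φ x t)
  weak_Θ : ∀ φ : ℝ → ℝ → ℝ, TestT T φ →
    - intOmT a b T (fun x t => Θ x t * pdt φ x t) - intOm a b (fun x => Θ0 x * φ x 0)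
      = - intOmT a b T (fun x t => Θx x t * pdx φ x t)
        + intOmT a b T (fun x t => f' (Θ x t) * Θx x t * ut x t * φ x t)
        + intOmT a b T (fun x t => f (Θ x t) * ut x t * pdx φ x t)

/-- Continuity of `t ↦ w(·,t)` as a map `J → L²(Ω)` (with slices in `L²(Ω)`). -/
def ContL2 (a b : ℝ) (J : Set ℝ) (w : ℝ → ℝ → ℝ) : Prop :=
  (∀ t ∈ J, MemL2 a b (fun x => w x t)) ∧
    ∀ t₀ ∈ J, Tendsto (fun t => ∫ x in Ioo a b, (w x t - w x t₀) ^ 2)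
      (nhdsWithin t₀ J) (nhds 0)

/-- The regularity class (R_T):  `u ∈ C⁰([0,T];W₀^{1,2})`, `u_t ∈ C⁰([0,T];L²)`,
`Θ ∈ C⁰([0,T];L²) ∩ L²((0,T);W^{1,2})`. -/
structure RegT (a b T : ℝ) (u ut ux Θ Θx : ℝ → ℝ → ℝ) : Prop where
  u_cont : ContL2 a b (Icc 0 T) u
  ux_cont : ContL2 a b (Icc 0 T) ux
  u_W0 : ∀ t ∈ Icc (0 : ℝ) T, WeakDerivZ a b (fun x => u x t) (fun x => ux x t)
  ut_cont : ContL2 a b (Icc 0 T) ut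
  Θ_cont : ContL2 a b (Icc 0 T) Θ
  Θ_sq_int : IntegrableOn (fun p : ℝ × ℝ => (Θ p.1 p.2) ^ 2) ((Ioo a b) ×ˢ (Ioo 0 T))
  Θx_sq_int : IntegrableOn (fun p : ℝ × ℝ => (Θx p.1 p.2) ^ 2) ((Ioo a b) ×ˢ (Ioo 0 T))

/-- Data hypothesis (I), with `u0x` the weak derivative of `u0 ∈ W₀^{1,2}(Ω)`. -/
structure DataI (a b : ℝ) (u0 u0x u0t Θ0 : ℝ → ℝ) : Prop where
  u0_L2 : MemL2 a b u0
  u0x_L2 : MemL2 a b u0x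
  u0_W0 : WeakDerivZ a b u0 u0x
  u0t_L2 : MemL2 a b u0t
  Θ0_L2 : MemL2 a b Θ0
  Θ0_nonneg : ∀ᵐ x ∂volume.restrict (Ioo a b), 0 ≤ Θ0 x

/-- Smooth-data hypothesis (I∞). -/
structure SmoothData (a b : ℝ) (v0 u0 Θ0 : ℝ → ℝ) : Prop where
  v0_smooth : ContDiff ℝ (⊤ : ℕ∞) v0
  v0_supp : ∃ K : Set ℝ, IsCompact K ∧ K ⊆ Ioo a b ∧ ∀ x, x ∉ K → v0 x = 0
  u0_smooth : ContDiff ℝ (⊤ : ℕ∞) u0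
  u0_supp : ∃ K : Set ℝ, IsCompact K ∧ K ⊆ Ioo a b ∧ ∀ x, x ∉ K → u0 x = 0
  Θ0_smooth : ContDiff ℝ (⊤ : ℕ∞) Θ0
  Θ0_pos : ∀ x ∈ Icc a b, 0 < Θ0 x
  Θ0x_supp : ∃ K : Set ℝ, IsCompact K ∧ K ⊆ Ioo a b ∧ ∀ x, x ∉ K → deriv Θ0 x = 0

/-- Classical solution of the regularized problem (P_ε), of class
`C^{4,1} × C^{2,1} × C^{2,1}(Ω̄ × [0,∞))`, with positive temperature. -/
structure IsClassicalSolEps (a b : ℝ) (f : ℝ → ℝ) (ε : ℝ) (v0 u0 Θ0 : ℝ → ℝ)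
    (v u Θ : ℝ → ℝ → ℝ) : Prop where
  diffx_v : ∀ k < 4, ∀ x ∈ Icc a b, ∀ t ∈ Ici (0 : ℝ),
    DifferentiableAt ℝ (fun y => pdx^[k] v y t) x
  difft_v : ∀ x ∈ Icc a b, ∀ t ∈ Ici (0 : ℝ), DifferentiableAt ℝ (fun s => v x s) t
  cont_v : ∀ k ≤ 4, ContinuousOn (uncurry (pdx^[k] v)) ((Icc a b) ×ˢ (Ici 0))
  contt_v : ContinuousOn (uncurry (pdt v)) ((Icc a b) ×ˢ (Ici 0))
  diffx_u : ∀ k < 2, ∀ x ∈ Icc a b, ∀ t ∈ Ici (0 : ℝ),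
    DifferentiableAt ℝ (fun y => pdx^[k] u y t) x
  difft_u : ∀ x ∈ Icc a b, ∀ t ∈ Ici (0 : ℝ), DifferentiableAt ℝ (fun s => u x s) t
  cont_u : ∀ k ≤ 2, ContinuousOn (uncurry (pdx^[k] u)) ((Icc a b) ×ˢ (Ici 0))
  contt_u : ContinuousOn (uncurry (pdt u)) ((Icc a b) ×ˢ (Ici 0))
  diffx_Θ : ∀ k < 2, ∀ x ∈ Icc a b, ∀ t ∈ Ici (0 : ℝ),
    DifferentiableAt ℝ (fun y => pdx^[k] Θ y t) x
  difft_Θ : ∀ x ∈ Icc a b, ∀ t ∈ Ici (0 : ℝ), DifferentiableAt ℝ (fun s => Θ x s) t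
  cont_Θ : ∀ k ≤ 2, ContinuousOn (uncurry (pdx^[k] Θ)) ((Icc a b) ×ˢ (Ici 0))
  contt_Θ : ContinuousOn (uncurry (pdt Θ)) ((Icc a b) ×ˢ (Ici 0))
  Θ_pos : ∀ x ∈ Icc a b, ∀ t ∈ Ici (0 : ℝ), 0 < Θ x t
  eq_v : ∀ x ∈ Ioo a b, ∀ t ∈ Ioi (0 : ℝ),
    pdt v x t = -ε * pdx^[4] v x t + pdx^[2] u x t - pdx (fun y s => f (Θ y s)) x t
  eq_u : ∀ x ∈ Ioo a b, ∀ t ∈ Ioi (0 : ℝ), pdt u x t = ε * pdx^[2] u x t + v x t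
  eq_Θ : ∀ x ∈ Ioo a b, ∀ t ∈ Ioi (0 : ℝ),
    pdt Θ x t = pdx^[2] Θ x t - f (Θ x t) * pdx v x t
  bc_v : ∀ t ∈ Ioi (0 : ℝ),
    v a t = 0 ∧ v b t = 0 ∧ pdx^[2] v a t = 0 ∧ pdx^[2] v b t = 0
  bc_u : ∀ t ∈ Ioi (0 : ℝ), u a t = 0 ∧ u b t = 0
  bc_Θ : ∀ t ∈ Ioi (0 : ℝ), pdx Θ a t = 0 ∧ pdx Θ b t = 0
  init : ∀ x ∈ Icc a b, v x 0 = v0 x ∧ u x 0 = u0 x ∧ Θ x 0 = Θ0 x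

/-- Weak convergence in `L²_loc(Ω̄ × [0,∞))`. -/
def WkL2loc (a b : ℝ) (wj : ℕ → ℝ → ℝ → ℝ) (w : ℝ → ℝ → ℝ) : Prop :=
  ∀ T > (0 : ℝ), ∀ ψ : ℝ → ℝ → ℝ,
    AEStronglyMeasurable (fun p : ℝ × ℝ => ψ p.1 p.2)
      (volume.restrict ((Icc a b) ×ˢ (Icc 0 T))) →
    IntegrableOn (fun p : ℝ × ℝ => (ψ p.1 p.2) ^ 2) ((Icc a b) ×ˢ (Icc 0 T)) →
    Tendsto (fun j => ∫ p in (Icc a b) ×ˢ (Icc 0 T), wj j p.1 p.2 * ψ p.1 p.2) atTop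
      (nhds (∫ p in (Icc a b) ×ˢ (Icc 0 T), w p.1 p.2 * ψ p.1 p.2))

open scoped InnerProductSpace BoundedContinuousFunction NNReal

/-- The real Hilbert space of square summable sequences. -/
abbrev SeqE := lp (fun _ : ℕ => ℝ) 2

theorem seq_inner (x y : SeqE) : ⟪x, y⟫_ℝ = ∑' k, x k * y k := by
  rw [lp.inner_eq_tsum]
  simp [mul_comm]

theorem seq_hasSum_inner (x y : SeqE) : HasSum (fun k => x k * y k) ⟪x, y⟫_ℝ := by
  have := lp.hasSum_inner (𝕜 := ℝ) x y
  simpa [mul_comm] using this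

theorem seq_hasSum_sq (x : SeqE) : HasSum (fun k => x k ^ 2) (‖x‖ ^ 2) := by
  have := seq_hasSum_inner x x
  rw [real_inner_self_eq_norm_sq] at this
  simpa [sq] using this

theorem seq_memlp {x : ℕ → ℝ} (h : Summable fun k => x k ^ 2) : Memℓp x 2 := by
  refine memℓp_gen ?_
  simpa using h

/-- The coordinate functional. -/
def coordL (k : ℕ) : SeqE →L[ℝ] ℝ := lp.evalCLM ℝ (fun _ : ℕ => ℝ) 2 k

@[simp] theorem coordL_apply (k : ℕ) (x : SeqE) : coordL k x = x k := rfl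

/-- The element of the sequence space with given square summable coordinates. -/
def seqMk (x : ℕ → ℝ) (h : Summable fun k => x k ^ 2) : SeqE := ⟨x, seq_memlp h⟩

@[simp] theorem seqMk_apply (x : ℕ → ℝ) (h : Summable fun k => x k ^ 2) (k : ℕ) :
    seqMk x h k = x k := rfl

theorem seq_ext {x y : SeqE} (h : ∀ k, x k = y k) : x = y := by
  ext k; exact h k

open Classical in
/-- The diagonal operator with bounded multiplier `m` (zero if `m` is unbounded). -/
def diagL (m : ℕ → ℝ) : SeqE →L[ℝ] SeqE :=
  if h : ∃ C, ∀ k, |m k| ≤ C then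
    LinearMap.mkContinuousOfExistsBound
      { toFun := fun x => seqMk (fun k => m k * x k) (by
          obtain ⟨C, hC⟩ := h
          refine Summable.of_nonneg_of_le (fun _ => sq_nonneg _) (fun k => ?_)
            ((seq_hasSum_sq x).summable.mul_left (C ^ 2))
          rw [mul_pow]
          exact mul_le_mul_of_nonneg_right (sq_le_sq' (by linarith [abs_le.1 (hC k)])
            (abs_le.1 (hC k)).2) (sq_nonneg _))
        map_add' := fun x y => seq_ext fun k => by simp [mul_add]
        map_smul' := fun c x => seq_ext fun k => by simp; ring }
      (by
        obtain ⟨C, hC⟩ := h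
        refine ⟨C, fun x => ?_⟩
        have hC0 : 0 ≤ C := (abs_nonneg _).trans (hC 0)
        refine abs_le_of_sq_le_sq' ?_ (by positivity) |>.2
        refine (hasSum_le (fun k => ?_) (seq_hasSum_sq _)
          ((seq_hasSum_sq x).mul_left (C ^ 2))).trans_eq (by ring)
        simp only [LinearMap.coe_mk, AddHom.coe_mk, seqMk_apply]
        rw [mul_pow]
        exact mul_le_mul_of_nonneg_right (sq_le_sq' (by linarith [abs_le.1 (hC k)])
            (abs_le.1 (hC k)).2) (sq_nonneg _))
  else 0

theorem diagL_apply {m : ℕ → ℝ} {C : ℝ} (h : ∀ k, |m k| ≤ C) (x : SeqE) (k : ℕ) :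
    diagL m x k = m k * x k := by
  have h' : ∃ C, ∀ k, |m k| ≤ C := ⟨C, h⟩
  rw [diagL, dif_pos h']
  rfl

theorem norm_diagL_le {m : ℕ → ℝ} {C : ℝ} (h : ∀ k, |m k| ≤ C) (x : SeqE) :
    ‖diagL m x‖ ≤ C * ‖x‖ := by
  have hC0 : 0 ≤ C := (abs_nonneg _).trans (h 0)
  refine abs_le_of_sq_le_sq' ?_ (by positivity) |>.2
  refine (hasSum_le (fun k => ?_) (seq_hasSum_sq _)
    ((seq_hasSum_sq x).mul_left (C ^ 2))).trans_eq (by ring)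
  rw [diagL_apply h, mul_pow]
  exact mul_le_mul_of_nonneg_right (sq_le_sq' (by linarith [abs_le.1 (h k)])
      (abs_le.1 (h k)).2) (sq_nonneg _)

theorem inner_diagL {m : ℕ → ℝ} {C : ℝ} (h : ∀ k, |m k| ≤ C) (x y : SeqE) :
    ⟪diagL m x, y⟫_ℝ = ⟪x, diagL m y⟫_ℝ := by
  rw [seq_inner, seq_inner]
  refine tsum_congr fun k => ?_
  rw [diagL_apply h, diagL_apply h]; ring

/-- Truncation to the first `n` coordinates. -/
def truncL (n : ℕ) : SeqE →L[ℝ] SeqE := diagL fun k => if k < n then 1 else 0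

theorem truncL_bound (n : ℕ) (k : ℕ) : |(if k < n then 1 else 0 : ℝ)| ≤ 1 := by
  split_ifs <;> simp

theorem truncL_apply (n : ℕ) (x : SeqE) (k : ℕ) :
    truncL n x k = if k < n then x k else 0 := by
  rw [truncL, diagL_apply (truncL_bound n)]; split_ifs <;> simp

theorem norm_truncL_le (n : ℕ) (x : SeqE) : ‖truncL n x‖ ≤ ‖x‖ := by
  simpa [truncL] using norm_diagL_le (truncL_bound n) x

theorem tendsto_truncL (x : SeqE) : Tendsto (fun n => truncL n x) atTop (nhds x) := by
  rw [tendsto_iff_norm_sub_tendsto_zero]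
  have h1 : ∀ n, ‖truncL n x - x‖ ^ 2 = ‖x‖ ^ 2 - ∑ k ∈ Finset.range n, x k ^ 2 := by
    intro n
    have h2 := seq_hasSum_sq (truncL n x - x)
    have h3 := (seq_hasSum_sq x).sub (hasSum_sum_of_ne_finset_zero
      (f := fun k => if k < n then x k ^ 2 else 0) (s := Finset.range n) (by
        intro k hk; simp at hk; simp [hk]))
    have h4 := h2.unique (h3.congr_fun ?_)
    · rw [h4]; congr 1
      exact Finset.sum_congr rfl fun k hk => by simp [Finset.mem_range.1 hk]
    · intro k
      have : (truncL n x - x) k = truncL n x k - x k := rfl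
      rw [this, truncL_apply]; split_ifs <;> simp
  have h5 : Tendsto (fun n => ‖truncL n x - x‖ ^ 2) atTop (nhds 0) := by
    simp_rw [h1]
    have := (seq_hasSum_sq x).tendsto_sum_nat.const_sub (‖x‖ ^ 2)
    rwa [sub_self] at this
  have := h5.sqrt
  simpa [Real.sqrt_sq] using this

/-- Weak convergence from bounded norms and coordinatewise convergence. -/
theorem tendsto_inner_of_coord {x : ℕ → SeqE} {x₀ : SeqE} {R : ℝ} (hR : ∀ n, ‖x n‖ ≤ R)
    (h : ∀ k, Tendsto (fun n => x n k) atTop (nhds (x₀ k))) (z : SeqE) :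
    Tendsto (fun n => ⟪x n, z⟫_ℝ) atTop (nhds ⟪x₀, z⟫_ℝ) := by
  have hR0 : 0 ≤ R := (norm_nonneg _).trans (hR 0)
  rw [Metric.tendsto_atTop]
  intro ε hε
  obtain ⟨m, hm⟩ := (Metric.tendsto_atTop.1 (tendsto_truncL z)) (ε / (2 * (R + ‖x₀‖ + 1)))
    (by positivity)
  specialize hm m le_rfl
  rw [dist_eq_norm] at hm
  have hfin : ∀ y : SeqE, ⟪y, truncL m z⟫_ℝ = ∑ k ∈ Finset.range m, y k * z k := by
    intro y
    refine (seq_hasSum_inner y (truncL m z)).unique ?_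
    have : HasSum (fun k => y k * truncL m z k) _ :=
      hasSum_sum_of_ne_finset_zero (s := Finset.range m) (by
        intro k hk; simp at hk; simp [truncL_apply, hk])
    convert this using 1
    exact Finset.sum_congr rfl fun k hk => by simp [truncL_apply, Finset.mem_range.1 hk]
  have hlim : Tendsto (fun n => ⟪x n, truncL m z⟫_ℝ) atTop (nhds ⟪x₀, truncL m z⟫_ℝ) := by
    simp_rw [hfin]
    exact tendsto_finsetSum _ fun k _ => (h k).mul_const _
  obtain ⟨N, hN⟩ := (Metric.tendsto_atTop.1 hlim) (ε / 2) (by positivity)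
  refine ⟨N, fun n hn => ?_⟩
  specialize hN n hn
  rw [Real.dist_eq] at hN ⊢
  have e1 : ⟪x n, z⟫_ℝ - ⟪x₀, z⟫_ℝ = (⟪x n, truncL m z⟫_ℝ - ⟪x₀, truncL m z⟫_ℝ)
      - ⟪x n - x₀, truncL m z - z⟫_ℝ := by
    simp only [inner_sub_left, inner_sub_right]; ring
  have e2 : |⟪x n - x₀, truncL m z - z⟫_ℝ| ≤ (R + ‖x₀‖) * (ε / (2 * (R + ‖x₀‖ + 1))) := by
    refine (abs_real_inner_le_norm _ _).trans ?_
    have : ‖x n - x₀‖ ≤ R + ‖x₀‖ := (norm_sub_le _ _).trans (by linarith [hR n])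
    gcongr
  have e3 : (R + ‖x₀‖) * (ε / (2 * (R + ‖x₀‖ + 1))) < ε / 2 := by
    have : 0 < R + ‖x₀‖ + 1 := by positivity
    rw [mul_div_assoc', div_lt_div_iff₀ (by positivity) (by positivity)]
    nlinarith
  rw [e1]
  calc _ ≤ _ := abs_sub _ _
    _ < ε := by linarith

/-- A curve in the sequence space with continuous coordinates and a uniform square summable bound
is continuous. -/
theorem continuousOn_seq {X : Type*} [TopologicalSpace X] {s : Set X} {x : X → SeqE} {c : ℕ → ℝ}
    (hc : Summable c) (hb : ∀ t ∈ s, ∀ k, x t k ^ 2 ≤ c k)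
    (hcont : ∀ k, ContinuousOn (fun t => x t k) s) : ContinuousOn x s := by
  intro t₀ ht₀
  have key : Tendsto (fun t => ∑' k, (x t k - x t₀ k) ^ 2) (nhdsWithin t₀ s) (nhds (∑' _k : ℕ, 0)) := by
    refine tendsto_tsum_of_dominated_convergence (bound := fun k => 4 * c k) (hc.mul_left 4) ?_ ?_
    · intro k
      have := ((hcont k t₀ ht₀).sub_const (x t₀ k)).pow 2
      simpa using this
    · filter_upwards [self_mem_nhdsWithin] with t ht k
      rw [Real.norm_of_nonneg (sq_nonneg _)]
      nlinarith [hb t ht k, hb t₀ ht₀ k, sq_nonneg (x t k + x t₀ k)]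
  rw [tsum_zero] at key
  rw [ContinuousWithinAt, tendsto_iff_norm_sub_tendsto_zero]
  have h2 : ∀ t, ∑' k, (x t k - x t₀ k) ^ 2 = ‖x t - x t₀‖ ^ 2 := fun t =>
    (seq_hasSum_sq (x t - x t₀)).tsum_eq
  simp_rw [h2] at key
  simpa [Real.sqrt_sq] using key.sqrt

theorem seq_sub (x y : SeqE) (k : ℕ) : (x - y) k = x k - y k := rfl
theorem seq_add (x y : SeqE) (k : ℕ) : (x + y) k = x k + y k := rfl
theorem seq_smul (c : ℝ) (x : SeqE) (k : ℕ) : (c • x) k = c * x k := rfl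

/-- `X` is on `[0,T]` the primitive of the integrable function `r`. -/
def IsPrim {Z : Type*} [NormedAddCommGroup Z] [NormedSpace ℝ Z] (T : ℝ) (X r : ℝ → Z) : Prop :=
  IntervalIntegrable r volume 0 T ∧ ∀ t ∈ Icc 0 T, X t = X 0 + ∫ s in (0 : ℝ)..t, r s

theorem AbsolutelyContinuousOnInterval.of_dist_le {X : Type*} [PseudoMetricSpace X]
    {F : ℝ → X} {g : ℝ → ℝ} {a b C : ℝ}
    (hg : AbsolutelyContinuousOnInterval g a b)
    (h : ∀ s ∈ uIcc a b, ∀ t ∈ uIcc a b, dist (F s) (F t) ≤ C * dist (g s) (g t)) :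
    AbsolutelyContinuousOnInterval F a b := by
  unfold AbsolutelyContinuousOnInterval at hg ⊢
  have h0 := hg.const_mul C
  rw [mul_zero] at h0
  refine squeeze_zero' (Eventually.of_forall fun E => Finset.sum_nonneg fun _ _ => dist_nonneg) ?_ h0
  rw [eventually_inf_principal]
  refine Eventually.of_forall fun E hE => ?_
  rw [Finset.mul_sum]
  exact Finset.sum_le_sum fun i hi => h _ (hE.1 i hi).1 _ (hE.1 i hi).2

section
variable {Z : Type*} [NormedAddCommGroup Z] [NormedSpace ℝ Z] {T : ℝ} {X r : ℝ → Z}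

theorem IntervalIntegrable.sub_right {E : Type*} [NormedAddCommGroup E] {f : ℝ → E} {t : ℝ}
    (h : IntervalIntegrable f volume 0 T) (ht : t ∈ Icc 0 T) : IntervalIntegrable f volume 0 t :=
  h.mono_set (by rw [uIcc_of_le ht.1, uIcc_of_le (ht.1.trans ht.2)]; exact Icc_subset_Icc_right ht.2)

theorem IsPrim.mono {t : ℝ} (h : IsPrim T X r) (ht : t ∈ Icc 0 T) : IsPrim t X r :=
  ⟨h.1.sub_right ht, fun s hs => h.2 s ⟨hs.1, hs.2.trans ht.2⟩⟩

theorem IsPrim.sub_eq (h : IsPrim T X r) {s t : ℝ} (hs : s ∈ Icc 0 T) (ht : t ∈ Icc 0 T) :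
    X t - X s = ∫ τ in s..t, r τ := by
  rw [h.2 t ht, h.2 s hs, ← intervalIntegral.integral_interval_sub_left
    (h.1.sub_right ht) (h.1.sub_right hs)]
  abel

theorem IsPrim.dist_le (hT : 0 ≤ T) (h : IsPrim T X r) :
    ∀ s ∈ uIcc 0 T, ∀ t ∈ uIcc 0 T, dist (X s) (X t) ≤
      1 * dist (∫ τ in (0 : ℝ)..s, ‖r τ‖) (∫ τ in (0 : ℝ)..t, ‖r τ‖) := by
  intro s hs t ht
  rw [uIcc_of_le hT] at hs ht
  rw [dist_comm, dist_eq_norm, h.sub_eq hs ht, one_mul, dist_comm, Real.dist_eq,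
    intervalIntegral.integral_interval_sub_left (h.1.norm.sub_right ht) (h.1.norm.sub_right hs)]
  exact intervalIntegral.norm_integral_le_abs_integral_norm

theorem IsPrim.absolutelyContinuous (hT : 0 ≤ T) (h : IsPrim T X r) :
    AbsolutelyContinuousOnInterval X 0 T :=
  AbsolutelyContinuousOnInterval.of_dist_le
    (h.1.norm.absolutelyContinuousOnInterval_intervalIntegral (c := 0) (by simp)) (h.dist_le hT)

theorem IsPrim.continuousOn (hT : 0 ≤ T) (h : IsPrim T X r) : ContinuousOn X (Icc 0 T) := by
  have := (h.absolutelyContinuous hT).continuousOn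
  rwa [uIcc_of_le hT] at this

theorem IsPrim.ae_hasDerivAt [CompleteSpace Z] (h : IsPrim T X r) :
    ∀ᵐ t, t ∈ Ioo 0 T → HasDerivAt X (r t) t := by
  filter_upwards [h.1.ae_hasDerivAt_integral] with t ht hti
  have hT : 0 ≤ T := (hti.1.trans hti.2).le
  have h1 := ht (by rw [uIcc_of_le hT]; exact ⟨hti.1.le, hti.2.le⟩) 0 (by simp)
  have h2 := h1.const_add (X 0)
  refine h2.congr_of_eventuallyEq ?_
  filter_upwards [Ioo_mem_nhds hti.1 hti.2] with s hs
  exact h.2 s ⟨hs.1.le, hs.2.le⟩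

/-- Fundamental theorem of calculus for absolutely continuous functions with a known derivative. -/
theorem IsPrim.of_ac {F f : ℝ → ℝ} (hT : 0 ≤ T) (hF : AbsolutelyContinuousOnInterval F 0 T)
    (hf : ∀ᵐ t, t ∈ Ioo 0 T → HasDerivAt F (f t) t) : IsPrim T F f := by
  have hae : ∀ᵐ t, t ∈ Ioc 0 T → deriv F t = f t := by
    have : ∀ᵐ t : ℝ, t ≠ T := by simp [ae_iff, measure_singleton]
    filter_upwards [hf, this] with t ht htT hti
    exact (ht ⟨hti.1, lt_of_le_of_ne hti.2 htT⟩).deriv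
  refine ⟨?_, fun t ht => ?_⟩
  · have := hF.intervalIntegrable_deriv
    refine this.congr_ae ?_
    rw [uIoc_of_le hT]
    exact (ae_restrict_iff' measurableSet_Ioc).2 hae
  · have h1 : AbsolutelyContinuousOnInterval F 0 t := hF.mono (by
      rw [uIcc_of_le ht.1, uIcc_of_le hT]; exact Icc_subset_Icc_right ht.2)
    have h2 := h1.integral_deriv_eq_sub
    have h3 : ∫ s in (0 : ℝ)..t, f s = ∫ s in (0 : ℝ)..t, deriv F s := by
      refine intervalIntegral.integral_congr_ae ?_
      filter_upwards [hae] with s hs hsi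
      rw [uIoc_of_le ht.1] at hsi
      exact (hs ⟨hsi.1, hsi.2.trans ht.2⟩).symm
    rw [h3, h2]; ring

/-- Chain rule for primitives of Bochner integrable functions. -/
theorem IsPrim.comp [CompleteSpace Z] (hT : 0 ≤ T) (h : IsPrim T X r) {G : Z → ℝ}
    {G' : Z → Z →L[ℝ] ℝ} (hG : ∀ z, HasFDerivAt G (G' z) z)
    (hb : ∀ R, ∃ C, ∀ z, ‖z‖ ≤ R → ‖G' z‖ ≤ C) :
    IsPrim T (fun t => G (X t)) (fun t => G' (X t) (r t)) := by
  obtain ⟨R, hR⟩ : ∃ R, ∀ t ∈ Icc 0 T, ‖X t‖ ≤ R :=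
    isCompact_Icc.exists_bound_of_continuousOn (h.continuousOn hT)
  obtain ⟨C, hC⟩ := hb R
  have hlip : ∀ s ∈ uIcc 0 T, ∀ t ∈ uIcc 0 T, dist (G (X s)) (G (X t)) ≤
      C * dist (∫ τ in (0 : ℝ)..s, ‖r τ‖) (∫ τ in (0 : ℝ)..t, ‖r τ‖) := by
    intro s hs t ht
    have h1 := h.dist_le hT s hs t ht
    rw [uIcc_of_le hT] at hs ht
    have hC0 : 0 ≤ C := (norm_nonneg _).trans (hC _ (hR s hs))
    have h2 : ‖G (X s) - G (X t)‖ ≤ C * ‖X s - X t‖ := by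
      refine Convex.norm_image_sub_le_of_norm_hasFDerivWithin_le (s := Metric.closedBall 0 R)
        (f' := G') (fun z _ => (hG z).hasFDerivWithinAt) (fun z hz => hC z (by simpa using hz))
        (convex_closedBall _ _) (by simpa using hR t ht) (by simpa using hR s hs)
    rw [← dist_eq_norm, ← dist_eq_norm] at h2
    exact h2.trans (mul_le_mul_of_nonneg_left (by simpa using h1) hC0)
  refine IsPrim.of_ac hT (AbsolutelyContinuousOnInterval.of_dist_le
    (h.1.norm.absolutelyContinuousOnInterval_intervalIntegral (c := 0) (by simp)) hlip) ?_
  filter_upwards [h.ae_hasDerivAt] with t ht hti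
  exact (hG (X t)).comp_hasDerivAt t (ht hti)

theorem IsPrim.prod {Y : Type*} [NormedAddCommGroup Y] [NormedSpace ℝ Y] [CompleteSpace Y]
    [CompleteSpace Z] {U q : ℝ → Y} (h : IsPrim T X r) (h' : IsPrim T U q) :
    IsPrim T (fun t => (X t, U t)) (fun t => (r t, q t)) := by
  have hi : ∀ t, IntervalIntegrable r volume 0 t → IntervalIntegrable q volume 0 t →
      IntervalIntegrable (fun t => (r t, q t)) volume 0 t := fun t a b =>
    ⟨a.1.prodMk b.1, a.2.prodMk b.2⟩
  refine ⟨hi T h.1 h'.1, fun t ht => ?_⟩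
  have i1 := h.1.sub_right ht
  have i2 := h'.1.sub_right ht
  have e1 := (ContinuousLinearMap.fst ℝ Z Y).intervalIntegral_comp_comm (hi t i1 i2)
  have e2 := (ContinuousLinearMap.snd ℝ Z Y).intervalIntegral_comp_comm (hi t i1 i2)
  simp only [ContinuousLinearMap.coe_fst', ContinuousLinearMap.coe_snd'] at e1 e2
  refine Prod.ext ?_ ?_
  · simp only [Prod.fst_add]; rw [← e1]; exact h.2 t ht
  · simp only [Prod.snd_add]; rw [← e2]; exact h'.2 t ht

theorem IsPrim.clm {Y : Type*} [NormedAddCommGroup Y] [NormedSpace ℝ Y] [CompleteSpace Y]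
    [CompleteSpace Z] (L : Z →L[ℝ] Y) (h : IsPrim T X r) :
    IsPrim T (fun t => L (X t)) (fun t => L (r t)) := by
  refine ⟨⟨L.integrable_comp h.1.1, L.integrable_comp h.1.2⟩, fun t ht => ?_⟩
  beta_reduce
  rw [L.intervalIntegral_comp_comm (h.1.sub_right ht), h.2 t ht, map_add]

theorem IsPrim.congr_ae {r' : ℝ → Z} (hT : 0 ≤ T) (h : IsPrim T X r)
    (hr : r =ᵐ[volume.restrict (Ioc 0 T)] r') : IsPrim T X r' := by
  refine ⟨h.1.congr_ae (by rwa [uIoc_of_le hT]), fun t ht => ?_⟩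
  rw [h.2 t ht]
  congr 1
  refine intervalIntegral.integral_congr_ae ?_
  filter_upwards [(ae_restrict_iff' measurableSet_Ioc).1 hr] with s hs hsi
  rw [uIoc_of_le ht.1] at hsi
  exact hs ⟨hsi.1, hsi.2.trans ht.2⟩

theorem IsPrim.of_hasDerivAt [CompleteSpace Z] (hT : 0 ≤ T) (h : ∀ t ∈ Icc 0 T, HasDerivAt X (r t) t)
    (hr : ContinuousOn r (Icc 0 T)) : IsPrim T X r := by
  have hi : ∀ t ∈ Icc 0 T, IntervalIntegrable r volume 0 t := fun t ht =>
    (hr.mono (by rw [uIcc_of_le ht.1]; exact Icc_subset_Icc_right ht.2)).intervalIntegrable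
  refine ⟨hi T ⟨hT, le_rfl⟩, fun t ht => ?_⟩
  rw [intervalIntegral.integral_eq_sub_of_hasDerivAt (fun s hs => h s ?_) (hi t ht)]
  · abel
  · rw [uIcc_of_le ht.1] at hs; exact ⟨hs.1, hs.2.trans ht.2⟩

theorem IsPrim.of_integral {x₀ : Z} (hr : IntervalIntegrable r volume 0 T) :
    IsPrim T (fun t => x₀ + ∫ s in (0 : ℝ)..t, r s) r :=
  ⟨hr, fun t _ => by simp⟩

theorem IsPrim.add {X' r' : ℝ → Z} (h : IsPrim T X r) (h' : IsPrim T X' r') :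
    IsPrim T (fun t => X t + X' t) (fun t => r t + r' t) := by
  refine ⟨h.1.add h'.1, fun t ht => ?_⟩
  beta_reduce
  rw [intervalIntegral.integral_add (h.1.sub_right ht) (h'.1.sub_right ht), h.2 t ht, h'.2 t ht]
  abel

theorem IsPrim.sub {X' r' : ℝ → Z} (h : IsPrim T X r) (h' : IsPrim T X' r') :
    IsPrim T (fun t => X t - X' t) (fun t => r t - r' t) := by
  refine ⟨h.1.sub h'.1, fun t ht => ?_⟩
  beta_reduce
  rw [intervalIntegral.integral_sub (h.1.sub_right ht) (h'.1.sub_right ht), h.2 t ht, h'.2 t ht]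
  abel

theorem IsPrim.const_mul {F f : ℝ → ℝ} (c : ℝ) (h : IsPrim T F f) :
    IsPrim T (fun t => c * F t) (fun t => c * f t) := by
  simpa using h.clm (ContinuousLinearMap.mul ℝ ℝ c)

end

/-- Product rule for inner products of primitives. -/
theorem IsPrim.inner {Z : Type*} [NormedAddCommGroup Z] [InnerProductSpace ℝ Z] [CompleteSpace Z]
    {T : ℝ} {X r U q : ℝ → Z} (hT : 0 ≤ T) (h : IsPrim T X r) (h' : IsPrim T U q) :
    IsPrim T (fun t => ⟪X t, U t⟫_ℝ) (fun t => ⟪X t, q t⟫_ℝ + ⟪r t, U t⟫_ℝ) := by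
  have hb : IsBoundedBilinearMap ℝ fun p : Z × Z => ⟪p.1, p.2⟫_ℝ := isBoundedBilinearMap_inner
  refine (h.prod h').comp hT (fun z => hb.hasFDerivAt z) ?_
  intro R
  obtain ⟨C, hC⟩ : ∃ C, ∀ z : Z × Z, ‖hb.deriv z‖ ≤ C * ‖z‖ := by
    exact ⟨_, hb.isBoundedLinearMap_deriv.bound.choose_spec.2⟩
  refine ⟨|C| * R, fun z hz => (hC z).trans ?_⟩
  exact mul_le_mul (le_abs_self C) hz (norm_nonneg _) (abs_nonneg _)

theorem IsPrim.mul {T : ℝ} {F f G g : ℝ → ℝ} (hT : 0 ≤ T) (h : IsPrim T F f) (h' : IsPrim T G g) :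
    IsPrim T (fun t => F t * G t) (fun t => F t * g t + f t * G t) := by
  have := IsPrim.inner hT h h'
  simpa [mul_comm] using this

theorem IsPrim.half_sq {T : ℝ} {F f : ℝ → ℝ} (hT : 0 ≤ T) (h : IsPrim T F f) :
    IsPrim T (fun t => 1 / 2 * F t ^ 2) (fun t => F t * f t) := by
  have := (IsPrim.mul hT h h).const_mul (1 / 2)
  convert this using 2 <;> ring

/-- Square integrability in time on `(0,T)`. -/
abbrev L2T {Z : Type*} [NormedAddCommGroup Z] (T : ℝ) (r : ℝ → Z) : Prop :=
  MemLp r 2 (volume.restrict (Ioc 0 T))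

section
variable {Z : Type*} [NormedAddCommGroup Z] {T : ℝ} {r q : ℝ → Z}

theorem L2T.intervalIntegrable (hT : 0 ≤ T) (h : L2T T r) : IntervalIntegrable r volume 0 T := by
  rw [intervalIntegrable_iff, uIoc_of_le hT]
  exact h.integrable one_le_two

theorem L2T.sq (hT : 0 ≤ T) (h : L2T T r) :
    IntervalIntegrable (fun t => ‖r t‖ ^ 2) volume 0 T := by
  rw [intervalIntegrable_iff, uIoc_of_le hT]
  exact h.integrable_norm_pow two_ne_zero

theorem L2T.mono {t : ℝ} (h : L2T T r) (ht : t ≤ T) : L2T t r :=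
  h.mono_measure (Measure.restrict_mono_set _ (Ioc_subset_Ioc_right ht))

theorem L2T.of_continuousOn (hr : ContinuousOn r (Icc 0 T)) : L2T T r := by
  obtain ⟨C, hC⟩ := isCompact_Icc.exists_bound_of_continuousOn hr
  refine MemLp.of_bound ((hr.mono Ioc_subset_Icc_self).aestronglyMeasurable measurableSet_Ioc) C ?_
  filter_upwards [ae_restrict_mem measurableSet_Ioc] with t ht
  exact hC t (Ioc_subset_Icc_self ht)

theorem L2T.inner [InnerProductSpace ℝ Z] (hT : 0 ≤ T) (h : L2T T r) (h' : L2T T q) :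
    IntervalIntegrable (fun t => ⟪r t, q t⟫_ℝ) volume 0 T := by
  rw [intervalIntegrable_iff, uIoc_of_le hT]
  refine Integrable.mono' ((h.integrable_norm_pow two_ne_zero).add
    (h'.integrable_norm_pow two_ne_zero)) (h.1.inner h'.1) (Eventually.of_forall fun t => ?_)
  refine (norm_inner_le_norm (𝕜 := ℝ) _ _).trans ?_
  simp only [Pi.add_apply]
  nlinarith [sq_nonneg (‖r t‖ - ‖q t‖), sq_nonneg (‖r t‖), sq_nonneg (‖q t‖)]

end

theorem L2T.coord {T : ℝ} {r : ℝ → SeqE} (h : L2T T r) (k : ℕ) : L2T T (fun t => r t k) :=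
  (coordL k).comp_memLp' h

theorem hasSum_integral_inner {T : ℝ} {r q : ℝ → SeqE} (hT : 0 ≤ T) (h : L2T T r) (h' : L2T T q) :
    HasSum (fun k => ∫ t in (0 : ℝ)..T, r t k * q t k) (∫ t in (0 : ℝ)..T, ⟪r t, q t⟫_ℝ) := by
  have hs : ∀ t, HasSum (fun k => r t k ^ 2 + q t k ^ 2) (‖r t‖ ^ 2 + ‖q t‖ ^ 2) := fun t =>
    (seq_hasSum_sq _).add (seq_hasSum_sq _)
  refine intervalIntegral.hasSum_integral_of_dominated_convergence
    (bound := fun k t => r t k ^ 2 + q t k ^ 2) ?_ ?_ ?_ ?_ ?_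
  · intro k
    rw [uIoc_of_le hT]
    exact (h.coord k).1.mul (h'.coord k).1
  · intro k
    refine Eventually.of_forall fun t _ => ?_
    rw [norm_mul, Real.norm_eq_abs, Real.norm_eq_abs]
    nlinarith [sq_nonneg (|r t k| - |q t k|), sq_abs (r t k), sq_abs (q t k),
      sq_nonneg (|r t k|), sq_nonneg (|q t k|)]
  · exact Eventually.of_forall fun t _ => (hs t).summable
  · simp_rw [fun t => (hs t).tsum_eq]
    exact (h.sq hT).add (h'.sq hT)
  · exact Eventually.of_forall fun t _ => seq_hasSum_inner _ _

theorem hasSum_integral_sq {T : ℝ} {r : ℝ → SeqE} (hT : 0 ≤ T) (h : L2T T r) :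
    HasSum (fun k => ∫ t in (0 : ℝ)..T, r t k ^ 2) (∫ t in (0 : ℝ)..T, ‖r t‖ ^ 2) := by
  have := hasSum_integral_inner hT h h
  simpa [← sq, real_inner_self_eq_norm_sq] using this

/-- Measurability of a curve in the sequence space from that of its coordinates. -/
theorem aestronglyMeasurable_seq {α : Type*} [MeasurableSpace α] {μ : Measure α} {y : α → SeqE}
    (h : ∀ k, AEStronglyMeasurable (fun t => y t k) μ) : AEStronglyMeasurable y μ := by
  refine aestronglyMeasurable_of_tendsto_ae atTop (f := fun n t => truncL n (y t)) (fun n => ?_)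
    (Eventually.of_forall fun t => tendsto_truncL (y t))
  have : (fun t => truncL n (y t)) =
      fun t => ∑ k ∈ Finset.range n, y t k • lp.single 2 k (1 : ℝ) := by
    funext t
    refine seq_ext fun j => ?_
    rw [truncL_apply, ← coordL_apply j (∑ k ∈ Finset.range n, _), map_sum]
    simp [lp.single_apply, Pi.single_apply]
  rw [this]
  exact Finset.aestronglyMeasurable_fun_sum _ fun k _ => (h k).smul_const _

/-- A square integrable curve in the sequence space with prescribed coordinates. -/
theorem exists_seq_curve {T : ℝ} (hT : 0 ≤ T) {Y : ℕ → ℝ → ℝ} {c : ℕ → ℝ} (hY : ∀ k, L2T T (Y k))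
    (hc : Summable c) (hb : ∀ k, ∫ t in (0 : ℝ)..T, Y k t ^ 2 ≤ c k) :
    ∃ y : ℝ → SeqE, L2T T y ∧ ∀ᵐ t ∂volume.restrict (Ioc 0 T), ∀ k, y t k = Y k t := by
  classical
  have hint : ∀ k, ∫⁻ t in Ioc 0 T, ENNReal.ofReal (Y k t ^ 2) =
      ENNReal.ofReal (∫ t in (0 : ℝ)..T, Y k t ^ 2) := by
    intro k
    rw [intervalIntegral.integral_of_le hT, ofReal_integral_eq_lintegral_ofReal]
    · simpa using (hY k).integrable_norm_pow two_ne_zero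
    · exact Eventually.of_forall fun t => sq_nonneg _
  have hsum : ∑' k, ∫⁻ t in Ioc 0 T, ENNReal.ofReal (Y k t ^ 2) < ⊤ := by
    have hs : Summable fun k => ∫ t in (0 : ℝ)..T, Y k t ^ 2 :=
      Summable.of_nonneg_of_le (fun k => intervalIntegral.integral_nonneg hT
        fun _ _ => sq_nonneg _) hb hc
    simp_rw [hint]
    exact (hs.tsum_ofReal_lt_top)
  have hmeas : ∀ k, AEMeasurable (fun t => ENNReal.ofReal (Y k t ^ 2))
      (volume.restrict (Ioc 0 T)) := fun k => ((hY k).1.aemeasurable.pow_const 2).ennreal_ofReal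
  rw [← lintegral_tsum hmeas] at hsum
  have hae : ∀ᵐ t ∂volume.restrict (Ioc 0 T), Summable fun k => Y k t ^ 2 := by
    filter_upwards [ae_lt_top' (AEMeasurable.tsum hmeas) hsum.ne] with t ht
    have := ENNReal.summable_toReal ht.ne
    refine this.congr fun k => ?_
    rw [ENNReal.toReal_ofReal (sq_nonneg _)]
  set y : ℝ → SeqE := fun t => if h : Summable fun k => Y k t ^ 2 then seqMk _ h else 0 with hy
  have hyk : ∀ᵐ t ∂volume.restrict (Ioc 0 T), ∀ k, y t k = Y k t := by
    filter_upwards [hae] with t ht k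
    simp only [hy, dif_pos ht, seqMk_apply]
  have hym : AEStronglyMeasurable y (volume.restrict (Ioc 0 T)) :=
    aestronglyMeasurable_seq fun k => (hY k).1.congr (by
      filter_upwards [hyk] with t ht using (ht k).symm)
  refine ⟨y, (memLp_two_iff_integrable_sq_norm hym).2 ⟨hym.norm.pow 2, ?_⟩, hyk⟩
  rw [hasFiniteIntegral_iff_ofReal (Eventually.of_forall fun t => sq_nonneg _)]
  refine lt_of_le_of_lt (lintegral_mono_ae ?_) hsum
  filter_upwards [hyk] with t ht
  rw [← (seq_hasSum_sq (y t)).tsum_eq, ENNReal.ofReal_tsum_of_nonneg (fun _ => sq_nonneg _)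
    (seq_hasSum_sq (y t)).summable]
  simp_rw [ht]; exact le_rfl

/-- The diagonal heat equation `θ' + ω y = ω ρ`, `y = ω θ`. -/
structure HeatSol (om : ℕ → ℝ) (T : ℝ) (θ y ρ : ℝ → SeqE) : Prop where
  cont : ContinuousOn θ (Icc 0 T)
  y2 : L2T T y
  ρ2 : L2T T ρ
  yθ : ∀ᵐ t ∂volume.restrict (Ioc 0 T), ∀ k, y t k = om k * θ t k
  mode : ∀ k, IsPrim T (fun t => θ t k) (fun t => om k * (ρ t k - y t k))

/-- The diagonal wave equation `v' = -λ w + h`, `w' = λ v`. -/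
structure WaveSol (lam : ℕ → ℝ) (T : ℝ) (v w h : ℝ → SeqE) : Prop where
  contv : ContinuousOn v (Icc 0 T)
  contw : ContinuousOn w (Icc 0 T)
  h2 : L2T T h
  modev : ∀ k, IsPrim T (fun t => v t k) (fun t => -lam k * w t k + h t k)
  modew : ∀ k, IsPrim T (fun t => w t k) (fun t => lam k * v t k)

theorem HeatSol.mono {om : ℕ → ℝ} {T t : ℝ} {θ y ρ : ℝ → SeqE} (h : HeatSol om T θ y ρ)
    (ht : t ∈ Icc 0 T) : HeatSol om t θ y ρ :=
  ⟨h.cont.mono (Icc_subset_Icc_right ht.2), h.y2.mono ht.2, h.ρ2.mono ht.2,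
    ae_mono (Measure.restrict_mono_set _ (Ioc_subset_Ioc_right ht.2)) h.yθ,
    fun k => (h.mode k).mono ht⟩

theorem WaveSol.mono {lam : ℕ → ℝ} {T t : ℝ} {v w h : ℝ → SeqE} (H : WaveSol lam T v w h)
    (ht : t ∈ Icc 0 T) : WaveSol lam t v w h :=
  ⟨H.contv.mono (Icc_subset_Icc_right ht.2), H.contw.mono (Icc_subset_Icc_right ht.2),
    H.h2.mono ht.2, fun k => (H.modev k).mono ht, fun k => (H.modew k).mono ht⟩

theorem HeatSol.sub {om : ℕ → ℝ} {T : ℝ} {θ y ρ θ' y' ρ' : ℝ → SeqE} (h : HeatSol om T θ y ρ)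
    (h' : HeatSol om T θ' y' ρ') :
    HeatSol om T (fun t => θ t - θ' t) (fun t => y t - y' t) (fun t => ρ t - ρ' t) := by
  refine ⟨h.cont.sub h'.cont, h.y2.sub h'.y2, h.ρ2.sub h'.ρ2, ?_, fun k => ?_⟩
  · filter_upwards [h.yθ, h'.yθ] with t h1 h2 k
    simp only [seq_sub, h1 k, h2 k]; ring
  · have := (h.mode k).sub (h'.mode k)
    exact (congrArg (IsPrim T _) (funext fun t => by
      simp only [seq_sub]; ring)).mp this

theorem WaveSol.sub {lam : ℕ → ℝ} {T : ℝ} {v w h v' w' h' : ℝ → SeqE} (H : WaveSol lam T v w h)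
    (H' : WaveSol lam T v' w' h') :
    WaveSol lam T (fun t => v t - v' t) (fun t => w t - w' t) (fun t => h t - h' t) := by
  refine ⟨H.contv.sub H'.contv, H.contw.sub H'.contw, H.h2.sub H'.h2, fun k => ?_, fun k => ?_⟩
  · have := (H.modev k).sub (H'.modev k)
    exact (congrArg (IsPrim T _) (funext fun t => by
      simp only [seq_sub]; ring)).mp this
  · have := (H.modew k).sub (H'.modew k)
    exact (congrArg (IsPrim T _) (funext fun t => by
      simp only [seq_sub]; ring)).mp this

theorem HeatSol.energy {om : ℕ → ℝ} {T : ℝ} {θ y ρ : ℝ → SeqE} (h : HeatSol om T θ y ρ)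
    {t : ℝ} (ht : t ∈ Icc 0 T) :
    1 / 2 * ‖θ t‖ ^ 2 = 1 / 2 * ‖θ 0‖ ^ 2 + ∫ s in (0 : ℝ)..t, ⟪y s, ρ s - y s⟫_ℝ := by
  have h' := h.mono ht
  have h0 : (0 : ℝ) ≤ t := ht.1
  have hs := ((seq_hasSum_sq (θ 0)).mul_left (1 / 2)).add
    (hasSum_integral_inner h0 h'.y2 (h'.ρ2.sub h'.y2))
  refine HasSum.unique ((seq_hasSum_sq (θ t)).mul_left (1 / 2)) (hs.congr_fun fun k => ?_)
  have h1 := ((h'.mode k).half_sq h0).2 t ⟨h0, le_rfl⟩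
  refine h1.trans ?_
  congr 1
  rw [intervalIntegral.integral_of_le h0, intervalIntegral.integral_of_le h0]
  refine integral_congr_ae ?_
  filter_upwards [h'.yθ] with s hs
  simp only [Pi.sub_apply, seq_sub, hs k]; ring

theorem WaveSol.energy {lam : ℕ → ℝ} {T : ℝ} {v w h : ℝ → SeqE} (H : WaveSol lam T v w h)
    {t : ℝ} (ht : t ∈ Icc 0 T) :
    1 / 2 * (‖v t‖ ^ 2 + ‖w t‖ ^ 2) = 1 / 2 * (‖v 0‖ ^ 2 + ‖w 0‖ ^ 2) +
      ∫ s in (0 : ℝ)..t, ⟪v s, h s⟫_ℝ := by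
  have H' := H.mono ht
  have h0 : (0 : ℝ) ≤ t := ht.1
  have hs := (((seq_hasSum_sq (v 0)).add (seq_hasSum_sq (w 0))).mul_left (1 / 2)).add
    (hasSum_integral_inner h0 (L2T.of_continuousOn H'.contv) H'.h2)
  refine HasSum.unique (((seq_hasSum_sq (v t)).add (seq_hasSum_sq (w t))).mul_left (1 / 2))
    (hs.congr_fun fun k => ?_)
  have h1 := (((H'.modev k).half_sq h0).add ((H'.modew k).half_sq h0)).2 t ⟨h0, le_rfl⟩
  have e1 : ∀ x y : ℝ, 1 / 2 * (x ^ 2 + y ^ 2) = 1 / 2 * x ^ 2 + 1 / 2 * y ^ 2 := by intros; ring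
  rw [e1, e1]
  refine h1.trans ?_
  congr 1
  refine intervalIntegral.integral_congr fun s _ => ?_
  ring

theorem isPrim_exp (T c : ℝ) (hT : 0 ≤ T) :
    IsPrim T (fun t => Real.exp (c * t)) (fun t => c * Real.exp (c * t)) :=
  IsPrim.of_hasDerivAt hT (fun t _ => by
    simpa [mul_comm] using ((hasDerivAt_id t).const_mul c).exp) (by fun_prop)

theorem heat_mode {T c : ℝ} (hT : 0 ≤ T) (x₀ : ℝ) {r : ℝ → ℝ} (hr : IntervalIntegrable r volume 0 T) :
    ∃ x : ℝ → ℝ, x 0 = x₀ ∧ IsPrim T x (fun t => r t - c * x t) := by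
  have hi : IntervalIntegrable (fun s => Real.exp (c * s) * r s) volume 0 T :=
    hr.continuousOn_mul (by fun_prop)
  refine ⟨fun t => Real.exp (-c * t) * (x₀ + ∫ s in (0 : ℝ)..t, Real.exp (c * s) * r s),
    by simp, ?_⟩
  refine (congrArg (IsPrim T _) (funext fun t => ?_)).mp
    (IsPrim.mul hT (isPrim_exp T (-c) hT) (IsPrim.of_integral (x₀ := x₀) hi))
  rw [← mul_assoc, ← Real.exp_add]
  simp; ring

theorem isPrim_cos (T c : ℝ) (hT : 0 ≤ T) :
    IsPrim T (fun t => Real.cos (c * t)) (fun t => -c * Real.sin (c * t)) :=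
  IsPrim.of_hasDerivAt hT (fun t _ => by
    simpa [mul_comm] using ((hasDerivAt_id t).const_mul c).cos) (by fun_prop)

theorem isPrim_sin (T c : ℝ) (hT : 0 ≤ T) :
    IsPrim T (fun t => Real.sin (c * t)) (fun t => c * Real.cos (c * t)) :=
  IsPrim.of_hasDerivAt hT (fun t _ => by
    simpa [mul_comm] using ((hasDerivAt_id t).const_mul c).sin) (by fun_prop)

theorem wave_mode {T c : ℝ} (hT : 0 ≤ T) (v₀ w₀ : ℝ) {h : ℝ → ℝ}
    (hh : IntervalIntegrable h volume 0 T) :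
    ∃ v w : ℝ → ℝ, v 0 = v₀ ∧ w 0 = w₀ ∧ IsPrim T v (fun t => -c * w t + h t) ∧
      IsPrim T w (fun t => c * v t) := by
  have h1 : IntervalIntegrable (fun s => Real.cos (c * s) * h s) volume 0 T :=
    hh.continuousOn_mul (by fun_prop)
  have h2 : IntervalIntegrable (fun s => -(Real.sin (c * s) * h s)) volume 0 T :=
    (hh.continuousOn_mul (by fun_prop)).neg
  have p1 := IsPrim.of_integral (x₀ := v₀) h1
  have p2 := IsPrim.of_integral (x₀ := w₀) h2
  refine ⟨fun t => Real.cos (c * t) * (v₀ + ∫ s in (0 : ℝ)..t, Real.cos (c * s) * h s)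
      - Real.sin (c * t) * (w₀ + ∫ s in (0 : ℝ)..t, -(Real.sin (c * s) * h s)),
    fun t => Real.sin (c * t) * (v₀ + ∫ s in (0 : ℝ)..t, Real.cos (c * s) * h s)
      + Real.cos (c * t) * (w₀ + ∫ s in (0 : ℝ)..t, -(Real.sin (c * s) * h s)),
    by simp, by simp, ?_, ?_⟩
  · refine (congrArg (IsPrim T _) (funext fun t => ?_)).mp
      ((IsPrim.mul hT (isPrim_cos T c hT) p1).sub (IsPrim.mul hT (isPrim_sin T c hT) p2))
    linear_combination h t * Real.sin_sq_add_cos_sq (c * t)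
  · refine (congrArg (IsPrim T _) (funext fun t => ?_)).mp
      ((IsPrim.mul hT (isPrim_sin T c hT) p1).add (IsPrim.mul hT (isPrim_cos T c hT) p2))
    ring

/-- Solvability of the diagonal heat equation. -/
theorem exists_heatSol {om : ℕ → ℝ} {T : ℝ} (hT : 0 ≤ T) (θ₀ : SeqE) {ρ : ℝ → SeqE}
    (hρ : L2T T ρ) : ∃ θ y, HeatSol om T θ y ρ ∧ θ 0 = θ₀ := by
  classical
  have hk : ∀ k, ∃ x : ℝ → ℝ, x 0 = θ₀ k ∧ IsPrim T x (fun t => om k * ρ t k - om k ^ 2 * x t) :=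
    fun k => heat_mode hT (θ₀ k) (((hρ.coord k).intervalIntegrable hT).const_mul _)
  choose x hx0 hx using hk
  set c : ℕ → ℝ := fun k => θ₀ k ^ 2 + ∫ t in (0 : ℝ)..T, ρ t k ^ 2 with hc
  have hcs : Summable c := (seq_hasSum_sq θ₀).summable.add (hasSum_integral_sq hT hρ).summable
  have hxc : ∀ k, ContinuousOn (x k) (Icc 0 T) := fun k => (hx k).continuousOn hT
  have hsq : ∀ k, IntervalIntegrable (fun t => ρ t k ^ 2) volume 0 T := fun k => by
    simpa using (hρ.coord k).sq hT
  have hx2 : ∀ k, L2T T fun t => om k * x k t := fun k =>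
    L2T.of_continuousOn ((hxc k).const_mul (om k) |>.congr fun _ _ => rfl)
  have hxsq : ∀ k, IntervalIntegrable (fun t => (om k * x k t) ^ 2) volume 0 T := fun k => by
    simpa only [Real.norm_eq_abs, sq_abs] using (hx2 k).sq hT
  have hen : ∀ k, ∀ t ∈ Icc 0 T, x k t ^ 2 + ∫ s in (0 : ℝ)..t, (om k * x k s) ^ 2 ≤ c k := by
    intro k t ht
    have h1 := ((hx k).half_sq hT).2 t ht
    have i1 := (hxsq k).sub_right ht
    have i2 := (hsq k).sub_right ht
    have h2 : ∫ s in (0 : ℝ)..t, x k s * (om k * ρ s k - om k ^ 2 * x k s) ≤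
        ∫ s in (0 : ℝ)..t, (1 / 2 * ρ s k ^ 2 - 1 / 2 * (om k * x k s) ^ 2) := by
      refine intervalIntegral.integral_mono_on ht.1 ?_ ((i2.const_mul _).sub (i1.const_mul _)) ?_
      · exact (((hx k).half_sq hT).1).sub_right ht
      · intro s _
        nlinarith [sq_nonneg (ρ s k - om k * x k s)]
    rw [intervalIntegral.integral_sub (i2.const_mul _) (i1.const_mul _),
      intervalIntegral.integral_const_mul, intervalIntegral.integral_const_mul] at h2
    have h3 : ∫ s in (0 : ℝ)..t, ρ s k ^ 2 ≤ ∫ s in (0 : ℝ)..T, ρ s k ^ 2 :=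
      intervalIntegral.integral_mono_interval le_rfl ht.1 ht.2
        (Eventually.of_forall fun _ => sq_nonneg _) (hsq k)
    simp only [hc]
    simp only [hx0] at h1
    linarith
  have hpos : ∀ k, ∀ t ∈ Icc 0 T, 0 ≤ ∫ s in (0 : ℝ)..t, (om k * x k s) ^ 2 := fun k t ht =>
    intervalIntegral.integral_nonneg ht.1 fun _ _ => sq_nonneg _
  have hxb : ∀ t ∈ Icc 0 T, ∀ k, x k t ^ 2 ≤ c k := fun t ht k => by
    linarith [hen k t ht, hpos k t ht]
  have hsum : ∀ t ∈ Icc 0 T, Summable fun k => x k t ^ 2 := fun t ht =>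
    Summable.of_nonneg_of_le (fun _ => sq_nonneg _) (hxb t ht) hcs
  set θ : ℝ → SeqE := fun t => if h : Summable fun k => x k t ^ 2 then seqMk _ h else 0 with hθ
  have hθk : ∀ t ∈ Icc 0 T, ∀ k, θ t k = x k t := fun t ht k => by
    simp only [hθ, dif_pos (hsum t ht), seqMk_apply]
  obtain ⟨y, hy, hyk⟩ := exists_seq_curve hT hx2 hcs fun k => by
    have := hen k T ⟨hT, le_rfl⟩
    nlinarith [sq_nonneg (x k T)]
  refine ⟨θ, y, ⟨?_, hy, hρ, ?_, fun k => ?_⟩, ?_⟩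
  · exact continuousOn_seq hcs (fun t ht k => by rw [hθk t ht]; exact hxb t ht k)
      (fun k => (hxc k).congr fun t ht => hθk t ht k)
  · filter_upwards [hyk, ae_restrict_mem measurableSet_Ioc] with t ht hti k
    rw [ht k, hθk t (Ioc_subset_Icc_self hti)]
  · have h1 : IsPrim T (fun t => θ t k) (fun t => om k * ρ t k - om k ^ 2 * x k t) :=
      ⟨(hx k).1, fun t ht => by
        simp only [hθk t ht, hθk 0 ⟨le_rfl, hT⟩]; exact (hx k).2 t ht⟩
    refine h1.congr_ae hT ?_
    filter_upwards [hyk] with t ht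
    rw [ht k]; ring
  · exact seq_ext fun k => by rw [hθk 0 ⟨le_rfl, hT⟩, hx0]

/-- Solvability of the diagonal wave equation. -/
theorem exists_waveSol {lam : ℕ → ℝ} {T : ℝ} (hT : 0 ≤ T) (v₀ w₀ : SeqE) {h : ℝ → SeqE}
    (hh : L2T T h) : ∃ v w, WaveSol lam T v w h ∧ v 0 = v₀ ∧ w 0 = w₀ := by
  classical
  have hk : ∀ k, _ := fun k => wave_mode (c := lam k) hT (v₀ k) (w₀ k)
    ((hh.coord k).intervalIntegrable hT)
  choose x z hx0 hz0 hx hz using hk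
  set c : ℕ → ℝ := fun k =>
    (v₀ k ^ 2 + w₀ k ^ 2 + ∫ t in (0 : ℝ)..T, h t k ^ 2) * Real.exp T with hc
  have hcs : Summable c := (((seq_hasSum_sq v₀).summable.add (seq_hasSum_sq w₀).summable).add
    (hasSum_integral_sq hT hh).summable).mul_right _
  have hxc : ∀ k, ContinuousOn (x k) (Icc 0 T) := fun k => (hx k).continuousOn hT
  have hzc : ∀ k, ContinuousOn (z k) (Icc 0 T) := fun k => (hz k).continuousOn hT
  have hsq : ∀ k, IntervalIntegrable (fun t => h t k ^ 2) volume 0 T := fun k => by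
    simpa using (hh.coord k).sq hT
  have hen : ∀ k, ∀ t ∈ Icc 0 T, x k t ^ 2 + z k t ^ 2 ≤ c k := by
    intro k t ht
    -- the weighted energy `exp (-t) * (v² + w²)` grows at most by `∫ h²`
    have h1 := (IsPrim.mul hT (isPrim_exp T (-1) hT)
      (((hx k).half_sq hT).add ((hz k).half_sq hT)))
    have h2 := h1.2 t ht
    have h3 := intervalIntegral.integral_mono_on ht.1 (h1.1.sub_right ht)
      (((hsq k).sub_right ht).const_mul (1 / 2)) (fun s hs => by
      have e1 : Real.exp (-1 * s) ≤ 1 := Real.exp_le_one_iff.2 (by linarith [hs.1])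
      have e0 : 0 < Real.exp (-1 * s) := Real.exp_pos _
      have : Real.exp (-1 * s) * (x k s * (-lam k * z k s + h s k) + z k s * (lam k * x k s)) +
          -1 * Real.exp (-1 * s) * (1 / 2 * x k s ^ 2 + 1 / 2 * z k s ^ 2) ≤
          Real.exp (-1 * s) * (1 / 2 * h s k ^ 2) := by
        have : x k s * h s k - (1 / 2 * x k s ^ 2 + 1 / 2 * z k s ^ 2) ≤ 1 / 2 * h s k ^ 2 := by
          nlinarith [sq_nonneg (x k s - h s k), sq_nonneg (z k s)]
        nlinarith
      exact this.trans (by nlinarith [sq_nonneg (h s k)]))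
    rw [intervalIntegral.integral_const_mul] at h3
    have h4 : ∫ s in (0 : ℝ)..t, h s k ^ 2 ≤ ∫ s in (0 : ℝ)..T, h s k ^ 2 :=
      intervalIntegral.integral_mono_interval le_rfl ht.1 ht.2
        (Eventually.of_forall fun _ => sq_nonneg _) (hsq k)
    have h5 : Real.exp (-1 * t) * (x k t ^ 2 + z k t ^ 2) ≤
        v₀ k ^ 2 + w₀ k ^ 2 + ∫ t in (0 : ℝ)..T, h t k ^ 2 := by
      simp only [mul_zero, Real.exp_zero, one_mul, hx0, hz0] at h2
      linarith
    have h6 : 0 ≤ v₀ k ^ 2 + w₀ k ^ 2 + ∫ t in (0 : ℝ)..T, h t k ^ 2 := le_trans (by positivity) h5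
    have h7 : x k t ^ 2 + z k t ^ 2 = Real.exp (-1 * t) * (x k t ^ 2 + z k t ^ 2) * Real.exp t := by
      have : Real.exp (-1 * t) * Real.exp t = 1 := by rw [← Real.exp_add]; simp
      linear_combination (-(x k t ^ 2 + z k t ^ 2)) * this
    rw [h7]
    exact mul_le_mul h5 (Real.exp_le_exp.2 ht.2) (Real.exp_pos _).le h6
  have hxb : ∀ t ∈ Icc 0 T, ∀ k, x k t ^ 2 ≤ c k := fun t ht k => by
    nlinarith [hen k t ht, sq_nonneg (z k t)]
  have hzb : ∀ t ∈ Icc 0 T, ∀ k, z k t ^ 2 ≤ c k := fun t ht k => by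
    nlinarith [hen k t ht, sq_nonneg (x k t)]
  have hsumx : ∀ t ∈ Icc 0 T, Summable fun k => x k t ^ 2 := fun t ht =>
    Summable.of_nonneg_of_le (fun _ => sq_nonneg _) (hxb t ht) hcs
  have hsumz : ∀ t ∈ Icc 0 T, Summable fun k => z k t ^ 2 := fun t ht =>
    Summable.of_nonneg_of_le (fun _ => sq_nonneg _) (hzb t ht) hcs
  set v : ℝ → SeqE := fun t => if h : Summable fun k => x k t ^ 2 then seqMk _ h else 0 with hv
  set w : ℝ → SeqE := fun t => if h : Summable fun k => z k t ^ 2 then seqMk _ h else 0 with hw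
  have hvk : ∀ t ∈ Icc 0 T, ∀ k, v t k = x k t := fun t ht k => by
    simp only [hv, dif_pos (hsumx t ht), seqMk_apply]
  have hwk : ∀ t ∈ Icc 0 T, ∀ k, w t k = z k t := fun t ht k => by
    simp only [hw, dif_pos (hsumz t ht), seqMk_apply]
  have h0 : (0 : ℝ) ∈ Icc 0 T := ⟨le_rfl, hT⟩
  refine ⟨v, w, ⟨?_, ?_, hh, fun k => ?_, fun k => ?_⟩, ?_, ?_⟩
  · exact continuousOn_seq hcs (fun t ht k => by rw [hvk t ht]; exact hxb t ht k)
      (fun k => (hxc k).congr fun t ht => hvk t ht k)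
  · exact continuousOn_seq hcs (fun t ht k => by rw [hwk t ht]; exact hzb t ht k)
      (fun k => (hzc k).congr fun t ht => hwk t ht k)
  · have h1 : IsPrim T (fun t => v t k) (fun t => -lam k * z k t + h t k) :=
      ⟨(hx k).1, fun t ht => by
        simp only [hvk t ht, hvk 0 h0]; exact (hx k).2 t ht⟩
    refine h1.congr_ae hT ?_
    filter_upwards [ae_restrict_mem measurableSet_Ioc] with t ht
    rw [hwk t (Ioc_subset_Icc_self ht)]
  · have h1 : IsPrim T (fun t => w t k) (fun t => lam k * x k t) :=
      ⟨(hz k).1, fun t ht => by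
        simp only [hwk t ht, hwk 0 h0]; exact (hz k).2 t ht⟩
    refine h1.congr_ae hT ?_
    filter_upwards [ae_restrict_mem measurableSet_Ioc] with t ht
    rw [hvk t (Ioc_subset_Icc_self ht)]
  · exact seq_ext fun k => by rw [hvk 0 h0, hx0]
  · exact seq_ext fun k => by rw [hwk 0 h0, hz0]

/-- The structural data of the coupled system in Fourier coordinates. -/
structure Model (H C : Type*) [NormedAddCommGroup H] [InnerProductSpace ℝ H] [CompleteSpace H]
    [NormedAddCommGroup C] [NormedSpace ℝ C] where
  om : ℕ → ℝ
  lam : ℕ → ℝ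
  one_le_om : ∀ k, 1 ≤ om k
  J : SeqE →L[ℝ] H
  D : SeqE →L[ℝ] H
  V : SeqE →L[ℝ] H
  S : SeqE →L[ℝ] C
  mul : C →L[ℝ] H →L[ℝ] H
  F : C → C
  F' : C → C
  M : ℝ
  K : ℝ
  M_nonneg : 0 ≤ M
  K_nonneg : 0 ≤ K
  norm_sq : ∀ y, ‖y‖ ^ 2 = ‖J y‖ ^ 2 + ‖D y‖ ^ 2
  inner_J : ∀ y z, ⟪J y, J z⟫_ℝ = ⟪diagL (fun k => 1 / om k) y, diagL (fun k => 1 / om k) z⟫_ℝ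
  norm_V_le : ∀ v, ‖V v‖ ≤ ‖v‖
  agmon : ∀ y, ‖S y‖ ^ 2 ≤ K * ‖J y‖ * ‖y‖
  norm_mul_le : ∀ c g, ‖mul c g‖ ≤ ‖c‖ * ‖g‖
  mul_symm : ∀ c g h, ⟪mul c g, h⟫_ℝ = ⟪g, mul c h⟫_ℝ
  F_lip : ∀ c d, ‖F c - F d‖ ≤ M * ‖c - d‖
  F'_lip : ∀ c d, ‖F' c - F' d‖ ≤ M * ‖c - d‖
  F'_le : ∀ c, ‖F' c‖ ≤ M
  F_zero : F 0 = 0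

theorem mul_le_sq_div_add (x y : ℝ) : x * y ≤ 1 / 512 * y ^ 2 + 128 * x ^ 2 := by
  nlinarith [sq_nonneg (y - 256 * x)]

theorem young_bound_h {M K d s a Y n : ℝ} (hs : s ^ 2 ≤ K * a * d) :
    (M * d + M * s * Y) * n ≤ 1 / 64 * d ^ 2 +
      (128 * M ^ 2 + 32 * K ^ 2) * (1 + Y ^ 2) * (a ^ 2 + n ^ 2) := by
  have k1 := mul_le_sq_div_add (M * n) d
  have k2 : M * s * Y * n ≤ 1 / 2 * s ^ 2 + 1 / 2 * (M * Y * n) ^ 2 := by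
    linarith [sq_nonneg (s - M * Y * n)]
  have k3 := mul_le_sq_div_add (1 / 2 * K * a) d
  have p1 := sq_nonneg (M * Y * n)
  have p2 := sq_nonneg (K * Y * n)
  have p3 := sq_nonneg (M * Y * a)
  have p4 := sq_nonneg (K * Y * a)
  have p5 := sq_nonneg (M * a)
  have p6 := sq_nonneg (K * n)
  have p7 := sq_nonneg d
  linarith

theorem young_bound_B {M K N d p s r a b Y n : ℝ} (hN : 0 ≤ N) (hY : 0 ≤ Y)
    (hs : s ^ 2 ≤ K * a * d) (hr : r ^ 2 ≤ K * b * p) :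
    a * b + (N * d * r + N * Y * s * r) + M * Y * r * n + N * s * p + M * (1 + K) * Y * n * p ≤
      1 / 64 * (d ^ 2 + p ^ 2) + (1 + 2 ^ 22 * N ^ 4 * K ^ 2 + 32 * K ^ 2 * N ^ 2 +
        8 * M ^ 4 * K ^ 2 + 128 * M ^ 2 * (1 + K) ^ 2) * (1 + Y ^ 2) *
        (a ^ 2 + b ^ 2 + n ^ 2) := by
  have k1 : a * b ≤ 1 / 2 * a ^ 2 + 1 / 2 * b ^ 2 := by linarith [sq_nonneg (a - b)]
  have k2 : N * d * r ≤ 1 / 512 * d ^ 2 + (1 / 512 * p ^ 2 + 2 ^ 21 * (N ^ 4 * K ^ 2 * b ^ 2)) := by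
    have h1 := mul_le_sq_div_add (N * r) d
    have h2 := mul_le_sq_div_add (128 * N ^ 2 * K * b) p
    have h3 := mul_le_mul_of_nonneg_left hr (sq_nonneg N)
    linarith
  have k3 : N * Y * s * r ≤ 1 / 512 * d ^ 2 + 1 / 512 * p ^ 2 +
      32 * (K ^ 2 * N ^ 2 * Y ^ 2 * (a ^ 2 + b ^ 2)) := by
    have h1 := mul_nonneg (mul_nonneg hN hY) (sq_nonneg (s - r))
    have h2 := mul_le_sq_div_add (1 / 2 * K * N * Y * a) d
    have h3 := mul_le_sq_div_add (1 / 2 * K * N * Y * b) p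
    have h4 := mul_le_mul_of_nonneg_left hr (mul_nonneg hN hY)
    have h5 := mul_le_mul_of_nonneg_left hs (mul_nonneg hN hY)
    linarith
  have k4 : M * Y * r * n ≤ Y ^ 2 * n ^ 2 + (1 / 512 * p ^ 2 + 8 * (M ^ 4 * K ^ 2 * b ^ 2)) := by
    have h1 := sq_nonneg (Y * n - 1 / 2 * M * r)
    have h2 := mul_le_sq_div_add (1 / 4 * M ^ 2 * K * b) p
    have h3 := mul_le_mul_of_nonneg_left hr (sq_nonneg M)
    linarith
  have k5 : N * s * p ≤ 1 / 512 * p ^ 2 + (1 / 512 * d ^ 2 + 2 ^ 21 * (N ^ 4 * K ^ 2 * a ^ 2)) := by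
    have h1 := mul_le_sq_div_add (N * s) p
    have h2 := mul_le_sq_div_add (128 * N ^ 2 * K * a) d
    have h3 := mul_le_mul_of_nonneg_left hs (sq_nonneg N)
    linarith
  have k6 := mul_le_sq_div_add (M * (1 + K) * Y * n) p
  have e : (1 + 2 ^ 22 * N ^ 4 * K ^ 2 + 32 * K ^ 2 * N ^ 2 +
        8 * M ^ 4 * K ^ 2 + 128 * M ^ 2 * (1 + K) ^ 2) * (1 + Y ^ 2) *
        (a ^ 2 + b ^ 2 + n ^ 2) =
      (1 + Y ^ 2) * (a ^ 2 + b ^ 2 + n ^ 2) + 2 ^ 22 * (N ^ 4 * K ^ 2 * a ^ 2) +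
      2 ^ 22 * (N ^ 4 * K ^ 2 * b ^ 2) +
      2 ^ 22 * (N ^ 4 * K ^ 2 * (n ^ 2 + Y ^ 2 * (a ^ 2 + b ^ 2 + n ^ 2))) +
      32 * (K ^ 2 * N ^ 2 * Y ^ 2 * (a ^ 2 + b ^ 2)) +
      32 * (K ^ 2 * N ^ 2 * (Y ^ 2 * n ^ 2 + (a ^ 2 + b ^ 2 + n ^ 2))) +
      8 * (M ^ 4 * K ^ 2 * b ^ 2) +
      8 * (M ^ 4 * K ^ 2 * (a ^ 2 + n ^ 2 + Y ^ 2 * (a ^ 2 + b ^ 2 + n ^ 2))) +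
      128 * (M * (1 + K) * Y * n) ^ 2 +
      128 * (M ^ 2 * (1 + K) ^ 2 * (Y ^ 2 * (a ^ 2 + b ^ 2) + (a ^ 2 + b ^ 2 + n ^ 2))) := by
    ring
  have p1 : 0 ≤ N ^ 4 * K ^ 2 * (n ^ 2 + Y ^ 2 * (a ^ 2 + b ^ 2 + n ^ 2)) := by positivity
  have p2 : 0 ≤ K ^ 2 * N ^ 2 * (Y ^ 2 * n ^ 2 + (a ^ 2 + b ^ 2 + n ^ 2)) := by positivity
  have p3 : 0 ≤ M ^ 4 * K ^ 2 * (a ^ 2 + n ^ 2 + Y ^ 2 * (a ^ 2 + b ^ 2 + n ^ 2)) := by positivity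
  have p4 : 0 ≤ M ^ 2 * (1 + K) ^ 2 * (Y ^ 2 * (a ^ 2 + b ^ 2) + (a ^ 2 + b ^ 2 + n ^ 2)) := by
    positivity
  have p5 : 0 ≤ N ^ 4 * K ^ 2 * a ^ 2 := by positivity
  have p6 : 0 ≤ N ^ 4 * K ^ 2 * b ^ 2 := by positivity
  have p7 : 0 ≤ Y ^ 2 * (a ^ 2 + b ^ 2) := by positivity
  rw [e]
  linarith [sq_nonneg a, sq_nonneg b, sq_nonneg n, sq_nonneg d, sq_nonneg p]

namespace Model

variable {H C : Type*} [NormedAddCommGroup H] [InnerProductSpace ℝ H] [CompleteSpace H]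
    [NormedAddCommGroup C] [NormedSpace ℝ C] (m : Model H C)

/-- The multiplier `1 / ω`. -/
def W : SeqE →L[ℝ] SeqE := diagL fun k => 1 / m.om k

theorem abs_inv_om_le (k : ℕ) : |1 / m.om k| ≤ 1 := by
  have := m.one_le_om k
  rw [abs_of_nonneg (by positivity), div_le_one (by linarith)]
  exact this

theorem W_apply (y : SeqE) (k : ℕ) : m.W y k = 1 / m.om k * y k := diagL_apply m.abs_inv_om_le y k

theorem norm_W (y : SeqE) : ‖m.W y‖ = ‖m.J y‖ := by
  have := m.inner_J y y
  rw [real_inner_self_eq_norm_sq, real_inner_self_eq_norm_sq] at this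
  exact ((sq_eq_sq₀ (norm_nonneg _) (norm_nonneg _)).1 this).symm

theorem norm_J_le (y : SeqE) : ‖m.J y‖ ≤ ‖y‖ :=
  abs_le_of_sq_le_sq' (by nlinarith [m.norm_sq y, sq_nonneg ‖m.D y‖]) (norm_nonneg _) |>.2

theorem norm_D_le (y : SeqE) : ‖m.D y‖ ≤ ‖y‖ :=
  abs_le_of_sq_le_sq' (by nlinarith [m.norm_sq y, sq_nonneg ‖m.J y‖]) (norm_nonneg _) |>.2

theorem norm_S_le (y : SeqE) : ‖m.S y‖ ≤ (1 + m.K) * ‖y‖ := by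
  have hK := m.K_nonneg
  refine abs_le_of_sq_le_sq' ?_ (by positivity) |>.2
  have h1 := m.agmon y
  have h2 := mul_le_mul_of_nonneg_right (mul_le_mul_of_nonneg_left (m.norm_J_le y) hK)
    (norm_nonneg y)
  nlinarith [sq_nonneg ‖y‖, mul_nonneg hK (sq_nonneg ‖y‖), mul_nonneg (sq_nonneg m.K) (sq_nonneg ‖y‖)]

theorem norm_F_le (c : C) : ‖m.F c‖ ≤ m.M * ‖c‖ := by
  simpa [m.F_zero] using m.F_lip c 0

theorem continuous_F : Continuous m.F :=
  (LipschitzWith.of_dist_le_mul (K := ⟨m.M, m.M_nonneg⟩) fun c d => by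
    rw [dist_eq_norm, dist_eq_norm]; exact m.F_lip c d).continuous

theorem continuous_F' : Continuous m.F' :=
  (LipschitzWith.of_dist_le_mul (K := ⟨m.M, m.M_nonneg⟩) fun c d => by
    rw [dist_eq_norm, dist_eq_norm]; exact m.F'_lip c d).continuous

/-- The spatial derivative `f'(Θ) Θ_x` of `f(Θ)`. -/
def A (y : SeqE) : H := m.mul (m.F' (m.S y)) (m.D y)

/-- The source of the wave equation. -/
def h (y : SeqE) : SeqE := -(ContinuousLinearMap.adjoint m.V (m.A y))

/-- The source of the heat equation. -/
def B (y v : SeqE) : SeqE :=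
  m.W (m.W y) + ContinuousLinearMap.adjoint ((m.mul.flip (m.V v)).comp m.S) (m.A y) +
    ContinuousLinearMap.adjoint m.D (m.mul (m.F (m.S y)) (m.V v))

theorem continuous_A : Continuous m.A := by
  have h1 := m.continuous_F'
  unfold A
  fun_prop

theorem continuous_h : Continuous m.h := by
  have h1 := m.continuous_A
  unfold h
  fun_prop

theorem continuous_B : Continuous fun p : SeqE × SeqE => m.B p.1 p.2 := by
  have h1 := m.continuous_A
  have h2 := m.continuous_F
  have h3 : Continuous fun p : SeqE × SeqE =>
      ContinuousLinearMap.adjoint ((m.mul.flip (m.V p.2)).comp m.S) := by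
    refine (ContinuousLinearMap.adjoint (𝕜 := ℝ) (E := SeqE) (F := H)).continuous.comp ?_
    exact ((m.mul.flip.continuous.comp (m.V.continuous.comp continuous_snd)).clm_comp
      continuous_const)
  unfold B
  refine ((by fun_prop : Continuous fun p : SeqE × SeqE => m.W (m.W p.1)).add
    (h3.clm_apply (h1.comp continuous_fst))).add ?_
  fun_prop

theorem inner_h (y ν : SeqE) : ⟪m.h y, ν⟫_ℝ = -⟪m.A y, m.V ν⟫_ℝ := by
  rw [h, inner_neg_left, ContinuousLinearMap.adjoint_inner_left]

theorem inner_W (y z : SeqE) : ⟪m.W (m.W y), z⟫_ℝ = ⟪m.J y, m.J z⟫_ℝ := by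
  rw [m.inner_J]; exact inner_diagL m.abs_inv_om_le _ _

theorem inner_B (y v φ : SeqE) : ⟪m.B y v, φ⟫_ℝ = ⟪m.J y, m.J φ⟫_ℝ +
    ⟪m.A y, m.mul (m.S φ) (m.V v)⟫_ℝ + ⟪m.mul (m.F (m.S y)) (m.V v), m.D φ⟫_ℝ := by
  rw [B, inner_add_left, inner_add_left, ContinuousLinearMap.adjoint_inner_left,
    ContinuousLinearMap.adjoint_inner_left, inner_W]
  rfl

theorem norm_A_le (y : SeqE) : ‖m.A y‖ ≤ m.M * ‖y‖ :=
  (m.norm_mul_le _ _).trans (mul_le_mul (m.F'_le _) (m.norm_D_le y) (norm_nonneg _) m.M_nonneg)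

theorem norm_A_sub_le (y z : SeqE) :
    ‖m.A y - m.A z‖ ≤ m.M * ‖y - z‖ + m.M * ‖m.S (y - z)‖ * ‖z‖ := by
  have e : m.A y - m.A z = m.mul (m.F' (m.S y)) (m.D (y - z)) +
      m.mul (m.F' (m.S y) - m.F' (m.S z)) (m.D z) := by
    simp [A]
  rw [e]
  refine (norm_add_le _ _).trans (add_le_add ?_ ?_)
  · exact (m.norm_mul_le _ _).trans (mul_le_mul (m.F'_le _) (m.norm_D_le _) (norm_nonneg _)
      m.M_nonneg)
  · refine (m.norm_mul_le _ _).trans (mul_le_mul ?_ (m.norm_D_le _) (norm_nonneg _)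
      (mul_nonneg m.M_nonneg (norm_nonneg _)))
    rw [map_sub]
    exact m.F'_lip _ _

theorem norm_mulS_le (φ v : SeqE) : ‖m.mul (m.S φ) (m.V v)‖ ≤ ‖m.S φ‖ * ‖v‖ :=
  (m.norm_mul_le _ _).trans (mul_le_mul_of_nonneg_left (m.norm_V_le _) (norm_nonneg _))

theorem norm_mulF_le (y v : SeqE) : ‖m.mul (m.F (m.S y)) (m.V v)‖ ≤ m.M * ‖m.S y‖ * ‖v‖ :=
  (m.norm_mul_le _ _).trans (mul_le_mul (m.norm_F_le _) (m.norm_V_le _) (norm_nonneg _)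
    (mul_nonneg m.M_nonneg (norm_nonneg _)))

theorem norm_h_le (y : SeqE) : ‖m.h y‖ ≤ m.M * ‖y‖ := by
  have h1 : ‖m.h y‖ ^ 2 ≤ (m.M * ‖y‖) * ‖m.h y‖ := by
    rw [← real_inner_self_eq_norm_sq, inner_h, ← inner_neg_left]
    refine (real_inner_le_norm _ _).trans ?_
    rw [norm_neg]
    exact mul_le_mul (m.norm_A_le y) (m.norm_V_le _) (norm_nonneg _)
      (mul_nonneg m.M_nonneg (norm_nonneg _))
  rcases (norm_nonneg (m.h y)).eq_or_lt with h0 | h0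
  · rw [← h0]; exact mul_nonneg m.M_nonneg (norm_nonneg _)
  · nlinarith

theorem norm_B_le (y v : SeqE) : ‖m.B y v‖ ≤ (1 + 2 * m.M * (1 + m.K) * ‖v‖) * ‖y‖ := by
  have hM := m.M_nonneg
  have hK := m.K_nonneg
  have h1 : ‖m.B y v‖ ^ 2 ≤ ((1 + 2 * m.M * (1 + m.K) * ‖v‖) * ‖y‖) * ‖m.B y v‖ := by
    rw [← real_inner_self_eq_norm_sq, inner_B]
    set φ := m.B y v
    have a1 : ⟪m.J y, m.J φ⟫_ℝ ≤ ‖y‖ * ‖φ‖ := (real_inner_le_norm _ _).trans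
      (mul_le_mul (m.norm_J_le _) (m.norm_J_le _) (norm_nonneg _) (norm_nonneg _))
    have a2 : ⟪m.A y, m.mul (m.S φ) (m.V v)⟫_ℝ ≤ (m.M * ‖y‖) * ((1 + m.K) * ‖φ‖ * ‖v‖) :=
      (real_inner_le_norm _ _).trans (mul_le_mul (m.norm_A_le _)
        ((m.norm_mulS_le _ _).trans (mul_le_mul_of_nonneg_right (m.norm_S_le _) (norm_nonneg _)))
        (norm_nonneg _) (by positivity))
    have a3 : ⟪m.mul (m.F (m.S y)) (m.V v), m.D φ⟫_ℝ ≤ (m.M * ((1 + m.K) * ‖y‖) * ‖v‖) * ‖φ‖ :=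
      (real_inner_le_norm _ _).trans (mul_le_mul ((m.norm_mulF_le _ _).trans
        (mul_le_mul_of_nonneg_right (mul_le_mul_of_nonneg_left (m.norm_S_le _) hM)
          (norm_nonneg _))) (m.norm_D_le _) (norm_nonneg _) (by positivity))
    linarith
  rcases (norm_nonneg (m.B y v)).eq_or_lt with h0 | h0
  · rw [← h0]; positivity
  · nlinarith

theorem L2T_h {T : ℝ} {y : ℝ → SeqE} (hy : L2T T y) : L2T T fun t => m.h (y t) :=
  MemLp.of_le_mul hy (m.continuous_h.comp_aestronglyMeasurable hy.1)
    (Eventually.of_forall fun t => m.norm_h_le (y t))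

theorem L2T_B {T : ℝ} {y v : ℝ → SeqE} (hy : L2T T y) (hv : ContinuousOn v (Icc 0 T)) :
    L2T T fun t => m.B (y t) (v t) := by
  have hM := m.M_nonneg
  have hK := m.K_nonneg
  obtain ⟨R, hR⟩ := isCompact_Icc.exists_bound_of_continuousOn hv
  have hc : AEStronglyMeasurable (fun t => m.B (y t) (v t)) (volume.restrict (Ioc 0 T)) :=
    m.continuous_B.comp_aestronglyMeasurable (g := fun p : SeqE × SeqE => m.B p.1 p.2)
      (f := fun t => (y t, v t)) (hy.1.prodMk (L2T.of_continuousOn hv).1)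
  have hb : ∀ᵐ t ∂volume.restrict (Ioc 0 T),
      ‖m.B (y t) (v t)‖ ≤ (1 + 2 * m.M * (1 + m.K) * R) * ‖y t‖ := by
    filter_upwards [ae_restrict_mem measurableSet_Ioc] with t ht
    refine (m.norm_B_le _ _).trans (mul_le_mul_of_nonneg_right ?_ (norm_nonneg _))
    have := mul_le_mul_of_nonneg_left (hR t (Ioc_subset_Icc_self ht))
      (by positivity : 0 ≤ 2 * m.M * (1 + m.K))
    linarith
  exact MemLp.of_le_mul hy hc hb

theorem diff_h : ∃ c : ℝ, 0 ≤ c ∧ ∀ y z ν : SeqE, |⟪m.h y - m.h z, ν⟫_ℝ| ≤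
    1 / 64 * ‖y - z‖ ^ 2 + c * (1 + ‖z‖ ^ 2) * (‖m.J (y - z)‖ ^ 2 + ‖ν‖ ^ 2) := by
  have hM := m.M_nonneg
  have hK := m.K_nonneg
  refine ⟨128 * m.M ^ 2 + 32 * m.K ^ 2, by positivity, fun y z ν => ?_⟩
  have e : ⟪m.h y - m.h z, ν⟫_ℝ = -⟪m.A y - m.A z, m.V ν⟫_ℝ := by
    rw [inner_sub_left, inner_h, inner_h, inner_sub_left]; ring
  have h1 : |⟪m.h y - m.h z, ν⟫_ℝ| ≤
      (m.M * ‖y - z‖ + m.M * ‖m.S (y - z)‖ * ‖z‖) * ‖ν‖ := by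
    rw [e, abs_neg]
    exact (abs_real_inner_le_norm _ _).trans (mul_le_mul (m.norm_A_sub_le y z) (m.norm_V_le _)
      (norm_nonneg _) (by positivity))
  have h2 := m.agmon (y - z)
  exact h1.trans (young_bound_h h2)

theorem diff_B (R : ℝ) (hR : 0 ≤ R) : ∃ c : ℝ, 0 ≤ c ∧ ∀ y z v u φ : SeqE, ‖v‖ ≤ R →
    |⟪m.B y v - m.B z u, φ⟫_ℝ| ≤ 1 / 64 * (‖y - z‖ ^ 2 + ‖φ‖ ^ 2) +
      c * (1 + ‖z‖ ^ 2) * (‖m.J (y - z)‖ ^ 2 + ‖m.J φ‖ ^ 2 + ‖v - u‖ ^ 2) := by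
  have hM := m.M_nonneg
  have hK := m.K_nonneg
  set N : ℝ := m.M * R with hN
  have hN0 : 0 ≤ N := by positivity
  refine ⟨1 + 2 ^ 22 * N ^ 4 * m.K ^ 2 + 32 * m.K ^ 2 * N ^ 2 +
        8 * m.M ^ 4 * m.K ^ 2 + 128 * m.M ^ 2 * (1 + m.K) ^ 2, by positivity,
    fun y z v u φ hv => ?_⟩
  have e : ⟪m.B y v - m.B z u, φ⟫_ℝ = ⟪m.J (y - z), m.J φ⟫_ℝ +
      ⟪m.A y - m.A z, m.mul (m.S φ) (m.V v)⟫_ℝ + ⟪m.A z, m.mul (m.S φ) (m.V (v - u))⟫_ℝ +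
      ⟪m.mul (m.F (m.S y) - m.F (m.S z)) (m.V v), m.D φ⟫_ℝ +
      ⟪m.mul (m.F (m.S z)) (m.V (v - u)), m.D φ⟫_ℝ := by
    rw [inner_sub_left, inner_B, inner_B]
    simp only [map_sub, sub_apply, inner_sub_left, inner_sub_right]
    ring
  have t1 : |⟪m.J (y - z), m.J φ⟫_ℝ| ≤ ‖m.J (y - z)‖ * ‖m.J φ‖ := abs_real_inner_le_norm _ _
  have t2 : |⟪m.A y - m.A z, m.mul (m.S φ) (m.V v)⟫_ℝ| ≤
      (m.M * ‖y - z‖ + m.M * ‖m.S (y - z)‖ * ‖z‖) * (‖m.S φ‖ * R) :=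
    (abs_real_inner_le_norm _ _).trans (mul_le_mul (m.norm_A_sub_le y z)
      ((m.norm_mulS_le _ _).trans (mul_le_mul_of_nonneg_left hv (norm_nonneg _)))
      (norm_nonneg _) (by positivity))
  have t3 : |⟪m.A z, m.mul (m.S φ) (m.V (v - u))⟫_ℝ| ≤ m.M * ‖z‖ * (‖m.S φ‖ * ‖v - u‖) :=
    (abs_real_inner_le_norm _ _).trans (mul_le_mul (m.norm_A_le z) (m.norm_mulS_le _ _)
      (norm_nonneg _) (by positivity))
  have t4 : |⟪m.mul (m.F (m.S y) - m.F (m.S z)) (m.V v), m.D φ⟫_ℝ| ≤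
      m.M * ‖m.S (y - z)‖ * R * ‖φ‖ := by
    refine (abs_real_inner_le_norm _ _).trans (mul_le_mul ((m.norm_mul_le _ _).trans
      (mul_le_mul ?_ ((m.norm_V_le _).trans hv) (norm_nonneg _) (by positivity)))
      (m.norm_D_le _) (norm_nonneg _) (by positivity))
    rw [map_sub]; exact m.F_lip _ _
  have t5 : |⟪m.mul (m.F (m.S z)) (m.V (v - u)), m.D φ⟫_ℝ| ≤
      m.M * ((1 + m.K) * ‖z‖) * ‖v - u‖ * ‖φ‖ :=
    (abs_real_inner_le_norm _ _).trans (mul_le_mul ((m.norm_mulF_le _ _).trans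
      (mul_le_mul_of_nonneg_right (mul_le_mul_of_nonneg_left (m.norm_S_le _) hM)
        (norm_nonneg _))) (m.norm_D_le _) (norm_nonneg _) (by positivity))
  have h2 := m.agmon (y - z)
  have h3 := m.agmon φ
  refine le_trans ?_ (young_bound_B hN0 (norm_nonneg z) h2 h3)
  rw [e]
  refine ((abs_add_le _ _).trans (add_le_add ((abs_add_le _ _).trans (add_le_add
      ((abs_add_le _ _).trans (add_le_add ((abs_add_le _ _).trans (add_le_add t1 t2)) t3)) t4))
      t5)).trans (le_of_eq ?_)
  rw [hN]
  ring

end Model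

theorem HeatSol.energy_sub {om : ℕ → ℝ} {T : ℝ} {θ y ρ θ' y' ρ' : ℝ → SeqE}
    (h : HeatSol om T θ y ρ) (h' : HeatSol om T θ' y' ρ') (h0 : θ 0 = θ' 0)
    {t : ℝ} (ht : t ∈ Icc 0 T) :
    1 / 2 * ‖θ t - θ' t‖ ^ 2 + ∫ s in (0 : ℝ)..t, ‖y s - y' s‖ ^ 2 =
      ∫ s in (0 : ℝ)..t, ⟪ρ s - ρ' s, y s - y' s⟫_ℝ := by
  have H := (h.sub h').mono ht
  have e := (h.sub h').energy ht
  have i1 := H.ρ2.inner ht.1 H.y2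
  have i2 := H.y2.sq ht.1
  simp only [h0, sub_self, norm_zero] at e
  have : (∫ s in (0 : ℝ)..t, ⟪y s - y' s, ρ s - ρ' s - (y s - y' s)⟫_ℝ) =
      (∫ s in (0 : ℝ)..t, ⟪ρ s - ρ' s, y s - y' s⟫_ℝ) - ∫ s in (0 : ℝ)..t, ‖y s - y' s‖ ^ 2 := by
    rw [← intervalIntegral.integral_sub i1 i2]
    refine intervalIntegral.integral_congr fun s _ => ?_
    simp only [inner_sub_right (y s - y' s) (ρ s - ρ' s), real_inner_self_eq_norm_sq,
      real_inner_comm (ρ s - ρ' s)]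
  rw [this] at e
  linarith

theorem WaveSol.energy_sub {lam : ℕ → ℝ} {T : ℝ} {v w h v' w' h' : ℝ → SeqE}
    (H : WaveSol lam T v w h) (H' : WaveSol lam T v' w' h') (hv : v 0 = v' 0) (hw : w 0 = w' 0)
    {t : ℝ} (ht : t ∈ Icc 0 T) :
    1 / 2 * (‖v t - v' t‖ ^ 2 + ‖w t - w' t‖ ^ 2) =
      ∫ s in (0 : ℝ)..t, ⟪h s - h' s, v s - v' s⟫_ℝ := by
  have e := (H.sub H').energy ht
  simp only [hv, hw, sub_self, norm_zero] at e
  rw [e]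
  simp [real_inner_comm]

namespace Model

variable {H C : Type*} [NormedAddCommGroup H] [InnerProductSpace ℝ H] [CompleteSpace H]
    [NormedAddCommGroup C] [NormedSpace ℝ C] (m : Model H C)

/-- Solutions of the coupled system on `[0,T]` in Fourier coordinates. -/
structure Sol (T : ℝ) (θ v w y : ℝ → SeqE) : Prop where
  heat : HeatSol m.om T θ y (fun t => m.B (y t) (v t))
  wave : WaveSol m.lam T v w (fun t => m.h (y t))

theorem W_of_coord {θ y : SeqE} (h : ∀ k, y k = m.om k * θ k) : m.W y = θ := by
  refine seq_ext fun k => ?_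
  rw [m.W_apply, h k]
  have := m.one_le_om k
  field_simp

/-- Energy inequality for the difference of two solutions with sources given by `p` and `q`. -/
theorem energy_diff (R : ℝ) (hR : 0 ≤ R) : ∃ c : ℝ, 0 ≤ c ∧ ∀ (T : ℝ) (θ v w y p u θ' v' w' y' q u' :
      ℝ → SeqE), HeatSol m.om T θ y (fun t => m.B (p t) (u t)) →
    HeatSol m.om T θ' y' (fun t => m.B (q t) (u' t)) →
    WaveSol m.lam T v w (fun t => m.h (p t)) → WaveSol m.lam T v' w' (fun t => m.h (q t)) →
    L2T T p → L2T T q →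
    θ 0 = θ' 0 → v 0 = v' 0 → w 0 = w' 0 → (∀ t ∈ Icc 0 T, ‖u t‖ ≤ R) →
    ∀ t ∈ Icc 0 T, ∀ α β : ℝ → ℝ, ContinuousOn α (Icc 0 T) → ContinuousOn β (Icc 0 T) →
    (∀ᵐ s ∂volume.restrict (Ioc 0 T), ‖m.J (p s - q s)‖ ^ 2 ≤ α s) →
    (∀ s ∈ Icc 0 T, ‖u s - u' s‖ ^ 2 ≤ α s) →
    (∀ s ∈ Icc 0 T, ‖θ s - θ' s‖ ^ 2 + ‖v s - v' s‖ ^ 2 ≤ β s) →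
    1 / 2 * (‖θ t - θ' t‖ ^ 2 + ‖v t - v' t‖ ^ 2 + ‖w t - w' t‖ ^ 2) +
        ∫ s in (0 : ℝ)..t, ‖y s - y' s‖ ^ 2 ≤
      1 / 32 * (∫ s in (0 : ℝ)..t, ‖p s - q s‖ ^ 2) +
      1 / 64 * (∫ s in (0 : ℝ)..t, ‖y s - y' s‖ ^ 2) +
      c * ∫ s in (0 : ℝ)..t, (1 + ‖q s‖ ^ 2) * (3 * α s + β s) := by
  obtain ⟨c₁, hc₁, hB⟩ := m.diff_B R hR
  obtain ⟨c₂, hc₂, hh⟩ := m.diff_h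
  refine ⟨c₁ + c₂, by positivity, fun T θ v w y p u θ' v' w' y' q u' H1 H2 G1 G2 hp hq
    hθ hv hw huR t ht α β hα hβ hJ hη hθv => ?_⟩
  have e1 := H1.energy_sub H2 hθ ht
  have e2 := G1.energy_sub G2 hv hw ht
  have h0 : (0 : ℝ) ≤ t := ht.1
  have HS := (H1.sub H2).mono ht
  have GS := (G1.sub G2).mono ht
  have i1 := HS.ρ2.inner h0 HS.y2
  have i2 := GS.h2.inner h0 (L2T.of_continuousOn GS.contv)
  have i3 : IntervalIntegrable (fun s => ‖p s - q s‖ ^ 2) volume 0 t :=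
    L2T.sq h0 ((L2T.mono hp ht.2).sub (L2T.mono hq ht.2))
  have i4 := HS.y2.sq h0
  have i5 : IntervalIntegrable (fun s => (1 + ‖q s‖ ^ 2) * (3 * α s + β s)) volume 0 t := by
    refine IntervalIntegrable.mul_continuousOn ?_ ?_
    · exact (intervalIntegrable_const).add ((L2T.mono hq ht.2).sq h0)
    · rw [uIcc_of_le h0]
      exact ((continuousOn_const.mul hα).add hβ).mono (Icc_subset_Icc_right ht.2)
  have key : (∫ s in (0 : ℝ)..t, ⟪m.B (p s) (u s) - m.B (q s) (u' s), y s - y' s⟫_ℝ) +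
      (∫ s in (0 : ℝ)..t, ⟪m.h (p s) - m.h (q s), v s - v' s⟫_ℝ) ≤
      ∫ s in (0 : ℝ)..t, (1 / 32 * ‖p s - q s‖ ^ 2 + 1 / 64 * ‖y s - y' s‖ ^ 2 +
        (c₁ + c₂) * ((1 + ‖q s‖ ^ 2) * (3 * α s + β s))) := by
    rw [← intervalIntegral.integral_add i1 i2]
    refine intervalIntegral.integral_mono_ae_restrict h0 (i1.add i2)
      (((i3.const_mul _).add (i4.const_mul _)).add (i5.const_mul _)) ?_
    rw [← Measure.restrict_congr_set Ioc_ae_eq_Icc]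
    filter_upwards [ae_restrict_mem measurableSet_Ioc,
      ae_mono (Measure.restrict_mono_set _ (Ioc_subset_Ioc_right ht.2)) hJ, HS.yθ] with s hs hJs hys
    have hsT : s ∈ Icc 0 T := ⟨hs.1.le, hs.2.trans ht.2⟩
    have b1 := (le_abs_self _).trans (hB (p s) (q s) (u s) (u' s) (y s - y' s) (huR s hsT))
    have b2 := (le_abs_self _).trans (hh (p s) (q s) (v s - v' s))
    have b3 : ‖m.J (y s - y' s)‖ = ‖θ s - θ' s‖ := by rw [← m.norm_W, m.W_of_coord hys]
    rw [b3] at b1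
    have b4 := hη s hsT
    have b5 := hθv s hsT
    have b6 : c₁ * (1 + ‖q s‖ ^ 2) * (‖m.J (p s - q s)‖ ^ 2 + ‖θ s - θ' s‖ ^ 2 + ‖u s - u' s‖ ^ 2) ≤
        c₁ * (1 + ‖q s‖ ^ 2) * (3 * α s + β s) := by
      refine mul_le_mul_of_nonneg_left ?_ (by positivity)
      linarith [sq_nonneg ‖v s - v' s‖, sq_nonneg ‖u s - u' s‖]
    have b7 : c₂ * (1 + ‖q s‖ ^ 2) * (‖m.J (p s - q s)‖ ^ 2 + ‖v s - v' s‖ ^ 2) ≤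
        c₂ * (1 + ‖q s‖ ^ 2) * (3 * α s + β s) := by
      refine mul_le_mul_of_nonneg_left ?_ (by positivity)
      linarith [sq_nonneg ‖θ s - θ' s‖, sq_nonneg ‖u s - u' s‖]
    linarith
  rw [intervalIntegral.integral_add ((i3.const_mul _).add (i4.const_mul _)) (i5.const_mul _),
    intervalIntegral.integral_add (i3.const_mul _) (i4.const_mul _),
    intervalIntegral.integral_const_mul, intervalIntegral.integral_const_mul,
    intervalIntegral.integral_const_mul] at key
  linarith

theorem diff_bound (R : ℝ) (hR : 0 ≤ R) : ∃ c : ℝ, 0 ≤ c ∧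
    ∀ (T : ℝ) (θ v w y p u θ' v' w' y' q u' : ℝ → SeqE), 0 ≤ T →
    HeatSol m.om T θ y (fun t => m.B (p t) (u t)) →
    HeatSol m.om T θ' y' (fun t => m.B (q t) (u' t)) →
    WaveSol m.lam T v w (fun t => m.h (p t)) → WaveSol m.lam T v' w' (fun t => m.h (q t)) →
    L2T T p → L2T T q →
    θ 0 = θ' 0 → v 0 = v' 0 → w 0 = w' 0 → (∀ t ∈ Icc 0 T, ‖u t‖ ≤ R) →
    ∀ a d Q : ℝ, 0 ≤ a → (∫ s in (0 : ℝ)..T, ‖p s - q s‖ ^ 2) ≤ d →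
    (∀ᵐ s ∂volume.restrict (Ioc 0 T), ‖m.J (p s - q s)‖ ^ 2 ≤ a) →
    (∀ s ∈ Icc 0 T, ‖u s - u' s‖ ^ 2 ≤ a) →
    c * (T + ∫ s in (0 : ℝ)..T, ‖q s‖ ^ 2) ≤ Q → Q ≤ 1 / 64 →
    (∀ s ∈ Icc 0 T, ‖θ s - θ' s‖ ^ 2 ≤ d / 8 + 8 * Q * a ∧
      ‖v s - v' s‖ ^ 2 ≤ d / 8 + 8 * Q * a) ∧
      (∫ s in (0 : ℝ)..T, ‖y s - y' s‖ ^ 2) ≤ d / 8 + 8 * Q * a := by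
  obtain ⟨c, hc, h⟩ := m.energy_diff R hR
  refine ⟨c, hc, fun T θ v w y p u θ' v' w' y' q u' hT H1 H2 G1 G2 hp hq hθ hv hw hu a d Q ha hd
    hJ hη hQ hQ' => ?_⟩
  have hcont : ContinuousOn (fun t => ‖θ t - θ' t‖ ^ 2 + ‖v t - v' t‖ ^ 2 + ‖w t - w' t‖ ^ 2)
      (Icc 0 T) :=
    (((H1.cont.sub H2.cont).norm.pow 2).add ((G1.contv.sub G2.contv).norm.pow 2)).add
      ((G1.contw.sub G2.contw).norm.pow 2)
  obtain ⟨t₀, ht₀, hmax⟩ := isCompact_Icc.exists_isMaxOn (nonempty_Icc.2 hT) hcont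
  set E := ‖θ t₀ - θ' t₀‖ ^ 2 + ‖v t₀ - v' t₀‖ ^ 2 + ‖w t₀ - w' t₀‖ ^ 2 with hE
  have hE0 : 0 ≤ E := by positivity
  have hEle : ∀ t ∈ Icc 0 T,
      ‖θ t - θ' t‖ ^ 2 + ‖v t - v' t‖ ^ 2 + ‖w t - w' t‖ ^ 2 ≤ E := fun t ht => hmax ht
  have HS := H1.sub H2
  have i1 : IntervalIntegrable (fun s => ‖p s - q s‖ ^ 2) volume 0 T := L2T.sq hT (hp.sub hq)
  have i2 : IntervalIntegrable (fun s => ‖y s - y' s‖ ^ 2) volume 0 T := HS.y2.sq hT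
  have i3 : IntervalIntegrable (fun s => ‖q s‖ ^ 2) volume 0 T := hq.sq hT
  set P := ∫ s in (0 : ℝ)..T, ‖y s - y' s‖ ^ 2 with hP
  have mono : ∀ {g : ℝ → ℝ}, IntervalIntegrable g volume 0 T → (∀ s, 0 ≤ g s) →
      ∀ t ∈ Icc 0 T, ∫ s in (0 : ℝ)..t, g s ≤ ∫ s in (0 : ℝ)..T, g s := fun hg hg0 t ht =>
    intervalIntegral.integral_mono_interval le_rfl ht.1 ht.2 (Eventually.of_forall hg0) hg
  have hq0 : 0 ≤ ∫ s in (0 : ℝ)..T, ‖q s‖ ^ 2 :=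
    intervalIntegral.integral_nonneg hT fun _ _ => by positivity
  have hQ0 : 0 ≤ Q := le_trans (by positivity) hQ
  have bound : ∀ t ∈ Icc 0 T, 1 / 2 * (‖θ t - θ' t‖ ^ 2 + ‖v t - v' t‖ ^ 2 + ‖w t - w' t‖ ^ 2) +
      ∫ s in (0 : ℝ)..t, ‖y s - y' s‖ ^ 2 ≤ 1 / 32 * d + 1 / 64 * P + Q * (3 * a + E) := by
    intro t ht
    have := h T θ v w y p u θ' v' w' y' q u' H1 H2 G1 G2 hp hq hθ hv hw hu t ht (fun _ => a)
      (fun _ => E) continuousOn_const continuousOn_const hJ hη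
      (fun s hs => by linarith [hEle s hs, sq_nonneg ‖w s - w' s‖])
    have m1 := mono i1 (fun s => by positivity) t ht
    have m2 := mono i2 (fun s => by positivity) t ht
    have m3 := mono (g := fun s => 1 + ‖q s‖ ^ 2) (intervalIntegrable_const.add i3)
      (fun s => by positivity) t ht
    rw [intervalIntegral.integral_add intervalIntegrable_const i3] at m3
    simp only [intervalIntegral.integral_const, smul_eq_mul, mul_one, sub_zero] at m3
    rw [intervalIntegral.integral_mul_const] at this
    have m4 : c * ((∫ s in (0 : ℝ)..t, (1 + ‖q s‖ ^ 2)) * (3 * a + E)) ≤ Q * (3 * a + E) := by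
      rw [← mul_assoc]
      exact mul_le_mul_of_nonneg_right ((mul_le_mul_of_nonneg_left m3 hc).trans hQ) (by positivity)
    linarith
  have b1 := bound t₀ ht₀
  have b2 := bound T ⟨hT, le_rfl⟩
  have n1 : 0 ≤ ∫ s in (0 : ℝ)..t₀, ‖y s - y' s‖ ^ 2 :=
    intervalIntegral.integral_nonneg ht₀.1 fun _ _ => by positivity
  have n2 : Q * E ≤ 1 / 64 * E := mul_le_mul_of_nonneg_right hQ' hE0
  have n3 : 0 ≤ Q * a := mul_nonneg hQ0 ha
  have n4 : 0 ≤ d := le_trans (intervalIntegral.integral_nonneg hT fun _ _ => by positivity) hd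
  have n5 : 0 ≤ ‖θ T - θ' T‖ ^ 2 + ‖v T - v' T‖ ^ 2 + ‖w T - w' T‖ ^ 2 := by positivity
  refine ⟨fun s hs => ?_, ?_⟩
  · have := hEle s hs
    constructor <;>
      linarith [sq_nonneg ‖θ s - θ' s‖, sq_nonneg ‖v s - v' s‖, sq_nonneg ‖w s - w' s‖]
  · linarith

end Model

theorem exists_self_related {X : Type*} [MetricSpace X] [CompleteSpace X] {s : Set X}
    (hs : IsClosed s) (hne : s.Nonempty) {Rel : X → X → Prop}
    (h1 : ∀ x ∈ s, ∃ x' ∈ s, Rel x x')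
    (h2 : ∀ x ∈ s, ∀ y ∈ s, ∀ x' y', Rel x x' → Rel y y' → dist x' y' ≤ 1 / 2 * dist x y) :
    ∃ x ∈ s, Rel x x := by
  choose! g hgs hg using h1
  have : CompleteSpace s := hs.completeSpace_coe
  have : Nonempty s := hne.to_subtype
  let G : s → s := fun x => ⟨g x, hgs x x.2⟩
  have hG : ContractingWith (1 / 2) G := by
    refine ⟨by rw [← NNReal.coe_lt_coe]; norm_num, LipschitzWith.of_dist_le_mul fun x y => ?_⟩
    have := h2 x x.2 y y.2 (g x) (g y) (hg x x.2) (hg y y.2)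
    simpa [G, Subtype.dist_eq] using this
  obtain ⟨p, hfix⟩ : ∃ p, G p = p := ⟨_, hG.fixedPoint_isFixedPt⟩
  refine ⟨p, p.2, ?_⟩
  have h3 := hg _ p.2
  have h4 : g p = p := congrArg Subtype.val hfix
  rwa [h4] at h3

theorem IsPrim.congr_eqOn {Z : Type*} [NormedAddCommGroup Z] [NormedSpace ℝ Z] {T : ℝ}
    {X X' r : ℝ → Z} (hT : 0 ≤ T) (h : IsPrim T X r) (hX : EqOn X' X (Icc 0 T)) :
    IsPrim T X' r :=
  ⟨h.1, fun t ht => by rw [hX ht, hX ⟨le_rfl, hT⟩]; exact h.2 t ht⟩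

theorem HeatSol.congr {om : ℕ → ℝ} {T : ℝ} {θ y ρ θ' y' ρ' : ℝ → SeqE} (hT : 0 ≤ T)
    (h : HeatSol om T θ y ρ) (hθ : EqOn θ' θ (Icc 0 T))
    (hy : y' =ᵐ[volume.restrict (Ioc 0 T)] y) (hρ : ρ' =ᵐ[volume.restrict (Ioc 0 T)] ρ) :
    HeatSol om T θ' y' ρ' := by
  refine ⟨h.cont.congr hθ, (memLp_congr_ae hy).2 h.y2, (memLp_congr_ae hρ).2 h.ρ2, ?_, fun k => ?_⟩
  · filter_upwards [h.yθ, hy, ae_restrict_mem measurableSet_Ioc] with t h1 h2 ht k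
    rw [h2, h1 k, hθ (Ioc_subset_Icc_self ht)]
  · refine ((h.mode k).congr_eqOn hT fun t ht => congrArg (fun x : SeqE => x k) (hθ ht)).congr_ae
      hT ?_
    filter_upwards [hy, hρ] with t h1 h2
    rw [h1, h2]

theorem WaveSol.congr {lam : ℕ → ℝ} {T : ℝ} {v w h v' w' h' : ℝ → SeqE} (hT : 0 ≤ T)
    (H : WaveSol lam T v w h) (hv : EqOn v' v (Icc 0 T)) (hw : EqOn w' w (Icc 0 T))
    (hh : h' =ᵐ[volume.restrict (Ioc 0 T)] h) : WaveSol lam T v' w' h' := by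
  refine ⟨H.contv.congr hv, H.contw.congr hw, (memLp_congr_ae hh).2 H.h2, fun k => ?_, fun k => ?_⟩
  · refine ((H.modev k).congr_eqOn hT fun t ht => congrArg (fun x : SeqE => x k) (hv ht)).congr_ae
      hT ?_
    filter_upwards [hh, ae_restrict_mem measurableSet_Ioc] with t h1 ht
    rw [h1, hw (Ioc_subset_Icc_self ht)]
  · refine ((H.modew k).congr_eqOn hT fun t ht => congrArg (fun x : SeqE => x k) (hw ht)).congr_ae
      hT ?_
    filter_upwards [ae_restrict_mem measurableSet_Ioc] with t ht
    rw [hv (Ioc_subset_Icc_self ht)]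

theorem dist_sq_eq_integral {τ : ℝ} (hτ : 0 ≤ τ) (f g : Lp SeqE 2 (volume.restrict (Ioc 0 τ))) :
    dist f g ^ 2 = ∫ t in (0 : ℝ)..τ, ‖f t - g t‖ ^ 2 := by
  rw [dist_eq_norm, ← real_inner_self_eq_norm_sq, L2.inner_def,
    intervalIntegral.integral_of_le hτ]
  refine integral_congr_ae ?_
  filter_upwards [Lp.coeFn_sub f g] with t ht
  rw [ht, real_inner_self_eq_norm_sq]
  rfl

theorem isClosed_ae_eq {τ : ℝ} (hτ : 0 ≤ τ) (W : SeqE →L[ℝ] SeqE) :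
    IsClosed {x : C(Icc (0 : ℝ) τ, SeqE × SeqE) × Lp SeqE 2 (volume.restrict (Ioc 0 τ)) |
      ∀ᵐ t ∂volume.restrict (Ioc 0 τ), W (x.2 t) = (x.1 (projIcc 0 τ hτ t)).1} := by
  refine IsSeqClosed.isClosed fun x l hx hl => ?_
  have h2 : Tendsto (fun n => (x n).2) atTop (nhds l.2) := (continuous_snd.tendsto l).comp hl
  have h1 : Tendsto (fun n => (x n).1) atTop (nhds l.1) := (continuous_fst.tendsto l).comp hl
  obtain ⟨ns, hns, hae⟩ := (tendstoInMeasure_of_tendsto_Lp h2).exists_seq_tendsto_ae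
  filter_upwards [hae, ae_all_iff.2 hx] with t ht hxt
  refine tendsto_nhds_unique ((W.continuous.tendsto _).comp ht) ?_
  have h3 : Tendsto (fun i => ((x (ns i)).1 (projIcc 0 τ hτ t)).1) atTop
      (nhds (l.1 (projIcc 0 τ hτ t)).1) :=
    (continuous_fst.tendsto _).comp
      (((continuous_eval_const (F := C(Icc (0 : ℝ) τ, SeqE × SeqE)) (projIcc 0 τ hτ t)).tendsto l.1).comp
        (h1.comp hns.tendsto_atTop))
  exact h3.congr fun i => (hxt (ns i)).symm

theorem continuousOn_projIcc {Z : Type*} [TopologicalSpace Z] {τ : ℝ} (hτ : 0 ≤ τ)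
    (g : C(Icc (0 : ℝ) τ, Z)) (s : Set ℝ) : ContinuousOn (fun t => g (projIcc 0 τ hτ t)) s :=
  (g.continuous.comp continuous_projIcc).continuousOn

namespace Model

variable {H C : Type*} [NormedAddCommGroup H] [InnerProductSpace ℝ H] [CompleteSpace H]
    [NormedAddCommGroup C] [NormedSpace ℝ C] (m : Model H C)

theorem exists_local (θ₀ v₀ w₀ : SeqE) : ∃ τ : ℝ, 0 < τ ∧ ∃ θ v w y, m.Sol τ θ v w y ∧
    θ 0 = θ₀ ∧ v 0 = v₀ ∧ w 0 = w₀ := by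
  classical
  obtain ⟨θl, yl, Hl, hθl⟩ := exists_heatSol (om := m.om) zero_le_one θ₀
    (ρ := fun _ => m.B 0 0) (L2T.of_continuousOn continuousOn_const)
  obtain ⟨vl, wl, Gl, hvl, hwl⟩ := exists_waveSol (lam := m.lam) zero_le_one v₀ w₀
    (h := fun _ => m.h 0) (L2T.of_continuousOn continuousOn_const)
  obtain ⟨R₁, hR₁⟩ := isCompact_Icc.exists_bound_of_continuousOn Hl.cont
  obtain ⟨R₂, hR₂⟩ := isCompact_Icc.exists_bound_of_continuousOn Gl.contv
  set R : ℝ := |R₁| + |R₂| + 1 with hRdef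
  have hR : 0 ≤ R := by positivity
  obtain ⟨c, hc, hdiff⟩ := m.diff_bound R hR
  set r : ℝ := 1 / (512 * (c + 1)) with hr
  have hr0 : 0 < r := by positivity
  have hr1 : r ≤ 1 := by
    rw [hr, div_le_one (by positivity)]; linarith
  have hcr : c * (4 * r ^ 2) ≤ 1 / 128 := by
    have h1 : c * r ≤ 1 / 512 := by
      rw [hr, mul_one_div, div_le_div_iff₀ (by positivity) (by norm_num)]; linarith
    have h2 := mul_le_mul h1 hr1 hr0.le (by norm_num)
    linarith
  set Q₀ : ℝ := min (1 / 128) (r ^ 2 / (16 * R ^ 2 + 16)) with hQ₀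
  have hQpos : 0 < Q₀ := by positivity
  have hQR : 8 * Q₀ * R ^ 2 ≤ r ^ 2 / 2 := by
    have h1 : Q₀ ≤ r ^ 2 / (16 * R ^ 2 + 16) := min_le_right _ _
    rw [le_div_iff₀ (by positivity)] at h1
    linarith
  obtain ⟨τ, hτ0, hτ1, hcτ, hyl⟩ : ∃ τ : ℝ, 0 < τ ∧ τ ≤ 1 ∧ c * τ ≤ Q₀ ∧
      (∫ t in (0 : ℝ)..τ, ‖yl t‖ ^ 2) ≤ r ^ 2 := by
    have hi := Hl.y2.sq zero_le_one
    have hcont : ContinuousOn (fun t => ∫ s in (0 : ℝ)..t, ‖yl s‖ ^ 2) (Icc 0 1) := by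
      have := intervalIntegral.continuousOn_primitive_interval (a := 0) (b := 1) (μ := volume)
        (f := fun s => ‖yl s‖ ^ 2) (by
          rw [uIcc_of_le zero_le_one]
          exact (intervalIntegrable_iff_integrableOn_Icc_of_le zero_le_one).1 hi)
      rwa [uIcc_of_le zero_le_one] at this
    have h1 : Tendsto (fun t => ∫ s in (0 : ℝ)..t, ‖yl s‖ ^ 2) (nhdsWithin 0 (Ioc 0 1)) (nhds 0) := by
      have := (hcont 0 ⟨le_rfl, zero_le_one⟩).mono_left (nhdsWithin_mono 0 Ioc_subset_Icc_self)
      simpa using this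
    have h2 : Tendsto (fun t : ℝ => c * t) (nhdsWithin 0 (Ioc 0 1)) (nhds 0) := by
      have : Tendsto (fun t : ℝ => c * t) (nhds 0) (nhds (c * 0)) :=
        (continuous_const.mul continuous_id).tendsto 0
      rw [mul_zero] at this
      exact this.mono_left nhdsWithin_le_nhds
    have : (nhdsWithin (0 : ℝ) (Ioc 0 1)).NeBot := by
      rw [nhdsWithin_Ioc_eq_nhdsGT one_pos]; infer_instance
    obtain ⟨τ, ⟨h3, h4⟩, h5⟩ := ((h1.eventually_le_const (by positivity : 0 < r ^ 2)).and
      (h2.eventually_le_const hQpos)).and self_mem_nhdsWithin |>.exists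
    exact ⟨τ, h5.1, h5.2, h4, h3⟩
  have hτ : (0 : ℝ) ≤ τ := hτ0.le
  have hτI : τ ∈ Icc (0 : ℝ) 1 := ⟨hτ, hτ1⟩
  have Hl' := Hl.mono hτI
  have Gl' := Gl.mono hτI
  let X := C(Icc (0 : ℝ) τ, SeqE × SeqE) × Lp SeqE 2 (volume.restrict (Ioc 0 τ))
  let pr : ℝ → Icc (0 : ℝ) τ := projIcc 0 τ hτ
  have hpr : ∀ {t} (ht : t ∈ Icc 0 τ), pr t = ⟨t, ht⟩ := fun ht => projIcc_of_mem hτ ht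
  let Rel : X → X → Prop := fun x x' => ∃ w,
    HeatSol m.om τ (fun t => (x'.1 (pr t)).1) (fun t => x'.2 t)
      (fun t => m.B (x.2 t) (x.1 (pr t)).2) ∧
    WaveSol m.lam τ (fun t => (x'.1 (pr t)).2) w (fun t => m.h (x.2 t)) ∧
    (x'.1 (pr 0)).1 = θ₀ ∧ (x'.1 (pr 0)).2 = v₀ ∧ w 0 = w₀
  let mk : ∀ (θ v y : ℝ → SeqE), ContinuousOn θ (Icc 0 τ) → ContinuousOn v (Icc 0 τ) →
      L2T τ y → X := fun θ v y hθ hv hy =>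
    (⟨fun t => (θ t, v t), (hθ.domRestrict).prodMk (hv.domRestrict)⟩, MemLp.toLp y hy)
  have mkRel : ∀ (x : X) (θ v w y : ℝ → SeqE) (hy : L2T τ y) (hθ : ContinuousOn θ (Icc 0 τ))
      (hv : ContinuousOn v (Icc 0 τ)),
      HeatSol m.om τ θ y (fun t => m.B (x.2 t) (x.1 (pr t)).2) →
      WaveSol m.lam τ v w (fun t => m.h (x.2 t)) → θ 0 = θ₀ → v 0 = v₀ → w 0 = w₀ →
      Rel x (mk θ v y hθ hv hy) := by
    intro x θ v w y hy hθ hv hH hG e1 e2 e3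
    have h0 : pr 0 = ⟨0, le_rfl, hτ⟩ := hpr ⟨le_rfl, hτ⟩
    refine ⟨w, hH.congr hτ (fun t ht => ?_) (MemLp.coeFn_toLp hy) (Eventually.of_forall fun _ => rfl),
      hG.congr hτ (fun t ht => ?_) (fun _ _ => rfl) (Eventually.of_forall fun _ => rfl), ?_, ?_, e3⟩
    · simp only [mk, hpr ht]; rfl
    · simp only [mk, hpr ht]; rfl
    · simp only [mk, h0]; exact e1
    · simp only [mk, h0]; exact e2
  have distle : ∀ (x x' : X) (q : ℝ), 0 ≤ q →
      (∀ t ∈ Icc 0 τ, ‖(x.1 (pr t)).1 - (x'.1 (pr t)).1‖ ^ 2 ≤ q ^ 2 ∧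
        ‖(x.1 (pr t)).2 - (x'.1 (pr t)).2‖ ^ 2 ≤ q ^ 2) →
      (∫ t in (0 : ℝ)..τ, ‖x.2 t - x'.2 t‖ ^ 2) ≤ q ^ 2 → dist x x' ≤ q := by
    intro x x' q hq h1 h2
    refine max_le ((ContinuousMap.dist_le hq).2 fun t => ?_) ?_
    · have := h1 t t.2
      rw [show pr t = t from hpr t.2] at this
      rw [Prod.dist_eq, dist_eq_norm, dist_eq_norm]
      exact max_le (abs_le_of_sq_le_sq' this.1 hq).2 (abs_le_of_sq_le_sq' this.2 hq).2
    · rw [← dist_sq_eq_integral hτ] at h2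
      exact (abs_le_of_sq_le_sq' h2 hq).2
  have ledist : ∀ (x x' : X) (t : Icc (0 : ℝ) τ), ‖(x.1 t).1 - (x'.1 t).1‖ ≤ dist x x' ∧
      ‖(x.1 t).2 - (x'.1 t).2‖ ≤ dist x x' := by
    intro x x' t
    have h1 : dist (x.1 t) (x'.1 t) ≤ dist x x' :=
      (ContinuousMap.dist_apply_le_dist t).trans (le_max_left _ _)
    rw [← dist_eq_norm, ← dist_eq_norm]
    exact ⟨(le_max_left _ _).trans h1, (le_max_right _ _).trans h1⟩
  let xl : X := mk θl vl yl Hl'.cont Gl'.contv Hl'.y2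
  let s : Set X := Metric.closedBall xl r ∩
    {x | ∀ᵐ t ∂volume.restrict (Ioc 0 τ), m.W (x.2 t) = (x.1 (projIcc 0 τ hτ t)).1}
  have hs : IsClosed s := Metric.isClosed_closedBall.inter (isClosed_ae_eq hτ m.W)
  have hne : s.Nonempty := by
    refine ⟨xl, Metric.mem_closedBall_self hr0.le, ?_⟩
    have h1 : ⇑(xl.2) =ᵐ[volume.restrict (Ioc 0 τ)] yl := MemLp.coeFn_toLp Hl'.y2
    filter_upwards [h1, Hl'.yθ, ae_restrict_mem measurableSet_Ioc] with t h2 h3 ht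
    rw [h2, m.W_of_coord h3]
    simp only [xl, mk, projIcc_of_mem hτ (Ioc_subset_Icc_self ht)]; rfl
  have bnd : ∀ x ∈ s, ∀ t : Icc (0 : ℝ) τ, ‖(x.1 t).1‖ ≤ R ∧ ‖(x.1 t).2‖ ≤ R := by
    intro x hx t
    have h1 := ledist x xl t
    have h2 : dist x xl ≤ r := hx.1
    have ht : (t : ℝ) ∈ Icc (0 : ℝ) 1 := ⟨t.2.1, t.2.2.trans hτ1⟩
    have h3 := (hR₁ t ht).trans (le_abs_self _)
    have h4 := (hR₂ t ht).trans (le_abs_self _)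
    have h5 : (xl.1 t).1 = θl t := rfl
    have h6 : (xl.1 t).2 = vl t := rfl
    rw [h5, h6] at h1
    constructor
    · have := norm_le_norm_add_norm_sub' (x.1 t).1 (θl t)
      linarith [h1.1, abs_nonneg R₂]
    · have := norm_le_norm_add_norm_sub' (x.1 t).2 (vl t)
      linarith [h1.2, abs_nonneg R₁]
  have ybnd : ∀ x ∈ s, (∫ t in (0 : ℝ)..τ, ‖x.2 t‖ ^ 2) ≤ 4 * r ^ 2 := by
    intro x hx
    have e : ∀ f : Lp SeqE 2 (volume.restrict (Ioc 0 τ)),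
        ∫ t in (0 : ℝ)..τ, ‖f t‖ ^ 2 = ‖f‖ ^ 2 := by
      intro f
      rw [← real_inner_self_eq_norm_sq, L2.inner_def, intervalIntegral.integral_of_le hτ]
      simp only [real_inner_self_eq_norm_sq]
    have h1 : ‖xl.2‖ ≤ r := by
      refine (abs_le_of_sq_le_sq' ?_ hr0.le).2
      rw [← e]
      refine le_trans (le_of_eq ?_) hyl
      rw [intervalIntegral.integral_of_le hτ, intervalIntegral.integral_of_le hτ]
      refine integral_congr_ae ?_
      have h1 : ⇑(xl.2) =ᵐ[volume.restrict (Ioc 0 τ)] yl := MemLp.coeFn_toLp Hl'.y2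
      filter_upwards [h1] with t ht
      rw [ht]
    have h2 : dist x.2 xl.2 ≤ r := (le_max_right _ _).trans hx.1
    rw [dist_eq_norm] at h2
    have h3 := norm_le_norm_add_norm_sub' x.2 xl.2
    have h4 : ‖x.2‖ ≤ 2 * r := by linarith
    rw [e]
    nlinarith [norm_nonneg x.2]
  have hcQ : c * τ ≤ 1 / 128 := hcτ.trans (min_le_left _ _)
  suffices hfix : ∃ x ∈ s, Rel x x by
    obtain ⟨x, hx, w, h1, h2, h3, h4, h5⟩ := hfix
    exact ⟨τ, hτ0, _, _, w, _, ⟨h1, h2⟩, h3, h4, h5⟩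
  refine exists_self_related hs hne (Rel := Rel) ?_ ?_
  · intro x hx
    have hy : L2T τ (fun t => x.2 t) := Lp.memLp x.2
    have hvc : ContinuousOn (fun t => (x.1 (pr t)).2) (Icc 0 τ) :=
      continuous_snd.comp_continuousOn (continuousOn_projIcc hτ x.1 _)
    obtain ⟨θ, y, Hh, hθ⟩ := exists_heatSol (om := m.om) hτ θ₀ (m.L2T_B hy hvc)
    obtain ⟨v, w, Hw, hv, hw⟩ := exists_waveSol (lam := m.lam) hτ v₀ w₀ (m.L2T_h hy)
    have hRel := mkRel x θ v w y Hh.y2 Hh.cont Hw.contv Hh Hw hθ hv hw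
    refine ⟨_, ⟨?_, ?_⟩, hRel⟩
    · have hb := hdiff τ θ v w y (fun t => x.2 t) (fun t => (x.1 (pr t)).2) θl vl wl yl
        (fun _ => 0) (fun _ => 0) hτ Hh Hl' Hw Gl' hy (L2T.of_continuousOn continuousOn_const)
        (hθ.trans hθl.symm) (hv.trans hvl.symm) (hw.trans hwl.symm) (fun t _ => (bnd x hx _).2)
        (R ^ 2) (4 * r ^ 2) Q₀ (by positivity) (by simpa using ybnd x hx) ?_ ?_ (by simpa using hcτ)
        ((min_le_left _ _).trans (by norm_num))
      · have hle : 4 * r ^ 2 / 8 + 8 * Q₀ * R ^ 2 ≤ r ^ 2 := by linarith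
        refine distle _ _ r hr0.le (fun t ht => ?_) ?_
        · have := hb.1 t ht
          simp only [xl, mk, hpr ht]
          exact ⟨this.1.trans hle, this.2.trans hle⟩
        · refine le_trans (le_of_eq ?_) (hb.2.trans hle)
          rw [intervalIntegral.integral_of_le hτ, intervalIntegral.integral_of_le hτ]
          refine integral_congr_ae ?_
          filter_upwards [MemLp.coeFn_toLp Hl'.y2, MemLp.coeFn_toLp Hh.y2] with t ht ht'
          simp only [xl, mk]
          rw [ht, ht']
      · filter_upwards [hx.2] with t ht
        rw [sub_zero, ← m.norm_W, ht]
        exact pow_le_pow_left₀ (norm_nonneg _) (bnd x hx _).1 2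
      · intro t _
        rw [sub_zero]
        exact pow_le_pow_left₀ (norm_nonneg _) (bnd x hx _).2 2
    · filter_upwards [MemLp.coeFn_toLp Hh.y2, Hh.yθ, ae_restrict_mem measurableSet_Ioc]
        with t h2 h3 ht
      simp only [mk, projIcc_of_mem hτ (Ioc_subset_Icc_self ht)]
      rw [h2, m.W_of_coord h3]; rfl
  · rintro x hx x' hx' z z' ⟨w, h1, h2, h3, h4, h5⟩ ⟨w', h1', h2', h3', h4', h5'⟩
    have hQ : c * (τ + ∫ t in (0 : ℝ)..τ, ‖x'.2 t‖ ^ 2) ≤ 1 / 64 := by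
      have := mul_le_mul_of_nonneg_left (ybnd x' hx') hc
      linarith
    have hd0 : 0 ≤ dist x x' := dist_nonneg
    have hb := hdiff τ _ _ w _ (fun t => x.2 t) (fun t => (x.1 (pr t)).2) _ _ w' _
        (fun t => x'.2 t) (fun t => (x'.1 (pr t)).2) hτ h1 h1' h2 h2' (Lp.memLp x.2) (Lp.memLp x'.2)
        (h3.trans h3'.symm) (h4.trans h4'.symm) (h5.trans h5'.symm) (fun t _ => (bnd x hx _).2)
        (dist x x' ^ 2) (dist x x' ^ 2) (1 / 64) (by positivity) ?_ ?_ ?_ hQ le_rfl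
    · have e : dist x x' ^ 2 / 8 + 8 * (1 / 64) * dist x x' ^ 2 = (1 / 2 * dist x x') ^ 2 := by ring
      rw [e] at hb
      exact distle _ _ _ (by positivity) hb.1 hb.2
    · rw [← dist_sq_eq_integral hτ]
      exact pow_le_pow_left₀ dist_nonneg (le_max_right _ _) 2
    · filter_upwards [hx.2, hx'.2] with t ht ht'
      rw [← m.norm_W, map_sub, ht, ht']
      exact pow_le_pow_left₀ (norm_nonneg _) (ledist x x' _).1 2
    · intro t _
      exact pow_le_pow_left₀ (norm_nonneg _) (ledist x x' _).2 2

end Model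

/-- Grönwall's inequality with an integrable coefficient. -/
theorem le_mul_exp_of_le_integral {T A : ℝ} {E g : ℝ → ℝ} (hT : 0 ≤ T)
    (hE : ContinuousOn E (Icc 0 T)) (hg : IntervalIntegrable g volume 0 T) (hg0 : ∀ t, 0 ≤ g t)
    (h : ∀ t ∈ Icc 0 T, E t ≤ A + ∫ s in (0 : ℝ)..t, g s * E s) {t : ℝ} (ht : t ∈ Icc 0 T) :
    E t ≤ A * Real.exp (∫ s in (0 : ℝ)..t, g s) := by
  have hgE : IntervalIntegrable (fun s => g s * E s) volume 0 T :=
    hg.mul_continuousOn (by rwa [uIcc_of_le hT])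
  have hX := IsPrim.of_integral (x₀ := A) hgE
  have hG := (IsPrim.of_integral (x₀ := (0 : ℝ)) hg).const_mul (-1)
  have hexp := hG.comp hT (G := Real.exp)
    (G' := fun z => Real.exp z • ContinuousLinearMap.id ℝ ℝ)
    (fun z => (Real.hasDerivAt_exp z).hasFDerivAt.congr_fderiv (ContinuousLinearMap.ext fun w => by
      simp [mul_comm])) (fun R => ⟨Real.exp R, fun z hz => by
        rw [norm_smul, Real.norm_eq_abs, abs_of_pos (Real.exp_pos z)]
        calc _ ≤ Real.exp z * 1 :=
              mul_le_mul_of_nonneg_left ContinuousLinearMap.norm_id_le (Real.exp_pos _).le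
          _ ≤ _ := by
            rw [mul_one]
            exact Real.exp_le_exp.2 ((le_abs_self z).trans hz)⟩)
  have hP := (hX.mul hT hexp).mono ht
  have e := hP.2 t ⟨ht.1, le_rfl⟩
  simp only [intervalIntegral.integral_same, zero_add, add_zero, mul_zero, Real.exp_zero,
    mul_one, _root_.smul_apply, ContinuousLinearMap.id_apply, smul_eq_mul] at e
  have hneg : (∫ s in (0 : ℝ)..t, ((A + ∫ s in (0 : ℝ)..s, g s * E s) *
      (Real.exp (-1 * ∫ s in (0 : ℝ)..s, g s) * (-1 * g s)) +
      g s * E s * Real.exp (-1 * ∫ s in (0 : ℝ)..s, g s))) ≤ 0 := by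
    rw [← neg_nonneg, ← intervalIntegral.integral_neg]
    refine intervalIntegral.integral_nonneg ht.1 fun s hs => ?_
    have h1 := h s ⟨hs.1, hs.2.trans ht.2⟩
    have h2 := mul_nonneg (hg0 s) (Real.exp_pos (-1 * ∫ s in (0 : ℝ)..s, g s)).le
    nlinarith [mul_nonneg h2 (sub_nonneg.2 h1)]
  have h3 := mul_le_mul_of_nonneg_right (e.trans_le (add_le_of_nonpos_right hneg))
    (Real.exp_pos (∫ s in (0 : ℝ)..t, g s)).le
  rw [mul_assoc, ← Real.exp_add, neg_one_mul, neg_add_cancel, Real.exp_zero, mul_one] at h3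
  exact (h t ht).trans h3

namespace Model

variable {H C : Type*} [NormedAddCommGroup H] [InnerProductSpace ℝ H] [CompleteSpace H]
    [NormedAddCommGroup C] [NormedSpace ℝ C] (m : Model H C)

variable {m} in
theorem Sol.mono {T t : ℝ} {θ v w y : ℝ → SeqE} (h : m.Sol T θ v w y) (ht : t ∈ Icc 0 T) :
    m.Sol t θ v w y := ⟨h.heat.mono ht, h.wave.mono ht⟩

variable {m} in
theorem Sol.eqOn {T : ℝ} {θ v w y θ' v' w' y' : ℝ → SeqE} (hT : 0 ≤ T) (h : m.Sol T θ v w y)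
    (h' : m.Sol T θ' v' w' y') (hθ : θ 0 = θ' 0) (hv : v 0 = v' 0) (hw : w 0 = w' 0) :
    EqOn θ θ' (Icc 0 T) ∧ EqOn v v' (Icc 0 T) ∧ EqOn w w' (Icc 0 T) := by
  obtain ⟨R, hR⟩ := isCompact_Icc.exists_bound_of_continuousOn h.wave.contv
  obtain ⟨c, hc, hdiff⟩ := m.energy_diff |R| (abs_nonneg R)
  set E : ℝ → ℝ := fun t => ‖θ t - θ' t‖ ^ 2 + ‖v t - v' t‖ ^ 2 + ‖w t - w' t‖ ^ 2 with hE
  have hEc : ContinuousOn E (Icc 0 T) :=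
    (((h.heat.cont.sub h'.heat.cont).norm.pow 2).add
      ((h.wave.contv.sub h'.wave.contv).norm.pow 2)).add
      ((h.wave.contw.sub h'.wave.contw).norm.pow 2)
  have hgi : IntervalIntegrable (fun s => 8 * c * (1 + ‖y' s‖ ^ 2)) volume 0 T :=
    ((intervalIntegrable_const).add (L2T.sq hT h'.heat.y2)).const_mul (8 * c)
  have key : ∀ t ∈ Icc 0 T, E t ≤ 0 + ∫ s in (0 : ℝ)..t, 8 * c * (1 + ‖y' s‖ ^ 2) * E s := by
    intro t ht
    have h1 := hdiff T θ v w y y v θ' v' w' y' y' v' h.heat h'.heat h.wave h'.wave h.heat.y2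
      h'.heat.y2 hθ hv hw (fun t ht => (hR t ht).trans (le_abs_self R)) t ht E E hEc hEc ?_ ?_ ?_
    · have h2 : (∫ s in (0 : ℝ)..t, 8 * c * (1 + ‖y' s‖ ^ 2) * E s) =
          2 * (c * ∫ s in (0 : ℝ)..t, (1 + ‖y' s‖ ^ 2) * (3 * E s + E s)) := by
        rw [← intervalIntegral.integral_const_mul, ← intervalIntegral.integral_const_mul]
        refine intervalIntegral.integral_congr fun s _ => ?_
        ring
      have h3 : 0 ≤ ∫ s in (0 : ℝ)..t, ‖y s - y' s‖ ^ 2 :=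
        intervalIntegral.integral_nonneg ht.1 fun _ _ => by positivity
      rw [h2]
      simp only [hE] at h1 ⊢
      linarith
    · filter_upwards [h.heat.yθ, h'.heat.yθ] with s hs hs'
      rw [← m.norm_W, map_sub, m.W_of_coord hs, m.W_of_coord hs']
      simp only [hE]
      linarith [sq_nonneg ‖v s - v' s‖, sq_nonneg ‖w s - w' s‖]
    · intro s _
      simp only [hE]
      linarith [sq_nonneg ‖θ s - θ' s‖, sq_nonneg ‖w s - w' s‖]
    · intro s _
      simp only [hE]
      linarith [sq_nonneg ‖w s - w' s‖]
  have h0 : ∀ t ∈ Icc 0 T, E t ≤ 0 := fun t ht => by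
    simpa using le_mul_exp_of_le_integral hT hEc hgi (fun t => by positivity) key ht
  have hz : ∀ x y : SeqE, ‖x - y‖ ^ 2 ≤ 0 → x = y := fun x y h => by
    rw [← sub_eq_zero, ← norm_eq_zero]
    exact pow_eq_zero_iff two_ne_zero |>.1 (le_antisymm h (sq_nonneg _))
  refine ⟨fun t ht => hz _ _ ?_, fun t ht => hz _ _ ?_, fun t ht => hz _ _ ?_⟩ <;>
  · have := h0 t ht
    simp only [hE] at this
    linarith [sq_nonneg ‖θ t - θ' t‖, sq_nonneg ‖v t - v' t‖, sq_nonneg ‖w t - w' t‖]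

end Model

/-- Concatenation of two curves at time `T`. -/
def glue {Z : Type*} (T : ℝ) (f g : ℝ → Z) : ℝ → Z := fun t => if t ≤ T then f t else g (t - T)

section glue

variable {Z : Type*} {T τ : ℝ} {f g : ℝ → Z}

theorem glue_of_le {t : ℝ} (h : t ≤ T) : glue T f g t = f t := if_pos h

theorem glue_of_lt {t : ℝ} (h : T < t) : glue T f g t = g (t - T) := if_neg h.not_ge

theorem map_preserving_sub_Ioc (T τ : ℝ) : MeasurePreserving (fun t : ℝ => t - T)
    (volume.restrict (Ioc T (T + τ))) (volume.restrict (Ioc 0 τ)) := by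
  have := (measurePreserving_sub_right (volume : Measure ℝ) T).restrict_preimage
    (measurableSet_Ioc (a := 0) (b := τ))
  have e : (fun t : ℝ => t - T) ⁻¹' Ioc 0 τ = Ioc T (T + τ) := by
    ext t; simp [add_comm]
  rwa [e] at this

theorem restrict_Ioc_add (hT : 0 ≤ T) (hτ : 0 ≤ τ) : volume.restrict (Ioc 0 (T + τ)) =
    volume.restrict (Ioc 0 T) + volume.restrict (Ioc T (T + τ)) := by
  rw [← Ioc_union_Ioc_eq_Ioc hT (by linarith : T ≤ T + τ),
    Measure.restrict_union (Ioc_disjoint_Ioc_of_le le_rfl) measurableSet_Ioc]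

theorem ae_glue (hT : 0 ≤ T) (hτ : 0 ≤ τ) {p : ℝ → Prop} :
    (∀ᵐ t ∂volume.restrict (Ioc 0 T), p t) → (∀ᵐ t ∂volume.restrict (Ioc 0 τ), p (t + T)) →
    ∀ᵐ t ∂volume.restrict (Ioc 0 (T + τ)), p t := by
  intro h1 h2
  rw [restrict_Ioc_add hT hτ, ae_add_measure_iff]
  refine ⟨h1, ?_⟩
  filter_upwards [(map_preserving_sub_Ioc T τ).quasiMeasurePreserving.ae h2] with t ht
  simpa using ht

theorem glue_ae_left : glue T f g =ᵐ[volume.restrict (Ioc 0 T)] f := by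
  filter_upwards [ae_restrict_mem measurableSet_Ioc] with t ht
  exact glue_of_le ht.2

theorem glue_ae_right :
    glue T f g =ᵐ[volume.restrict (Ioc T (T + τ))] fun t => g (t - T) := by
  filter_upwards [ae_restrict_mem measurableSet_Ioc] with t ht
  exact glue_of_lt ht.1

theorem L2T.glue {f g : ℝ → SeqE} (hT : 0 ≤ T) (hτ : 0 ≤ τ) (hf : L2T T f) (hg : L2T τ g) :
    L2T (T + τ) (glue T f g) := by
  unfold L2T
  rw [restrict_Ioc_add hT hτ]
  have h1 : MemLp (_root_.glue T f g) 2 (volume.restrict (Ioc 0 T)) :=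
    (memLp_congr_ae glue_ae_left).2 hf
  have h2 : MemLp (_root_.glue T f g) 2 (volume.restrict (Ioc T (T + τ))) :=
    (memLp_congr_ae glue_ae_right).2 (MemLp.comp_measurePreserving hg (map_preserving_sub_Ioc T τ))
  refine ⟨h1.1.add_measure h2.1, ?_⟩
  have a1 := h1.2; have a2 := h2.2
  rw [eLpNorm_lt_top_iff_lintegral_rpow_enorm_lt_top (by norm_num) (by norm_num)] at a1 a2 ⊢
  rw [lintegral_add_measure]
  exact ENNReal.add_lt_top.2 ⟨a1, a2⟩

theorem continuousOn_glue [TopologicalSpace Z] (hT : 0 ≤ T) (hτ : 0 ≤ τ)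
    (hf : ContinuousOn f (Icc 0 T)) (hg : ContinuousOn g (Icc 0 τ)) (h : g 0 = f T) :
    ContinuousOn (glue T f g) (Icc 0 (T + τ)) := by
  have e : Icc 0 (T + τ) = Icc 0 T ∪ Icc T (T + τ) :=
    (Icc_union_Icc_eq_Icc hT (by linarith)).symm
  rw [e]
  refine ContinuousOn.union_of_isClosed ?_ ?_ isClosed_Icc isClosed_Icc
  · exact hf.congr fun t ht => glue_of_le ht.2
  · have h1 : ContinuousOn (fun t => g (t - T)) (Icc T (T + τ)) :=
      hg.comp (by fun_prop) fun t ht => ⟨by linarith [ht.1], by linarith [ht.2]⟩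
    refine h1.congr fun t ht => ?_
    rcases ht.1.eq_or_lt with rfl | h2
    · simp only [glue_of_le le_rfl, sub_self, h]
    · exact glue_of_lt h2

theorem IsPrim.glue [NormedAddCommGroup Z] [NormedSpace ℝ Z] {X r X' r' : ℝ → Z} (hT : 0 ≤ T)
    (hτ : 0 ≤ τ) (h : IsPrim T X r) (h' : IsPrim τ X' r') (h0 : X' 0 = X T) :
    IsPrim (T + τ) (glue T X X') (glue T r r') := by
  have i1 : ∀ t ∈ Icc 0 T, IntervalIntegrable (_root_.glue T r r') volume 0 t := fun t ht =>
    (h.1.sub_right ht).congr fun s hs => by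
      rw [uIoc_of_le ht.1] at hs
      exact (glue_of_le (hs.2.trans ht.2)).symm
  have e1 : ∀ t ∈ Icc T (T + τ), EqOn (fun s => r' (s - T)) (_root_.glue T r r') (uIoc T t) :=
    fun t ht s hs => by
      rw [uIoc_of_le ht.1] at hs
      exact (glue_of_lt hs.1).symm
  have i2 : ∀ t ∈ Icc T (T + τ), IntervalIntegrable (_root_.glue T r r') volume T t := by
    intro t ht
    refine IntervalIntegrable.congr (e1 t ht) ?_
    have := (h'.1.sub_right (t := t - T) ⟨by linarith [ht.1], by linarith [ht.2]⟩).comp_sub_right T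
    simpa using this
  have hI : T ∈ Icc 0 T := ⟨hT, le_rfl⟩
  refine ⟨(i1 T hI).trans (i2 _ ⟨by linarith, le_rfl⟩), fun t ht => ?_⟩
  rw [glue_of_le hT]
  have e2 : ∀ t ∈ Icc 0 T, (∫ s in (0 : ℝ)..t, _root_.glue T r r' s) = ∫ s in (0 : ℝ)..t, r s :=
    fun t ht => intervalIntegral.integral_congr_ae (Eventually.of_forall fun s hs => by
      rw [uIoc_of_le ht.1] at hs
      exact glue_of_le (hs.2.trans ht.2))
  rcases le_or_gt t T with htT | htT
  · rw [glue_of_le htT, h.2 t ⟨ht.1, htT⟩, e2 t ⟨ht.1, htT⟩]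
  · have htI : t ∈ Icc T (T + τ) := ⟨htT.le, ht.2⟩
    rw [glue_of_lt htT, ← intervalIntegral.integral_add_adjacent_intervals (i1 T hI) (i2 t htI),
      e2 T hI, ← add_assoc, ← h.2 T hI, ← h0, h'.2 (t - T) ⟨by linarith, by linarith [ht.2]⟩]
    congr 1
    rw [← intervalIntegral.integral_congr_ae (Eventually.of_forall (e1 t htI)),
      intervalIntegral.integral_comp_sub_right (fun s => r' s)]
    simp

end glue

theorem HeatSol.glue {om : ℕ → ℝ} {T τ : ℝ} {θ y ρ θ' y' ρ' : ℝ → SeqE} (hT : 0 ≤ T) (hτ : 0 ≤ τ)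
    (h : HeatSol om T θ y ρ) (h' : HeatSol om τ θ' y' ρ') (h0 : θ' 0 = θ T) :
    HeatSol om (T + τ) (glue T θ θ') (glue T y y') (glue T ρ ρ') := by
  refine ⟨continuousOn_glue hT hτ h.cont h'.cont h0, h.y2.glue hT hτ h'.y2, h.ρ2.glue hT hτ h'.ρ2,
    ae_glue hT hτ ?_ ?_, fun k => ?_⟩
  · filter_upwards [h.yθ, ae_restrict_mem measurableSet_Ioc] with t ht hm
    simpa only [glue_of_le hm.2] using ht
  · filter_upwards [h'.yθ, ae_restrict_mem measurableSet_Ioc] with t ht hm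
    simpa only [glue_of_lt (lt_add_of_pos_left T hm.1), add_sub_cancel_right] using ht
  · have := (h.mode k).glue hT hτ (h'.mode k) (congrArg (fun x : SeqE => x k) h0)
    refine (congrArg₂ (IsPrim _) (funext fun t => ?_) (funext fun t => ?_)).mp this <;>
    · unfold _root_.glue
      split_ifs <;> rfl

theorem WaveSol.glue {lam : ℕ → ℝ} {T τ : ℝ} {v w h v' w' h' : ℝ → SeqE} (hT : 0 ≤ T) (hτ : 0 ≤ τ)
    (H : WaveSol lam T v w h) (H' : WaveSol lam τ v' w' h') (hv : v' 0 = v T) (hw : w' 0 = w T) :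
    WaveSol lam (T + τ) (glue T v v') (glue T w w') (glue T h h') := by
  refine ⟨continuousOn_glue hT hτ H.contv H'.contv hv, continuousOn_glue hT hτ H.contw H'.contw hw,
    H.h2.glue hT hτ H'.h2, fun k => ?_, fun k => ?_⟩
  · have := (H.modev k).glue hT hτ (H'.modev k) (congrArg (fun x : SeqE => x k) hv)
    refine (congrArg₂ (IsPrim _) (funext fun t => ?_) (funext fun t => ?_)).mp this <;>
    · unfold _root_.glue
      split_ifs <;> rfl
  · have := (H.modew k).glue hT hτ (H'.modew k) (congrArg (fun x : SeqE => x k) hw)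
    refine (congrArg₂ (IsPrim _) (funext fun t => ?_) (funext fun t => ?_)).mp this <;>
    · unfold _root_.glue
      split_ifs <;> rfl

namespace Model

variable {H C : Type*} [NormedAddCommGroup H] [InnerProductSpace ℝ H] [CompleteSpace H]
    [NormedAddCommGroup C] [NormedSpace ℝ C] {m : Model H C}

theorem Sol.glue {T τ : ℝ} {θ v w y θ' v' w' y' : ℝ → SeqE} (hT : 0 ≤ T) (hτ : 0 ≤ τ)
    (h : m.Sol T θ v w y) (h' : m.Sol τ θ' v' w' y') (hθ : θ' 0 = θ T) (hv : v' 0 = v T)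
    (hw : w' 0 = w T) : m.Sol (T + τ) (_root_.glue T θ θ') (_root_.glue T v v')
      (_root_.glue T w w') (_root_.glue T y y') := by
  constructor
  · refine (congrArg (HeatSol _ _ _ _) (funext fun t => ?_)).mp (h.heat.glue hT hτ h'.heat hθ)
    unfold _root_.glue
    split_ifs <;> rfl
  · refine (congrArg (WaveSol _ _ _ _) (funext fun t => ?_)).mp (h.wave.glue hT hτ h'.wave hv hw)
    unfold _root_.glue
    split_ifs <;> rfl

/-- Solutions on the intervals `[0,T]`, `T ∈ I`, are restrictions of a common curve. -/
theorem exists_common {θ₀ v₀ w₀ : SeqE} {I : Set ℝ} (hI : ∀ T ∈ I, 0 ≤ T ∧ Icc 0 T ⊆ I)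
    (hex : ∀ T ∈ I, ∃ θ v w y, m.Sol T θ v w y ∧ θ 0 = θ₀ ∧ v 0 = v₀ ∧ w 0 = w₀) :
    ∃ θ v w y, ∀ T ∈ I, m.Sol T θ v w y ∧ θ 0 = θ₀ ∧ v 0 = v₀ ∧ w 0 = w₀ := by
  classical
  choose! θ' v' w' y' hsol hθ hv hw using hex
  let θ : ℝ → SeqE := fun t => θ' t t
  let v : ℝ → SeqE := fun t => v' t t
  let w : ℝ → SeqE := fun t => w' t t
  have agree : ∀ T ∈ I, ∀ t ∈ Icc 0 T, θ t = θ' T t ∧ v t = v' T t ∧ w t = w' T t := by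
    intro T hT t ht
    have htI := (hI T hT).2 ht
    have := (hsol t htI).eqOn ht.1 ((hsol T hT).mono ht) (by rw [hθ t htI, hθ T hT])
      (by rw [hv t htI, hv T hT]) (by rw [hw t htI, hw T hT])
    exact ⟨this.1 ⟨ht.1, le_rfl⟩, this.2.1 ⟨ht.1, le_rfl⟩, this.2.2 ⟨ht.1, le_rfl⟩⟩
  refine ⟨θ, v, w, fun t => if h : ∃ z : SeqE, ∀ k, z k = m.om k * θ t k then h.choose else 0,
    fun T hT => ?_⟩
  have h0 := (hI T hT).1
  have hI0 : (0 : ℝ) ∈ Icc 0 T := ⟨le_rfl, h0⟩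
  have hs := hsol T hT
  have hy : (fun t => if h : ∃ z : SeqE, ∀ k, z k = m.om k * θ t k then h.choose else 0)
      =ᵐ[volume.restrict (Ioc 0 T)] y' T := by
    filter_upwards [hs.heat.yθ, ae_restrict_mem measurableSet_Ioc] with t ht hm
    have a1 := (agree T hT t (Ioc_subset_Icc_self hm)).1
    have hx : ∃ z : SeqE, ∀ k, z k = m.om k * θ t k := ⟨y' T t, fun k => by rw [a1]; exact ht k⟩
    rw [dif_pos hx]
    refine seq_ext fun k => ?_
    rw [hx.choose_spec k, a1, ht k]
  refine ⟨⟨hs.heat.congr h0 (fun t ht => (agree T hT t ht).1) hy ?_,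
    hs.wave.congr h0 (fun t ht => (agree T hT t ht).2.1) (fun t ht => (agree T hT t ht).2.2) ?_⟩,
    ((agree T hT 0 hI0).1).trans (hθ T hT), ((agree T hT 0 hI0).2.1).trans (hv T hT),
    ((agree T hT 0 hI0).2.2).trans (hw T hT)⟩
  · filter_upwards [hy, ae_restrict_mem measurableSet_Ioc] with t ht hm
    rw [ht, (agree T hT t (Ioc_subset_Icc_self hm)).2.1]
  · filter_upwards [hy] with t ht
    rw [ht]

/-- Solutions on all smaller intervals with a uniform bound extend to the closed interval. -/
theorem exists_sol_of_lt {θ₀ v₀ w₀ : SeqE} {S Q : ℝ} (hS : 0 < S)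
    (hex : ∀ T, 0 ≤ T → T < S → ∃ θ v w y, m.Sol T θ v w y ∧ θ 0 = θ₀ ∧ v 0 = v₀ ∧ w 0 = w₀)
    (hQ : ∀ T, 0 ≤ T → T < S → ∀ θ v w y, m.Sol T θ v w y → θ 0 = θ₀ → v 0 = v₀ → w 0 = w₀ →
      ∫ t in (0 : ℝ)..T, ‖y t‖ ^ 2 ≤ Q) :
    ∃ θ v w y, m.Sol S θ v w y ∧ θ 0 = θ₀ ∧ v 0 = v₀ ∧ w 0 = w₀ := by
  obtain ⟨θ, v, w, y, hall⟩ := exists_common (I := Ico 0 S)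
    (fun T hT => ⟨hT.1, fun t ht => ⟨ht.1, ht.2.trans_lt hT.2⟩⟩) (fun T hT => hex T hT.1 hT.2)
  have sol : ∀ T, 0 ≤ T → T < S → m.Sol T θ v w y := fun T h0 h1 => (hall T ⟨h0, h1⟩).1
  obtain ⟨-, hθ0, hv0, hw0⟩ := hall 0 ⟨le_rfl, hS⟩
  obtain ⟨r, -, hrS, hr⟩ := exists_seq_strictMono_tendsto' hS
  have hr0 : ∀ n, 0 ≤ r n := fun n => (hrS n).1.le
  have hr1 : ∀ n, r n < S := fun n => (hrS n).2
  have hU : Ioo 0 S ⊆ ⋃ n, Ioc 0 (r n) := by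
    intro t ht
    obtain ⟨n, hn⟩ := (hr.eventually (lt_mem_nhds ht.2)).exists
    exact mem_iUnion.2 ⟨n, ht.1, hn.le⟩
  have lift : ∀ p : ℝ → Prop, (∀ n, ∀ᵐ t ∂volume.restrict (Ioc 0 (r n)), p t) →
      ∀ᵐ t ∂volume.restrict (Ioc 0 S), p t := by
    intro p hp
    rw [← Measure.restrict_congr_set Ioo_ae_eq_Ioc]
    exact ae_restrict_of_ae_restrict_of_subset hU ((ae_restrict_iUnion_iff _ _).2 hp)
  have hyL : L2T S y := by
    have hm : AEStronglyMeasurable y (volume.restrict (Ioc 0 S)) := by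
      rw [← Measure.restrict_congr_set Ioo_ae_eq_Ioc]
      exact AEStronglyMeasurable.mono_measure (aestronglyMeasurable_iUnion_iff.2 fun n =>
        (sol _ (hr0 n) (hr1 n)).heat.y2.1) (Measure.restrict_mono_set _ hU)
    rw [L2T, memLp_two_iff_integrable_sq_norm hm]
    have hint : ∀ n, IntegrableOn (fun t => ‖y t‖ ^ 2) (Ioc 0 (r n)) := fun n =>
      (memLp_two_iff_integrable_sq_norm (sol _ (hr0 n) (hr1 n)).heat.y2.1).1
        (sol _ (hr0 n) (hr1 n)).heat.y2
    refine integrableOn_Ioc_of_intervalIntegral_norm_bounded_right (I := Q) hint hr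
      (Eventually.of_forall fun n => ?_)
    have := hQ _ (hr0 n) (hr1 n) θ v w y (sol _ (hr0 n) (hr1 n)) hθ0 hv0 hw0
    rw [intervalIntegral.integral_of_le (hr0 n)] at this
    simpa using this
  obtain ⟨V, Wc, hW, hV0, hW0⟩ := exists_waveSol (lam := m.lam) hS.le v₀ w₀ (m.L2T_h hyL)
  obtain ⟨Th, Y, hH, hT0⟩ := exists_heatSol (om := m.om) hS.le θ₀ (m.L2T_B hyL hW.contv)
  have hz : ∀ x y : SeqE, ‖x - y‖ ^ 2 ≤ 0 → x = y := fun x y h => by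
    rw [← sub_eq_zero, ← norm_eq_zero]
    exact pow_eq_zero_iff two_ne_zero |>.1 (le_antisymm h (sq_nonneg _))
  have eqv : ∀ T, 0 ≤ T → T < S → EqOn V v (Icc 0 T) := by
    intro T h0 hTS t ht
    have := (hW.mono ⟨h0, hTS.le⟩).energy_sub (sol T h0 hTS).wave (hV0.trans hv0.symm)
      (hW0.trans hw0.symm) ht
    simp only [sub_self, inner_zero_left, intervalIntegral.integral_zero] at this
    exact hz _ _ (by linarith [sq_nonneg ‖Wc t - w t‖])
  have eqθ : ∀ T, 0 ≤ T → T < S → EqOn Th θ (Icc 0 T) := by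
    intro T h0 hTS t ht
    have hc : HeatSol m.om T Th Y (fun t => m.B (y t) (v t)) := by
      refine (hH.mono ⟨h0, hTS.le⟩).congr h0 (fun _ _ => rfl) (ae_eq_refl _) ?_
      filter_upwards [ae_restrict_mem measurableSet_Ioc] with t hm
      rw [eqv T h0 hTS (Ioc_subset_Icc_self hm)]
    have := hc.energy_sub (sol T h0 hTS).heat (hT0.trans hθ0.symm) ht
    simp only [sub_self, inner_zero_left, intervalIntegral.integral_zero] at this
    have h2 : 0 ≤ ∫ s in (0 : ℝ)..t, ‖Y s - y s‖ ^ 2 :=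
      intervalIntegral.integral_nonneg ht.1 fun _ _ => by positivity
    exact hz _ _ (by linarith)
  have eqy : Y =ᵐ[volume.restrict (Ioc 0 S)] y := by
    refine lift _ fun n => ?_
    filter_upwards [(hH.mono ⟨hr0 n, (hr1 n).le⟩).yθ, (sol _ (hr0 n) (hr1 n)).heat.yθ,
      ae_restrict_mem measurableSet_Ioc] with t h1 h2 hm
    refine seq_ext fun k => ?_
    rw [h1 k, h2 k, eqθ _ (hr0 n) (hr1 n) (Ioc_subset_Icc_self hm)]
  refine ⟨Th, V, Wc, y, ⟨hH.congr hS.le (fun _ _ => rfl) eqy.symm (ae_eq_refl _), hW⟩, hT0, hV0, hW0⟩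

theorem exists_sol_Icc (θ₀ v₀ w₀ : SeqE)
    (hQ : ∀ S, ∃ Q, ∀ T, 0 ≤ T → T ≤ S → ∀ θ v w y, m.Sol T θ v w y → θ 0 = θ₀ → v 0 = v₀ →
      w 0 = w₀ → ∫ t in (0 : ℝ)..T, ‖y t‖ ^ 2 ≤ Q) (T : ℝ) (hT : 0 ≤ T) :
    ∃ θ v w y, m.Sol T θ v w y ∧ θ 0 = θ₀ ∧ v 0 = v₀ ∧ w 0 = w₀ := by
  by_contra hne
  let A : Set ℝ := {T | 0 ≤ T ∧ ∃ θ v w y, m.Sol T θ v w y ∧ θ 0 = θ₀ ∧ v 0 = v₀ ∧ w 0 = w₀}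
  have mono : ∀ T ∈ A, ∀ t, 0 ≤ t → t ≤ T → t ∈ A := by
    rintro T ⟨-, θ, v, w, y, h, h1⟩ t h0 ht
    exact ⟨h0, θ, v, w, y, h.mono ⟨h0, ht⟩, h1⟩
  have hbdd : ∀ t ∈ A, t < T := fun t ht => by
    by_contra! h
    exact hne (mono t ht T hT h).2
  obtain ⟨τ, hτ, θ, v, w, y, hs, h1⟩ := m.exists_local θ₀ v₀ w₀
  have hτA : τ ∈ A := ⟨hτ.le, θ, v, w, y, hs, h1⟩
  have hb : BddAbove A := ⟨T, fun t ht => (hbdd t ht).le⟩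
  have hS0 : 0 < sSup A := hτ.trans_le (le_csSup hb hτA)
  obtain ⟨Q, hQ⟩ := hQ (sSup A)
  obtain ⟨θ, v, w, y, hs, hθ, hv, hw⟩ := exists_sol_of_lt (m := m) (Q := Q) hS0 (fun T h0 hTS => by
    obtain ⟨t, ht, htT⟩ := exists_lt_of_lt_csSup ⟨τ, hτA⟩ hTS
    exact (mono t ht T h0 htT.le).2) (fun T h0 hTS => hQ T h0 hTS.le)
  obtain ⟨σ, hσ, θ', v', w', y', hs', hθ', hv', hw'⟩ :=
    m.exists_local (θ (sSup A)) (v (sSup A)) (w (sSup A))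
  have : sSup A + σ ∈ A := ⟨by positivity, _, _, _, _, hs.glue hS0.le hσ.le hs' hθ' hv' hw',
    (glue_of_le hS0.le).trans hθ, (glue_of_le hS0.le).trans hv, (glue_of_le hS0.le).trans hw⟩
  linarith [le_csSup hb this]

/-- Global solvability under an a priori bound on the dissipation. -/
theorem exists_sol (θ₀ v₀ w₀ : SeqE)
    (hQ : ∀ S, ∃ Q, ∀ T, 0 ≤ T → T ≤ S → ∀ θ v w y, m.Sol T θ v w y → θ 0 = θ₀ → v 0 = v₀ →
      w 0 = w₀ → ∫ t in (0 : ℝ)..T, ‖y t‖ ^ 2 ≤ Q) :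
    ∃ θ v w y, ∀ T, 0 ≤ T → m.Sol T θ v w y ∧ θ 0 = θ₀ ∧ v 0 = v₀ ∧ w 0 = w₀ :=
  exists_common (I := Ici 0) (fun _ hT => ⟨hT, fun _ ht => ht.1⟩)
    (fun T hT => exists_sol_Icc θ₀ v₀ w₀ hQ T hT)

end Model

/-- The standard unit vectors. -/
def unitE (k : ℕ) : SeqE := lp.single 2 k (1 : ℝ)

theorem inner_unitE (x : SeqE) (k : ℕ) : ⟪x, unitE k⟫_ℝ = x k := by
  rw [real_inner_comm, unitE, lp.inner_single_left]
  simp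

theorem unitE_apply (k j : ℕ) : unitE k j = if j = k then 1 else 0 := by
  simp [unitE, Pi.single_apply]

theorem sum_unitE_apply (c : ℕ → ℝ) (n j : ℕ) :
    (∑ k ∈ Finset.range n, c k • unitE k : SeqE) j = if j < n then c j else 0 := by
  have h : ∀ s : Finset ℕ, coordL j (∑ k ∈ s, c k • unitE k) = ∑ k ∈ s, c k * unitE k j := by
    intro s
    rw [map_sum]
    exact Finset.sum_congr rfl fun k _ => by rw [map_smul]; rfl
  have h2 := h (Finset.range n)
  rw [coordL_apply] at h2
  rw [h2]
  simp [unitE_apply]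

theorem IsPrim.sum_unitE {T : ℝ} {x r : ℕ → ℝ → ℝ} (hT : 0 ≤ T) (h : ∀ k, IsPrim T (x k) (r k)) (n : ℕ) :
    IsPrim T (fun t => ∑ k ∈ Finset.range n, x k t • unitE k)
      (fun t => ∑ k ∈ Finset.range n, r k t • unitE k) := by
  induction n with
  | zero =>
    simpa using IsPrim.of_hasDerivAt hT (fun t _ => hasDerivAt_const t (0 : SeqE)) continuousOn_const
  | succ n ih =>
    simp only [Finset.sum_range_succ]
    exact ih.add ((h n).clm (ContinuousLinearMap.toSpanSingleton ℝ (unitE n)))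

theorem young_bound_dissipation {K N μ a d s : ℝ} (hN : 0 ≤ N) (hμ : 0 ≤ μ)
    (hs : 0 ≤ s) (h1 : s ^ 2 ≤ K * a * d) (h2 : a ^ 2 ≤ μ * s) :
    a ^ 2 + N * s ^ 2 ≤
      1 / 4 * d ^ 2 + ((N + μ) * (8 * (K ^ 2 * μ + 1) * (N + μ)) ^ 2 + μ) := by
  have h3 : s ^ 3 ≤ K ^ 2 * μ * d ^ 2 := by
    rcases hs.eq_or_lt with rfl | hs'
    · rw [zero_pow three_ne_zero]; positivity
    · refine le_of_mul_le_mul_left ?_ hs'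
      calc s * s ^ 3 = (s ^ 2) ^ 2 := by ring
        _ ≤ (K * a * d) ^ 2 := pow_le_pow_left₀ (sq_nonneg _) h1 2
        _ = (K * d) ^ 2 * a ^ 2 := by ring
        _ ≤ (K * d) ^ 2 * (μ * s) := mul_le_mul_of_nonneg_left h2 (sq_nonneg _)
        _ = _ := by ring
  have h4 : a ^ 2 + N * s ^ 2 ≤ (N + μ) * s ^ 2 + μ := by
    nlinarith [mul_nonneg hμ (sq_nonneg (s - 1 / 2)), mul_nonneg hμ hs]
  set Q := K ^ 2 * μ + 1 with hQ
  have hQ1 : 1 ≤ Q := by rw [hQ]; linarith [mul_nonneg (sq_nonneg K) hμ]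
  have h5 : s ^ 3 ≤ Q * d ^ 2 := by rw [hQ]; nlinarith [sq_nonneg d]
  set L := N + μ
  have hL : 0 ≤ L := add_nonneg hN hμ
  rcases le_total (8 * Q * L) s with h | h
  · have h6 : Q * (8 * (L * s ^ 2)) ≤ Q * d ^ 2 := by
      refine le_trans ?_ h5
      calc Q * (8 * (L * s ^ 2)) = 8 * Q * L * s ^ 2 := by ring
        _ ≤ s * s ^ 2 := mul_le_mul_of_nonneg_right h (sq_nonneg s)
        _ = s ^ 3 := by ring
    have h7 := le_of_mul_le_mul_left h6 (by linarith)
    have h8 : 0 ≤ L * (8 * Q * L) ^ 2 := by positivity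
    nlinarith [sq_nonneg d]
  · have h6 : L * s ^ 2 ≤ L * (8 * Q * L) ^ 2 :=
      mul_le_mul_of_nonneg_left (pow_le_pow_left₀ hs h 2) hL
    nlinarith [sq_nonneg d]

namespace Model

variable {H C : Type*} [NormedAddCommGroup H] [InnerProductSpace ℝ H] [CompleteSpace H]
    [NormedAddCommGroup C] [NormedSpace ℝ C]

theorem inner_B_le (m : Model H C) (y v : SeqE) {R μ : ℝ} (hv : ‖v‖ ≤ R) (hμ : 0 ≤ μ)
    (hm : ‖m.J y‖ ^ 2 ≤ μ * ‖m.S y‖) : ⟪m.B y v, y⟫_ℝ ≤ 1 / 2 * ‖y‖ ^ 2 +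
      ((4 * m.M ^ 2 * R ^ 2 + μ) * (8 * (m.K ^ 2 * μ + 1) * (4 * m.M ^ 2 * R ^ 2 + μ)) ^ 2 + μ) := by
  have hM := m.M_nonneg
  have hR := (norm_nonneg _).trans hv
  have h1 := young_bound_dissipation (N := 4 * m.M ^ 2 * R ^ 2) (by positivity) hμ
    (norm_nonneg _) (m.agmon y) hm
  rw [inner_B, real_inner_self_eq_norm_sq]
  have h2 : ⟪m.A y, m.mul (m.S y) (m.V v)⟫_ℝ ≤ m.M * ‖y‖ * (‖m.S y‖ * R) :=
    (real_inner_le_norm _ _).trans (mul_le_mul (m.norm_A_le y) ((m.norm_mulS_le y v).trans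
      (mul_le_mul_of_nonneg_left hv (norm_nonneg _))) (norm_nonneg _) (by positivity))
  have h3 : ⟪m.mul (m.F (m.S y)) (m.V v), m.D y⟫_ℝ ≤ m.M * ‖m.S y‖ * R * ‖y‖ :=
    (real_inner_le_norm _ _).trans (mul_le_mul ((m.norm_mulF_le y v).trans
      (mul_le_mul_of_nonneg_left hv (by positivity))) (m.norm_D_le y) (norm_nonneg _)
      (by positivity))
  nlinarith [sq_nonneg (‖y‖ - 4 * m.M * R * ‖m.S y‖)]

/-- Data expressing the order structure of the temperature space: `g` is the negative part in
`L²` coordinates and `χ` the negative part in `H¹` coordinates. -/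
structure Positivity (m : Model H C) where
  g : SeqE → SeqE
  χ : SeqE → SeqE
  s₀ : ℝ
  s₀_pos : 0 < s₀
  om_zero : m.om 0 = 1
  hasFDerivAt : ∀ θ, HasFDerivAt (fun θ => 1 / 2 * ‖g θ‖ ^ 2) (innerSL ℝ (g θ)) θ
  cont_g : Continuous g
  inner_g : ∀ θ, ⟪θ, g θ⟫_ℝ = ‖g θ‖ ^ 2
  χ_apply : ∀ y k, χ y k = m.om k * g (m.W y) k
  inner_χ : ∀ y, ⟪y, χ y⟫_ℝ = ‖χ y‖ ^ 2
  A_χ : ∀ y v, |⟪m.A y, m.mul (m.S (χ y)) (m.V v)⟫_ℝ| ≤ m.M * ‖m.S (χ y)‖ * ‖χ y‖ * ‖v‖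
  F_χ : ∀ y v, |⟪m.mul (m.F (m.S y)) (m.V v), m.D (χ y)⟫_ℝ| ≤ m.M * ‖m.S (χ y)‖ * ‖χ y‖ * ‖v‖
  D_zero : m.D (unitE 0) = 0
  mul_S_zero : ∀ p, m.mul (m.S (unitE 0)) p = s₀ • p
  nonneg_of_g : ∀ θ, g θ = 0 → 0 ≤ θ 0
  interp : ∀ y, g (m.W y) = 0 → ‖m.J y‖ ^ 2 ≤ y 0 / s₀ * ‖m.S y‖

namespace Positivity

variable {m : Model H C} (P : m.Positivity)

theorem norm_g_le (θ : SeqE) : ‖P.g θ‖ ≤ ‖θ‖ := by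
  have h1 := real_inner_le_norm θ (P.g θ)
  rw [P.inner_g] at h1
  by_contra! h
  nlinarith [norm_nonneg θ]

theorem norm_χ_le (y : SeqE) : ‖P.χ y‖ ≤ ‖y‖ := by
  have h1 := real_inner_le_norm y (P.χ y)
  rw [P.inner_χ] at h1
  by_contra! h
  nlinarith [norm_nonneg y]

theorem W_χ (y : SeqE) : m.W (P.χ y) = P.g (m.W y) := m.W_of_coord (P.χ_apply y)

theorem inner_B_χ_le (y v : SeqE) {R : ℝ} (hv : ‖v‖ ≤ R) :
    ⟪m.B y v - y, P.χ y⟫_ℝ ≤ (1 + 4 * m.M ^ 4 * R ^ 4 * m.K ^ 2) * ‖P.g (m.W y)‖ ^ 2 := by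
  have hM := m.M_nonneg
  rw [inner_sub_left, P.inner_χ, inner_B, m.inner_J]
  have e : ⟪m.W y, m.W (P.χ y)⟫_ℝ = ‖P.g (m.W y)‖ ^ 2 := by rw [W_χ, P.inner_g]
  rw [show ⟪diagL (fun k => 1 / m.om k) y, diagL (fun k => 1 / m.om k) (P.χ y)⟫_ℝ = _ from e]
  have h1 := (le_abs_self _).trans (P.A_χ y v)
  have h2 := (le_abs_self _).trans (P.F_χ y v)
  have h3 := m.agmon (P.χ y)
  rw [← m.norm_W, W_χ] at h3
  set s := ‖m.S (P.χ y)‖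
  set x := ‖P.χ y‖
  set n := ‖P.g (m.W y)‖
  have hs : 0 ≤ s := norm_nonneg _
  have hx : 0 ≤ x := norm_nonneg _
  have h4 : m.M * s * x * ‖v‖ ≤ m.M * s * x * R := mul_le_mul_of_nonneg_left hv (by positivity)
  have h5 : 2 * (m.M * s * x * R) ≤ 1 / 2 * x ^ 2 + 2 * m.M ^ 2 * R ^ 2 * s ^ 2 := by
    nlinarith [sq_nonneg (x - 2 * m.M * R * s)]
  have h6 : 2 * m.M ^ 2 * R ^ 2 * s ^ 2 ≤ 2 * m.M ^ 2 * R ^ 2 * (m.K * n * x) :=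
    mul_le_mul_of_nonneg_left h3 (by positivity)
  have h7 := sq_nonneg (x - 2 * m.M ^ 2 * R ^ 2 * m.K * n)
  have h8 := sq_nonneg (m.M ^ 2 * R ^ 2 * m.K * n)
  linarith

theorem chain {T : ℝ} {θ y ρ : ℝ → SeqE} (hT : 0 ≤ T) (h : HeatSol m.om T θ y ρ) {t : ℝ}
    (ht : t ∈ Icc 0 T) : 1 / 2 * ‖P.g (θ t)‖ ^ 2 =
      1 / 2 * ‖P.g (θ 0)‖ ^ 2 + ∫ s in (0 : ℝ)..t, ⟪ρ s - y s, P.χ (y s)⟫_ℝ := by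
  have hX : ∀ n, IsPrim T (fun t => truncL n (θ t))
      (fun t => ∑ k ∈ Finset.range n, (m.om k * (ρ t k - y t k)) • unitE k) := by
    intro n
    refine (IsPrim.sum_unitE hT h.mode n).congr_eqOn hT fun t _ => ?_
    refine seq_ext fun j => ?_
    rw [truncL_apply, sum_unitE_apply]
  have hG : ∀ n, IsPrim T (fun t => 1 / 2 * ‖P.g (truncL n (θ t))‖ ^ 2)
      (fun t => ⟪truncL n (P.χ (truncL n (y t))), ρ t - y t⟫_ℝ) := by
    intro n
    refine ((hX n).comp hT P.hasFDerivAt (fun R => ⟨R, fun z hz => ?_⟩)).congr_ae hT ?_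
    · rw [innerSL_apply_norm]
      exact (P.norm_g_le z).trans hz
    · filter_upwards [h.yθ] with s hs
      have e : m.W (truncL n (y s)) = truncL n (θ s) := m.W_of_coord fun k => by
        rw [truncL_apply, truncL_apply, hs k]; split_ifs <;> simp
      rw [innerSL_apply_apply, inner_sum]
      simp only [inner_smul_right, inner_unitE]
      rw [seq_inner, tsum_eq_sum (s := Finset.range n)]
      · refine Finset.sum_congr rfl fun k hk => ?_
        rw [truncL_apply, if_pos (Finset.mem_range.1 hk), P.χ_apply, e, seq_sub]
        ring
      · intro k hk
        rw [truncL_apply, if_neg (by simpa using hk), zero_mul]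
  have hlim : ∀ s, Tendsto (fun n => 1 / 2 * ‖P.g (truncL n (θ s))‖ ^ 2) atTop
      (nhds (1 / 2 * ‖P.g (θ s)‖ ^ 2)) := fun s =>
    ((((P.cont_g.tendsto _).comp (tendsto_truncL (θ s))).norm).pow 2).const_mul _
  have hint : Tendsto (fun n => ∫ s in (0 : ℝ)..t, ⟪truncL n (P.χ (truncL n (y s))), ρ s - y s⟫_ℝ)
      atTop (nhds (∫ s in (0 : ℝ)..t, ⟪P.χ (y s), ρ s - y s⟫_ℝ)) := by
    have hi1 := L2T.sq ht.1 (h.y2.mono ht.2)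
    have hi2 := L2T.sq ht.1 (L2T.mono (h.ρ2.sub h.y2) ht.2)
    refine intervalIntegral.tendsto_integral_filter_of_dominated_convergence
      (fun s => ‖y s‖ ^ 2 + ‖ρ s - y s‖ ^ 2) (Eventually.of_forall fun n => ?_)
      (Eventually.of_forall fun n => Eventually.of_forall fun s _ => ?_) (hi1.add hi2)
      (Eventually.of_forall fun s _ => ?_)
    · exact ((hG n).1.sub_right ht).def'.aestronglyMeasurable
    · refine (norm_inner_le_norm _ _).trans ?_
      have h1 := ((norm_truncL_le n _).trans (P.norm_χ_le (truncL n (y s)))).trans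
        (norm_truncL_le n (y s))
      have h2 := mul_le_mul_of_nonneg_right h1 (norm_nonneg (ρ s - y s))
      nlinarith [sq_nonneg (‖y s‖ - ‖ρ s - y s‖), sq_nonneg ‖y s‖, sq_nonneg ‖ρ s - y s‖]
    · refine tendsto_inner_of_coord (R := ‖y s‖) (fun n => ((norm_truncL_le n _).trans
        (P.norm_χ_le (truncL n (y s)))).trans (norm_truncL_le n (y s))) (fun k => ?_) _
      have h1 : Tendsto (fun n => m.om k * P.g (m.W (truncL n (y s))) k) atTop
          (nhds (m.om k * P.g (m.W (y s)) k)) :=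
        ((((coordL k).continuous.comp (P.cont_g.comp m.W.continuous)).tendsto _).comp
          (tendsto_truncL (y s))).const_mul _
      rw [← P.χ_apply] at h1
      refine h1.congr' ?_
      filter_upwards [eventually_gt_atTop k] with n hn
      rw [truncL_apply, if_pos hn, P.χ_apply]
  have heq : ∀ n, 1 / 2 * ‖P.g (truncL n (θ t))‖ ^ 2 = 1 / 2 * ‖P.g (truncL n (θ 0))‖ ^ 2 +
      ∫ s in (0 : ℝ)..t, ⟪truncL n (P.χ (truncL n (y s))), ρ s - y s⟫_ℝ := fun n => (hG n).2 t ht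
  have := tendsto_nhds_unique (hlim t) (((hlim 0).add hint).congr fun n => (heq n).symm)
  simpa only [real_inner_comm] using this

theorem g_eq_zero {T : ℝ} {θ v w y : ℝ → SeqE} (hT : 0 ≤ T) (h : m.Sol T θ v w y)
    (h0 : P.g (θ 0) = 0) {t : ℝ} (ht : t ∈ Icc 0 T) : P.g (θ t) = 0 := by
  obtain ⟨R, hR⟩ := isCompact_Icc.exists_bound_of_continuousOn h.wave.contv
  set c : ℝ := 1 + 4 * m.M ^ 4 * R ^ 4 * m.K ^ 2 with hc
  have hc0 : 0 ≤ c := by positivity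
  have hEc : ContinuousOn (fun t => 1 / 2 * ‖P.g (θ t)‖ ^ 2) (Icc 0 T) :=
    ((P.cont_g.comp_continuousOn h.heat.cont).norm.pow 2).const_mul _
  have key : ∀ t ∈ Icc 0 T, 1 / 2 * ‖P.g (θ t)‖ ^ 2 ≤
      0 + ∫ s in (0 : ℝ)..t, 2 * c * (1 / 2 * ‖P.g (θ s)‖ ^ 2) := by
    intro t ht
    have e := P.chain hT h.heat ht
    rw [h0, norm_zero] at e
    have hle : (∫ s in (0 : ℝ)..t, ⟪m.B (y s) (v s) - y s, P.χ (y s)⟫_ℝ) ≤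
        ∫ s in (0 : ℝ)..t, 2 * c * (1 / 2 * ‖P.g (θ s)‖ ^ 2) := by
      by_cases hi : IntervalIntegrable (fun s => ⟪m.B (y s) (v s) - y s, P.χ (y s)⟫_ℝ) volume 0 t
      · refine intervalIntegral.integral_mono_ae_restrict ht.1 hi
          ((hEc.mono (Icc_subset_Icc_right ht.2)).const_mul _ |>.intervalIntegrable_of_Icc ht.1) ?_
        rw [Measure.restrict_congr_set Ioc_ae_eq_Icc.symm]
        filter_upwards [(h.heat.mono ht).yθ, ae_restrict_mem measurableSet_Ioc] with s hs hm
        refine (P.inner_B_χ_le _ _ (hR s ⟨hm.1.le, hm.2.trans ht.2⟩)).trans_eq ?_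
        rw [m.W_of_coord hs]
        ring
      · rw [intervalIntegral.integral_undef hi]
        exact intervalIntegral.integral_nonneg ht.1 fun s _ => by positivity
    linarith
  have := le_mul_exp_of_le_integral (g := fun _ => 2 * c) hT hEc intervalIntegrable_const
    (fun _ => by positivity) key ht
  rw [zero_mul] at this
  rw [← norm_eq_zero]
  exact pow_eq_zero_iff two_ne_zero |>.1 (le_antisymm (by linarith) (sq_nonneg _))

/-- Conservation of the total energy. -/
theorem energy_conservation {T : ℝ} {θ v w y : ℝ → SeqE} (h : m.Sol T θ v w y)
    {t : ℝ} (ht : t ∈ Icc 0 T) :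
    1 / 2 * (‖v t‖ ^ 2 + ‖w t‖ ^ 2) + θ t 0 / P.s₀ =
      1 / 2 * (‖v 0‖ ^ 2 + ‖w 0‖ ^ 2) + θ 0 0 / P.s₀ := by
  have hs := P.s₀_pos.ne'
  have e1 := h.wave.energy ht
  have e2 := (h.heat.mode 0).2 t ht
  have e3 : ∀ s, m.om 0 * (m.B (y s) (v s) 0 - y s 0) = -P.s₀ * ⟪v s, m.h (y s)⟫_ℝ := by
    intro s
    have k1 : ⟪m.J (y s), m.J (unitE 0)⟫_ℝ = y s 0 := by
      rw [← inner_W, inner_unitE, W_apply, W_apply, P.om_zero]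
      ring
    have k2 := m.inner_h (y s) (v s)
    rw [real_inner_comm] at k2
    rw [k2, ← inner_unitE, inner_B, P.D_zero, inner_zero_right, P.mul_S_zero, inner_smul_right,
      k1, P.om_zero]
    ring
  simp only [e3] at e2
  rw [intervalIntegral.integral_const_mul] at e2
  rw [e1, e2]
  field_simp
  ring

theorem norm_v_le {T : ℝ} {θ v w y : ℝ → SeqE} (hT : 0 ≤ T) (h : m.Sol T θ v w y)
    (h0 : P.g (θ 0) = 0) {t : ℝ} (ht : t ∈ Icc 0 T) :
    ‖v t‖ ^ 2 ≤ 2 * (1 / 2 * (‖v 0‖ ^ 2 + ‖w 0‖ ^ 2) + θ 0 0 / P.s₀) := by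
  have h1 := P.energy_conservation h ht
  have h2 := div_nonneg (P.nonneg_of_g _ (P.g_eq_zero hT h h0 ht)) P.s₀_pos.le
  nlinarith [sq_nonneg ‖w t‖]

theorem mass_le {T : ℝ} {θ v w y : ℝ → SeqE} (h : m.Sol T θ v w y) {t : ℝ} (ht : t ∈ Icc 0 T) :
    θ t 0 / P.s₀ ≤ 1 / 2 * (‖v 0‖ ^ 2 + ‖w 0‖ ^ 2) + θ 0 0 / P.s₀ := by
  have h1 := P.energy_conservation h ht
  nlinarith [sq_nonneg ‖w t‖, sq_nonneg ‖v t‖]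

theorem exists_dissipation_bound (θ₀ v₀ w₀ : SeqE) (h0 : P.g θ₀ = 0) (U : ℝ) :
    ∃ Q, ∀ T, 0 ≤ T → T ≤ U → ∀ θ v w y : ℝ → SeqE, m.Sol T θ v w y → θ 0 = θ₀ → v 0 = v₀ →
      w 0 = w₀ → ∫ t in (0 : ℝ)..T, ‖y t‖ ^ 2 ≤ Q := by
  obtain ⟨μ, hμ⟩ : ∃ μ, μ = 1 / 2 * (‖v₀‖ ^ 2 + ‖w₀‖ ^ 2) + θ₀ 0 / P.s₀ := ⟨_, rfl⟩
  have hμ0 : 0 ≤ μ := by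
    rw [hμ]
    exact add_nonneg (by positivity) (div_nonneg (P.nonneg_of_g _ h0) P.s₀_pos.le)
  obtain ⟨c, hc0, hc⟩ : ∃ c, 0 ≤ c ∧ ∀ y v : SeqE, ‖v‖ ≤ Real.sqrt (2 * μ) →
      ‖m.J y‖ ^ 2 ≤ μ * ‖m.S y‖ → ⟪m.B y v, y⟫_ℝ ≤ 1 / 2 * ‖y‖ ^ 2 + c :=
    ⟨_, by positivity, fun y v hv hm => m.inner_B_le y v hv hμ0 hm⟩
  refine ⟨‖θ₀‖ ^ 2 + 2 * (U * c), fun T hT hTU θ v w y h hθ hv hw => ?_⟩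
  subst hθ hv hw
  have e := h.heat.energy (right_mem_Icc.2 hT)
  have hy := L2T.sq hT h.heat.y2
  have hi : IntervalIntegrable (fun s => ⟪y s, m.B (y s) (v s) - y s⟫_ℝ) volume 0 T :=
    L2T.inner hT h.heat.y2 (h.heat.ρ2.sub h.heat.y2)
  have hle : (∫ s in (0 : ℝ)..T, ⟪y s, m.B (y s) (v s) - y s⟫_ℝ) ≤
      ∫ s in (0 : ℝ)..T, (c - 1 / 2 * ‖y s‖ ^ 2) := by
    refine intervalIntegral.integral_mono_ae_restrict hT hi
      (intervalIntegrable_const.sub (hy.const_mul _)) ?_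
    rw [Measure.restrict_congr_set Ioc_ae_eq_Icc.symm]
    filter_upwards [h.heat.yθ, ae_restrict_mem measurableSet_Ioc] with s hs hm
    have hm' : s ∈ Icc 0 T := ⟨hm.1.le, hm.2⟩
    have hW : m.W (y s) = θ s := m.W_of_coord hs
    have e0 : y s 0 = θ s 0 := by rw [hs 0, P.om_zero, one_mul]
    have h1 := P.interp (y s) (by rw [hW]; exact P.g_eq_zero hT h h0 hm')
    have h2 := hc (y s) (v s) (Real.le_sqrt_of_sq_le (hμ ▸ P.norm_v_le hT h h0 hm'))
      (h1.trans (mul_le_mul_of_nonneg_right (by rw [e0]; exact hμ ▸ P.mass_le h hm')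
        (norm_nonneg _)))
    rw [inner_sub_right, real_inner_self_eq_norm_sq, real_inner_comm]
    linarith
  rw [intervalIntegral.integral_sub intervalIntegrable_const (hy.const_mul _),
    intervalIntegral.integral_const_mul, intervalIntegral.integral_const, sub_zero,
    smul_eq_mul] at hle
  have := mul_le_mul_of_nonneg_right hTU hc0
  nlinarith [sq_nonneg ‖θ T‖]

/-- Global existence for the abstract system with nonnegative initial temperature. -/
theorem exists_sol (θ₀ v₀ w₀ : SeqE) (h0 : P.g θ₀ = 0) : ∃ θ v w y : ℝ → SeqE, ∀ T, 0 ≤ T →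
    m.Sol T θ v w y ∧ θ 0 = θ₀ ∧ v 0 = v₀ ∧ w 0 = w₀ ∧ P.g (θ T) = 0 := by
  obtain ⟨θ, v, w, y, h⟩ := m.exists_sol θ₀ v₀ w₀ (P.exists_dissipation_bound θ₀ v₀ w₀ h0)
  refine ⟨θ, v, w, y, fun T hT => ⟨(h T hT).1, (h T hT).2.1, (h T hT).2.2.1, (h T hT).2.2.2, ?_⟩⟩
  refine P.g_eq_zero hT (h T hT).1 ?_ (right_mem_Icc.2 hT)
  rw [(h T hT).2.1, h0]

end Positivity
end Model

/-- The Hilbert space `L²(a,b)`. -/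
abbrev L2Om (a b : ℝ) := Lp ℝ 2 (volume.restrict (Ioo a b))

namespace L2Om

variable {a b : ℝ}

/-- The class in `L²(a,b)` of a bounded continuous function. -/
def ofBCF (a b : ℝ) : (ℝ →ᵇ ℝ) →L[ℝ] L2Om a b := BoundedContinuousFunction.toLp 2 _ ℝ

theorem coeFn_ofBCF (c : ℝ →ᵇ ℝ) : ofBCF a b c =ᵐ[volume.restrict (Ioo a b)] c :=
  BoundedContinuousFunction.coeFn_toLp _ _ _ c

theorem inner_eq (f g : L2Om a b) : ⟪f, g⟫_ℝ = ∫ x in Ioo a b, f x * g x := by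
  rw [L2.inner_def]
  exact integral_congr_ae (Eventually.of_forall fun x => by simp [mul_comm])

theorem inner_eq_of_ae {f g : L2Om a b} {F G : ℝ → ℝ} (hf : f =ᵐ[volume.restrict (Ioo a b)] F)
    (hg : g =ᵐ[volume.restrict (Ioo a b)] G) : ⟪f, g⟫_ℝ = ∫ x in Ioo a b, F x * G x := by
  rw [inner_eq]
  refine integral_congr_ae ?_
  filter_upwards [hf, hg] with x h1 h2
  rw [h1, h2]

theorem inner_ofBCF (f : L2Om a b) (c : ℝ →ᵇ ℝ) :
    ⟪f, ofBCF a b c⟫_ℝ = ∫ x in Ioo a b, f x * c x :=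
  inner_eq_of_ae (ae_eq_refl _) (coeFn_ofBCF c)

theorem integrable_mul (f g : L2Om a b) : IntegrableOn (fun x => f x * g x) (Ioo a b) := by
  have := L2.integrable_inner (𝕜 := ℝ) f g
  refine this.congr (Eventually.of_forall fun x => by simp [mul_comm])

theorem integrable_mul_bcf (f : L2Om a b) (c : ℝ →ᵇ ℝ) :
    IntegrableOn (fun x => f x * c x) (Ioo a b) := by
  refine (integrable_mul f (ofBCF a b c)).congr ?_
  filter_upwards [coeFn_ofBCF (a := a) (b := b) c] with x hx
  rw [hx]

theorem eq_zero_of_integral_bcf (f : L2Om a b)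
    (h : ∀ c : ℝ →ᵇ ℝ, ∫ x in Ioo a b, f x * c x = 0) : f = 0 := by
  have h1 : ∀ g : L2Om a b, ⟪f, g⟫_ℝ = 0 := by
    have hd : DenseRange (ofBCF a b) :=
      BoundedContinuousFunction.toLp_denseRange ℝ _ ℝ ENNReal.ofNat_ne_top
    intro g
    refine hd.induction_on g (isClosed_eq (by fun_prop) continuous_const) fun c => ?_
    rw [inner_ofBCF, h]
  exact inner_self_eq_zero.1 (h1 f)

theorem norm_toLp_top_le (c : ℝ →ᵇ ℝ) :
    ‖BoundedContinuousFunction.toLp ⊤ (volume.restrict (Ioo a b)) ℝ c‖ ≤ ‖c‖ := by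
  refine ((BoundedContinuousFunction.toLp ⊤ (volume.restrict (Ioo a b)) ℝ).le_opNorm c).trans ?_
  have := BoundedContinuousFunction.toLp_norm_le (E := ℝ) (p := ⊤) (𝕜 := ℝ)
    (volume.restrict (Ioo a b))
  simp only [ENNReal.toReal_top, inv_zero] at this
  exact (mul_le_mul_of_nonneg_right this (norm_nonneg _)).trans_eq (by simp)

/-- Multiplication of square integrable functions by bounded continuous functions. -/
def mul (a b : ℝ) : (ℝ →ᵇ ℝ) →L[ℝ] L2Om a b →L[ℝ] L2Om a b :=
  ((ContinuousLinearMap.mul ℝ ℝ).holderL (volume.restrict (Ioo a b)) ⊤ 2 2).comp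
    (BoundedContinuousFunction.toLp ⊤ (volume.restrict (Ioo a b)) ℝ)

theorem coeFn_mul (c : ℝ →ᵇ ℝ) (f : L2Om a b) :
    mul a b c f =ᵐ[volume.restrict (Ioo a b)] fun x => c x * f x := by
  have h1 := (ContinuousLinearMap.mul ℝ ℝ).coeFn_holder (r := 2)
    (BoundedContinuousFunction.toLp ⊤ (volume.restrict (Ioo a b)) ℝ c) f
  have h2 := BoundedContinuousFunction.coeFn_toLp ⊤ (volume.restrict (Ioo a b)) ℝ c
  filter_upwards [h1, h2] with x h3 h4
  rw [h4] at h3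
  exact h3

theorem norm_mul_le (c : ℝ →ᵇ ℝ) (f : L2Om a b) : ‖mul a b c f‖ ≤ ‖c‖ * ‖f‖ := by
  have h1 := (ContinuousLinearMap.mul ℝ ℝ).norm_holder_apply_apply_le (r := 2)
    (BoundedContinuousFunction.toLp ⊤ (volume.restrict (Ioo a b)) ℝ c) f
  have h2 : ‖ContinuousLinearMap.mul ℝ ℝ‖ ≤ 1 := ContinuousLinearMap.opNorm_mul_le ℝ ℝ
  have h3 := norm_toLp_top_le (a := a) (b := b) c
  refine h1.trans (mul_le_mul_of_nonneg_right ?_ (norm_nonneg _))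
  calc _ ≤ 1 * ‖c‖ := mul_le_mul h2 h3 (norm_nonneg _) zero_le_one
    _ = ‖c‖ := one_mul _

theorem mul_symm (c : ℝ →ᵇ ℝ) (f g : L2Om a b) : ⟪mul a b c f, g⟫_ℝ = ⟪f, mul a b c g⟫_ℝ := by
  rw [inner_eq_of_ae (coeFn_mul c f) (ae_eq_refl _), inner_eq_of_ae (ae_eq_refl _) (coeFn_mul c g)]
  exact integral_congr_ae (Eventually.of_forall fun x => by ring)

end L2Om

/-- The frequencies `kπ / (b - a)`. -/
def freq (a b : ℝ) (k : ℕ) : ℝ := k * (Real.pi / (b - a))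

/-- The cosines of the frequencies `kπ / (b - a)`, normalized in `L²(a,b)`. -/
def cosC (a b : ℝ) (k : ℕ) : ℝ →ᵇ ℝ :=
  BoundedContinuousFunction.ofNormedAddCommGroup
    (fun x => (if k = 0 then √(1 / (b - a)) else √(2 / (b - a))) * Real.cos (freq a b k * (x - a)))
    (by fun_prop) (√(1 / (b - a)) + √(2 / (b - a))) (fun x => by
      rw [norm_mul]
      refine (mul_le_of_le_one_right (norm_nonneg _) (Real.abs_cos_le_one _)).trans ?_
      have h1 := Real.sqrt_nonneg (1 / (b - a))
      have h2 := Real.sqrt_nonneg (2 / (b - a))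
      split_ifs <;> rw [Real.norm_of_nonneg (by assumption)] <;> linarith)

/-- The sines of the frequencies `kπ / (b - a)`, normalized in `L²(a,b)`. -/
def sinC (a b : ℝ) (k : ℕ) : ℝ →ᵇ ℝ :=
  BoundedContinuousFunction.ofNormedAddCommGroup
    (fun x => √(2 / (b - a)) * Real.sin (freq a b k * (x - a)))
    (by fun_prop) (√(2 / (b - a))) (fun x => by
      rw [norm_mul, Real.norm_of_nonneg (Real.sqrt_nonneg _)]
      exact mul_le_of_le_one_right (Real.sqrt_nonneg _) (Real.abs_sin_le_one _))

section Trig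

variable {a b : ℝ}

theorem cosC_apply (k : ℕ) (x : ℝ) : cosC a b k x =
    (if k = 0 then √(1 / (b - a)) else √(2 / (b - a))) * Real.cos (freq a b k * (x - a)) := rfl

theorem sinC_apply (k : ℕ) (x : ℝ) :
    sinC a b k x = √(2 / (b - a)) * Real.sin (freq a b k * (x - a)) := rfl

theorem freq_zero : freq a b 0 = 0 := by simp [freq]

theorem freq_pos (hab : a < b) {k : ℕ} (hk : k ≠ 0) : 0 < freq a b k :=
  mul_pos (by positivity) (div_pos Real.pi_pos (by linarith))

theorem freq_nonneg (hab : a < b) (k : ℕ) : 0 ≤ freq a b k :=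
  mul_nonneg (by positivity) (div_pos Real.pi_pos (by linarith)).le

theorem sinC_zero : sinC a b 0 = 0 := by
  ext x
  simp [sinC_apply, freq_zero]

theorem hasDerivAt_cosC (k : ℕ) (x : ℝ) :
    HasDerivAt (cosC a b k) (-(freq a b k * sinC a b k x)) x := by
  have h1 : HasDerivAt (fun x => freq a b k * (x - a)) (freq a b k) x := by
    simpa using ((hasDerivAt_id x).sub_const a).const_mul (freq a b k)
  have h2 := (h1.cos).const_mul (if k = 0 then √(1 / (b - a)) else √(2 / (b - a)))
  refine h2.congr_deriv ?_
  rw [sinC_apply]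
  rcases eq_or_ne k 0 with rfl | hk
  · simp [freq_zero]
  · rw [if_neg hk]; ring

theorem hasDerivAt_sinC (k : ℕ) (x : ℝ) :
    HasDerivAt (sinC a b k) (freq a b k * cosC a b k x) x := by
  have h1 : HasDerivAt (fun x => freq a b k * (x - a)) (freq a b k) x := by
    simpa using ((hasDerivAt_id x).sub_const a).const_mul (freq a b k)
  have h2 := (h1.sin).const_mul √(2 / (b - a))
  refine h2.congr_deriv ?_
  rw [cosC_apply]
  rcases eq_or_ne k 0 with rfl | hk
  · simp [freq_zero]
  · rw [if_neg hk]; ring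

theorem sinC_left (k : ℕ) : sinC a b k a = 0 := by simp [sinC_apply]

theorem sinC_right (hab : a < b) (k : ℕ) : sinC a b k b = 0 := by
  have : freq a b k * (b - a) = k * Real.pi := by
    rw [freq]; field_simp [(sub_pos.2 hab).ne']
  rw [sinC_apply, this, Real.sin_nat_mul_pi, mul_zero]

theorem integral_cos_int (hab : a < b) (n : ℤ) :
    ∫ x in a..b, Real.cos (n * (Real.pi / (b - a) * (x - a))) = if n = 0 then b - a else 0 := by
  split_ifs with h
  · simp [h]
  · have hL : b - a ≠ 0 := (sub_pos.2 hab).ne'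
    have hc : (n : ℝ) * (Real.pi / (b - a)) ≠ 0 :=
      mul_ne_zero (by exact_mod_cast h) (div_ne_zero Real.pi_ne_zero hL)
    have hd : ∀ x ∈ uIcc a b, HasDerivAt
        (fun x => Real.sin (n * (Real.pi / (b - a) * (x - a))) / (n * (Real.pi / (b - a))))
        (Real.cos (n * (Real.pi / (b - a) * (x - a)))) x := by
      intro x _
      have h1 : HasDerivAt (fun x => (n : ℝ) * (Real.pi / (b - a) * (x - a)))
          (n * (Real.pi / (b - a))) x := by
        simpa using (((hasDerivAt_id x).sub_const a).const_mul (Real.pi / (b - a))).const_mul (n : ℝ)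
      refine (h1.sin.div_const _).congr_deriv ?_
      field_simp
    rw [intervalIntegral.integral_eq_sub_of_hasDerivAt hd
      (Continuous.intervalIntegrable (by fun_prop) _ _)]
    have : (n : ℝ) * (Real.pi / (b - a) * (b - a)) = n * Real.pi := by field_simp
    rw [this, Real.sin_int_mul_pi]
    simp

theorem setIntegral_Ioo_eq (hab : a ≤ b) (f : ℝ → ℝ) : ∫ x in Ioo a b, f x = ∫ x in a..b, f x := by
  rw [intervalIntegral.integral_of_le hab, integral_Ioc_eq_integral_Ioo]

theorem integral_cos_mul_cos (hab : a < b) (j k : ℕ) :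
    ∫ x in a..b, Real.cos (freq a b j * (x - a)) * Real.cos (freq a b k * (x - a)) =
      1 / 2 * ((if j = k then b - a else 0) + if j + k = 0 then b - a else 0) := by
  have h : ∀ x, Real.cos (freq a b j * (x - a)) * Real.cos (freq a b k * (x - a)) =
      1 / 2 * (Real.cos (((j - k : ℤ) : ℝ) * (Real.pi / (b - a) * (x - a))) +
        Real.cos (((j + k : ℤ) : ℝ) * (Real.pi / (b - a) * (x - a)))) := by
    intro x
    have e1 : ((j - k : ℤ) : ℝ) * (Real.pi / (b - a) * (x - a)) =
        freq a b j * (x - a) - freq a b k * (x - a) := by push_cast [freq]; ring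
    have e2 : ((j + k : ℤ) : ℝ) * (Real.pi / (b - a) * (x - a)) =
        freq a b j * (x - a) + freq a b k * (x - a) := by push_cast [freq]; ring
    rw [e1, e2, Real.cos_sub, Real.cos_add]
    ring
  simp only [h]
  rw [intervalIntegral.integral_const_mul, intervalIntegral.integral_add
    (Continuous.intervalIntegrable (by fun_prop) _ _)
    (Continuous.intervalIntegrable (by fun_prop) _ _), integral_cos_int hab, integral_cos_int hab]
  congr 2
  · exact if_congr (by omega) rfl rfl
  · exact if_congr (by omega) rfl rfl

theorem integral_sin_mul_sin (hab : a < b) (j k : ℕ) :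
    ∫ x in a..b, Real.sin (freq a b j * (x - a)) * Real.sin (freq a b k * (x - a)) =
      1 / 2 * ((if j = k then b - a else 0) - if j + k = 0 then b - a else 0) := by
  have h : ∀ x, Real.sin (freq a b j * (x - a)) * Real.sin (freq a b k * (x - a)) =
      1 / 2 * (Real.cos (((j - k : ℤ) : ℝ) * (Real.pi / (b - a) * (x - a))) -
        Real.cos (((j + k : ℤ) : ℝ) * (Real.pi / (b - a) * (x - a)))) := by
    intro x
    have e1 : ((j - k : ℤ) : ℝ) * (Real.pi / (b - a) * (x - a)) =
        freq a b j * (x - a) - freq a b k * (x - a) := by push_cast [freq]; ring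
    have e2 : ((j + k : ℤ) : ℝ) * (Real.pi / (b - a) * (x - a)) =
        freq a b j * (x - a) + freq a b k * (x - a) := by push_cast [freq]; ring
    rw [e1, e2, Real.cos_sub, Real.cos_add]
    ring
  simp only [h]
  rw [intervalIntegral.integral_const_mul, intervalIntegral.integral_sub
    (Continuous.intervalIntegrable (by fun_prop) _ _)
    (Continuous.intervalIntegrable (by fun_prop) _ _), integral_cos_int hab, integral_cos_int hab]
  congr 2
  · exact if_congr (by omega) rfl rfl
  · exact if_congr (by omega) rfl rfl

/-- The normalized cosines as elements of `L²(a,b)`. -/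
def cosL (a b : ℝ) (k : ℕ) : L2Om a b := L2Om.ofBCF a b (cosC a b k)

/-- The normalized sines as elements of `L²(a,b)`. -/
def sinL (a b : ℝ) (k : ℕ) : L2Om a b := L2Om.ofBCF a b (sinC a b k)

theorem sinL_zero : sinL a b 0 = 0 := by rw [sinL, sinC_zero, map_zero]

theorem orthonormal_cosL (hab : a < b) : Orthonormal ℝ (cosL a b) := by
  have hL : 0 < b - a := sub_pos.2 hab
  rw [orthonormal_iff_ite]
  intro j k
  rw [cosL, cosL, L2Om.inner_eq_of_ae (L2Om.coeFn_ofBCF _) (L2Om.coeFn_ofBCF _),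
    setIntegral_Ioo_eq hab.le]
  simp only [cosC_apply, mul_mul_mul_comm _ (Real.cos _)]
  rw [intervalIntegral.integral_const_mul, integral_cos_mul_cos hab]
  rcases eq_or_ne j k with rfl | hjk
  · rcases eq_or_ne j 0 with rfl | hj
    · simp only [if_true]
      rw [Real.mul_self_sqrt (by positivity)]
      field_simp
      norm_num
    · simp only [if_neg hj, if_true]
      rw [Real.mul_self_sqrt (by positivity), if_neg (by omega)]
      field_simp
      norm_num
  · rw [if_neg hjk, if_neg hjk, if_neg (show ¬ (j + k = 0) by omega)]
    ring

theorem orthonormal_sinL (hab : a < b) : Orthonormal ℝ fun k => sinL a b (k + 1) := by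
  have hL : 0 < b - a := sub_pos.2 hab
  rw [orthonormal_iff_ite]
  intro j k
  rw [sinL, sinL, L2Om.inner_eq_of_ae (L2Om.coeFn_ofBCF _) (L2Om.coeFn_ofBCF _),
    setIntegral_Ioo_eq hab.le]
  simp only [sinC_apply, mul_mul_mul_comm _ (Real.sin _)]
  rw [intervalIntegral.integral_const_mul, integral_sin_mul_sin hab,
    Real.mul_self_sqrt (by positivity), if_neg (show ¬ (j + 1 + (k + 1) = 0) by omega)]
  rcases eq_or_ne j k with rfl | hjk
  · simp only [if_true]
    field_simp
    norm_num
  · rw [if_neg hjk, if_neg (by omega)]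
    ring

theorem integral_mul_cos_pow_eq_zero (f : L2Om a b)
    (h : ∀ k : ℕ, ∫ x in Ioo a b, f x * Real.cos (freq a b k * (x - a)) = 0) (n : ℕ) :
    ∀ k : ℕ, ∫ x in Ioo a b,
      f x * (Real.cos (freq a b k * (x - a)) * Real.cos (freq a b 1 * (x - a)) ^ n) = 0 := by
  have hi : ∀ k n : ℕ, IntegrableOn (fun x => f x *
      (Real.cos (freq a b k * (x - a)) * Real.cos (freq a b 1 * (x - a)) ^ n)) (Ioo a b) := by
    intro k n
    refine L2Om.integrable_mul_bcf f (BoundedContinuousFunction.ofNormedAddCommGroup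
      (fun x => Real.cos (freq a b k * (x - a)) * Real.cos (freq a b 1 * (x - a)) ^ n)
      (by fun_prop) 1 fun x => ?_)
    rw [norm_mul, norm_pow]
    exact mul_le_one₀ (Real.abs_cos_le_one _) (by positivity)
      (pow_le_one₀ (norm_nonneg _) (Real.abs_cos_le_one _))
  induction n with
  | zero => simpa using h
  | succ n ih =>
    intro k
    rcases k with _ | k
    · refine Eq.trans (integral_congr_ae (Eventually.of_forall fun x => ?_)) (ih 1)
      simp only [freq_zero]
      ring_nf
      simp
    · have e : ∀ x, f x * (Real.cos (freq a b (k + 1) * (x - a)) *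
          Real.cos (freq a b 1 * (x - a)) ^ (n + 1)) =
          1 / 2 * (f x * (Real.cos (freq a b (k + 2) * (x - a)) *
            Real.cos (freq a b 1 * (x - a)) ^ n) +
          f x * (Real.cos (freq a b k * (x - a)) * Real.cos (freq a b 1 * (x - a)) ^ n)) := by
        intro x
        have e1 : freq a b (k + 2) * (x - a) =
            freq a b (k + 1) * (x - a) + freq a b 1 * (x - a) := by push_cast [freq]; ring
        have e2 : freq a b k * (x - a) =
            freq a b (k + 1) * (x - a) - freq a b 1 * (x - a) := by push_cast [freq]; ring
        rw [e1, e2, Real.cos_add, Real.cos_sub]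
        ring
      simp only [e]
      rw [integral_const_mul, integral_add (hi _ _) (hi _ _), ih, ih]
      simp

theorem eq_zero_of_integral_cos (hab : a < b) (f : L2Om a b)
    (h : ∀ k : ℕ, ∫ x in Ioo a b, f x * Real.cos (freq a b k * (x - a)) = 0) : f = 0 := by
  have hL : 0 < b - a := sub_pos.2 hab
  have hpow : ∀ n : ℕ, ∫ x in Ioo a b, f x * Real.cos (freq a b 1 * (x - a)) ^ n = 0 := by
    intro n
    simpa [freq_zero] using integral_mul_cos_pow_eq_zero f h n 0
  have hB : ∀ p : Polynomial ℝ, ∃ c : ℝ →ᵇ ℝ,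
      ∀ x, c x = p.eval (Real.cos (freq a b 1 * (x - a))) := by
    intro p
    obtain ⟨C, hC⟩ := (isCompact_Icc (a := (-1 : ℝ)) (b := 1)).exists_bound_of_continuousOn
      p.continuous.continuousOn
    exact ⟨BoundedContinuousFunction.ofNormedAddCommGroup
      (fun x => p.eval (Real.cos (freq a b 1 * (x - a)))) (by fun_prop) C
      fun x => hC _ ⟨Real.neg_one_le_cos _, Real.cos_le_one _⟩, fun x => rfl⟩
  have hpoly : ∀ p : Polynomial ℝ,
      ∫ x in Ioo a b, f x * p.eval (Real.cos (freq a b 1 * (x - a))) = 0 := by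
    intro p
    induction p using Polynomial.induction_on' with
    | add p q hp hq =>
      obtain ⟨c, hc⟩ := hB p
      obtain ⟨d, hd⟩ := hB q
      simp only [Polynomial.eval_add, mul_add, ← hc, ← hd] at hp hq ⊢
      rw [integral_add (L2Om.integrable_mul_bcf f c) (L2Om.integrable_mul_bcf f d), hp, hq,
        add_zero]
    | monomial n r =>
      simp only [Polynomial.eval_monomial, mul_left_comm _ r]
      rw [integral_const_mul, hpow, mul_zero]
  refine L2Om.eq_zero_of_integral_bcf f fun φ => ?_
  have hi1 : IntegrableOn (fun x => f x) (Ioo a b) := by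
    simpa using L2Om.integrable_mul_bcf f (BoundedContinuousFunction.const ℝ 1)
  set N := ∫ x in Ioo a b, |f x| with hN
  have hN0 : 0 ≤ N := integral_nonneg fun x => abs_nonneg _
  have key : ∀ ε > 0, |∫ x in Ioo a b, f x * φ x| ≤ ε * N := by
    intro ε hε
    obtain ⟨p, hp⟩ := exists_polynomial_near_of_continuousOn (-1) 1
      (fun s => φ (a + (b - a) / Real.pi * Real.arccos s))
      (by fun_prop) ε hε
    obtain ⟨c, hc⟩ := hB p
    have e : ∫ x in Ioo a b, f x * φ x = ∫ x in Ioo a b, (f x * φ x - f x * c x) := by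
      rw [integral_sub (L2Om.integrable_mul_bcf f φ) (L2Om.integrable_mul_bcf f c)]
      simp only [hc]
      rw [hpoly, sub_zero]
    rw [e, hN, ← integral_const_mul, ← Real.norm_eq_abs]
    refine norm_integral_le_of_norm_le (hi1.abs.const_mul ε) ?_
    filter_upwards [ae_restrict_mem measurableSet_Ioo] with x hx
    have h1 := hp (Real.cos (freq a b 1 * (x - a))) ⟨Real.neg_one_le_cos _, Real.cos_le_one _⟩
    have h2 : freq a b 1 * (x - a) = Real.pi * ((x - a) / (b - a)) := by
      rw [freq]; push_cast; ring
    have h3 : (x - a) / (b - a) ≤ 1 := by rw [div_le_one hL]; linarith [hx.2]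
    have h4 : 0 ≤ (x - a) / (b - a) := div_nonneg (by linarith [hx.1]) hL.le
    rw [Real.arccos_cos (by rw [h2]; exact mul_nonneg Real.pi_pos.le h4)
      (by rw [h2]; exact mul_le_of_le_one_right Real.pi_pos.le h3), h2] at h1
    have h5 : a + (b - a) / Real.pi * (Real.pi * ((x - a) / (b - a))) = x := by
      field_simp [Real.pi_ne_zero]
      ring
    rw [h5, ← h2, ← hc, abs_sub_comm] at h1
    rw [← mul_sub, norm_mul, mul_comm]
    exact mul_le_mul_of_nonneg_right h1.le (norm_nonneg _)
  rw [← abs_nonpos_iff]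
  refine le_of_forall_pos_le_add fun δ hδ => ?_
  refine (key (δ / (N + 1)) (by positivity)).trans ?_
  rw [zero_add, div_mul_eq_mul_div, div_le_iff₀ (by positivity)]
  nlinarith

theorem eq_zero_of_inner_cosL (hab : a < b) (f : L2Om a b) (h : ∀ k, ⟪f, cosL a b k⟫_ℝ = 0) :
    f = 0 := by
  have hL : 0 < b - a := sub_pos.2 hab
  refine eq_zero_of_integral_cos hab f fun k => ?_
  have h1 := h k
  rw [cosL, L2Om.inner_ofBCF] at h1
  simp only [cosC_apply, mul_left_comm (f _)] at h1
  rw [integral_const_mul] at h1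
  refine (mul_eq_zero.1 h1).resolve_left ?_
  split_ifs <;> positivity

theorem eq_zero_of_inner_sinL (hab : a < b) (f : L2Om a b)
    (h : ∀ k, ⟪f, sinL a b (k + 1)⟫_ℝ = 0) : f = 0 := by
  have hL : 0 < b - a := sub_pos.2 hab
  have h0 : ∀ k, ∫ x in Ioo a b, f x * Real.sin (freq a b k * (x - a)) = 0 := by
    intro k
    rcases k with _ | k
    · simp [freq_zero]
    have h1 := h k
    rw [sinL, L2Om.inner_ofBCF] at h1
    simp only [sinC_apply, mul_left_comm (f _)] at h1
    rw [integral_const_mul] at h1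
    refine (mul_eq_zero.1 h1).resolve_left (by positivity)
  have hi : ∀ k, IntegrableOn (fun x => f x * Real.sin (freq a b k * (x - a))) (Ioo a b) := by
    intro k
    exact L2Om.integrable_mul_bcf f (BoundedContinuousFunction.ofNormedAddCommGroup
      (fun x => Real.sin (freq a b k * (x - a))) (by fun_prop) 1 fun x => Real.abs_sin_le_one _)
  have h1 : L2Om.mul a b (sinC a b 1) f = 0 := by
    refine eq_zero_of_integral_cos hab _ fun k => ?_
    have e : ∀ᵐ x ∂volume.restrict (Ioo a b),
        L2Om.mul a b (sinC a b 1) f x * Real.cos (freq a b k * (x - a)) =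
        √(2 / (b - a)) / 2 * (f x * Real.sin (freq a b (k + 1) * (x - a)) +
          if k = 0 then f x * Real.sin (freq a b 1 * (x - a))
          else -(f x * Real.sin (freq a b (k - 1) * (x - a)))) := by
      filter_upwards [L2Om.coeFn_mul (sinC a b 1) f] with x hx
      rw [hx, sinC_apply]
      rcases k with _ | k
      · simp [freq_zero]; ring
      · have e1 : freq a b (k + 1 + 1) * (x - a) =
            freq a b (k + 1) * (x - a) + freq a b 1 * (x - a) := by push_cast [freq]; ring
        have e2 : freq a b (k + 1 - 1) * (x - a) =
            freq a b (k + 1) * (x - a) - freq a b 1 * (x - a) := by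
          rw [Nat.add_sub_cancel]; push_cast [freq]; ring
        rw [if_neg (Nat.succ_ne_zero k), e1, e2, Real.sin_add, Real.sin_sub]
        ring
    rw [integral_congr_ae e, integral_const_mul]
    rcases k with _ | k
    · simp only [if_true]
      rw [integral_add (hi _) (hi _), h0]
      simp
    · simp only [if_neg (Nat.succ_ne_zero k)]
      simp only [← sub_eq_add_neg]
      rw [integral_sub (hi _) (hi _), h0, h0]
      simp
  have h2 : f =ᵐ[volume.restrict (Ioo a b)] 0 := by
    have h3 := Lp.coeFn_zero ℝ 2 (volume.restrict (Ioo a b))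
    have h4 := L2Om.coeFn_mul (sinC a b 1) f
    rw [h1] at h4
    filter_upwards [h3, h4, ae_restrict_mem measurableSet_Ioo] with x h5 h6 hx
    rw [h5] at h6
    refine (mul_eq_zero.1 h6.symm).resolve_left ?_
    rw [sinC_apply]
    refine (mul_pos (by positivity) (Real.sin_pos_of_pos_of_lt_pi ?_ ?_)).ne'
    · exact mul_pos (freq_pos hab one_ne_zero) (by linarith [hx.1])
    · rw [freq, Nat.cast_one, one_mul, div_mul_eq_mul_div, div_lt_iff₀ hL]
      exact mul_lt_mul_of_pos_left (by linarith [hx.2]) Real.pi_pos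
  exact (Lp.eq_zero_iff_ae_eq_zero).2 h2

theorem span_orthogonal_eq_bot {H : Type*} [NormedAddCommGroup H] [InnerProductSpace ℝ H]
    {e : ℕ → H} (h : ∀ f, (∀ k, ⟪f, e k⟫_ℝ = 0) → f = 0) : (Submodule.span ℝ (range e))ᗮ = ⊥ := by
  rw [Submodule.eq_bot_iff]
  intro f hf
  refine h f fun k => ?_
  rw [real_inner_comm]
  exact (Submodule.mem_orthogonal _ _).1 hf _ (Submodule.subset_span (mem_range_self k))

/-- The cosine basis. -/
def cosBasis (hab : a < b) : HilbertBasis ℕ ℝ (L2Om a b) :=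
  HilbertBasis.mkOfOrthogonalEqBot (orthonormal_cosL hab)
    (span_orthogonal_eq_bot (eq_zero_of_inner_cosL hab))

/-- The sine basis. -/
def sinBasis (hab : a < b) : HilbertBasis ℕ ℝ (L2Om a b) :=
  HilbertBasis.mkOfOrthogonalEqBot (orthonormal_sinL hab)
    (span_orthogonal_eq_bot (eq_zero_of_inner_sinL hab))

theorem cosBasis_apply (hab : a < b) (k : ℕ) : cosBasis hab k = cosL a b k :=
  congrFun (HilbertBasis.coe_mkOfOrthogonalEqBot _ _) k

theorem sinBasis_apply (hab : a < b) (k : ℕ) : sinBasis hab k = sinL a b (k + 1) :=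
  congrFun (HilbertBasis.coe_mkOfOrthogonalEqBot _ _) k

end Trig

section Synthesis

variable {a b : ℝ}

/-- Synthesis of a function from its cosine coefficients. -/
def cosS (hab : a < b) : SeqE →L[ℝ] L2Om a b :=
  ((cosBasis hab).repr.symm.toContinuousLinearEquiv : SeqE →L[ℝ] L2Om a b)

theorem cosS_apply (hab : a < b) (x : SeqE) : cosS hab x = (cosBasis hab).repr.symm x := rfl

theorem norm_cosS (hab : a < b) (x : SeqE) : ‖cosS hab x‖ = ‖x‖ :=
  (cosBasis hab).repr.symm.norm_map x

theorem inner_cosS_cosS (hab : a < b) (x y : SeqE) : ⟪cosS hab x, cosS hab y⟫_ℝ = ⟪x, y⟫_ℝ :=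
  (cosBasis hab).repr.symm.inner_map_map x y

theorem cosS_repr (hab : a < b) (f : L2Om a b) : cosS hab ((cosBasis hab).repr f) = f :=
  (cosBasis hab).repr.symm_apply_apply f

theorem repr_cosS (hab : a < b) (x : SeqE) : (cosBasis hab).repr (cosS hab x) = x :=
  (cosBasis hab).repr.apply_symm_apply x

theorem cosBasis_repr_apply (hab : a < b) (f : L2Om a b) (k : ℕ) :
    (cosBasis hab).repr f k = ⟪f, cosL a b k⟫_ℝ := by
  rw [HilbertBasis.repr_apply_apply, cosBasis_apply, real_inner_comm]

theorem inner_cosS (hab : a < b) (x : SeqE) (k : ℕ) : ⟪cosS hab x, cosL a b k⟫_ℝ = x k := by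
  rw [← cosBasis_repr_apply hab, repr_cosS]

theorem hasSum_cosS (hab : a < b) (x : SeqE) :
    HasSum (fun k => x k • cosL a b k) (cosS hab x) := by
  have := (cosBasis hab).hasSum_repr_symm x
  rw [cosS_apply]
  exact this.congr_fun fun k => by rw [cosBasis_apply]

/-- The left shift. -/
def shiftL : SeqE →L[ℝ] SeqE :=
  LinearMap.mkContinuous
    { toFun := fun x => seqMk (fun k => x (k + 1))
        ((summable_nat_add_iff 1).2 (seq_hasSum_sq x).summable)
      map_add' := fun _ _ => rfl
      map_smul' := fun _ _ => rfl } 1 (fun x => by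
    rw [one_mul]
    refine abs_le_of_sq_le_sq' ?_ (norm_nonneg _) |>.2
    rw [← (seq_hasSum_sq x).tsum_eq, (seq_hasSum_sq x).summable.tsum_eq_zero_add]
    rw [← (seq_hasSum_sq _).tsum_eq]
    exact le_add_of_nonneg_left (sq_nonneg (x 0)))

theorem shiftL_apply (x : SeqE) (k : ℕ) : shiftL x k = x (k + 1) := rfl

theorem norm_shiftL_sq (x : SeqE) : ‖x‖ ^ 2 = x 0 ^ 2 + ‖shiftL x‖ ^ 2 := by
  rw [← (seq_hasSum_sq x).tsum_eq, (seq_hasSum_sq x).summable.tsum_eq_zero_add,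
    ← (seq_hasSum_sq (shiftL x)).tsum_eq]
  rfl

/-- Synthesis of a function from its sine coefficients; the coefficient of index zero is
ignored. -/
def sinS (hab : a < b) : SeqE →L[ℝ] L2Om a b :=
  ((sinBasis hab).repr.symm.toContinuousLinearEquiv : SeqE →L[ℝ] L2Om a b).comp shiftL

theorem sinS_apply (hab : a < b) (x : SeqE) :
    sinS hab x = (sinBasis hab).repr.symm (shiftL x) := rfl

theorem norm_sinS_sq (hab : a < b) (x : SeqE) : ‖x‖ ^ 2 = x 0 ^ 2 + ‖sinS hab x‖ ^ 2 := by
  rw [sinS_apply, LinearIsometryEquiv.norm_map, norm_shiftL_sq]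

theorem inner_sinS (hab : a < b) (x : SeqE) (k : ℕ) :
    ⟪sinS hab x, sinL a b k⟫_ℝ = if k = 0 then 0 else x k := by
  rcases k with _ | k
  · simp [sinL_zero]
  · rw [← sinBasis_apply hab, real_inner_comm, ← HilbertBasis.repr_apply_apply, sinS_apply,
      LinearIsometryEquiv.apply_symm_apply]
    simp [shiftL_apply]

theorem norm_sinS_le (hab : a < b) (x : SeqE) : ‖sinS hab x‖ ≤ ‖x‖ :=
  abs_le_of_sq_le_sq' (by nlinarith [norm_sinS_sq hab x, sq_nonneg (x 0)]) (norm_nonneg _) |>.2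

theorem eq_of_inner_cosL (hab : a < b) {f g : L2Om a b}
    (h : ∀ k, ⟪f, cosL a b k⟫_ℝ = ⟪g, cosL a b k⟫_ℝ) : f = g :=
  sub_eq_zero.1 (eq_zero_of_inner_cosL hab _ fun k => by rw [inner_sub_left, h k, sub_self])

theorem eq_of_inner_sinL (hab : a < b) {f g : L2Om a b}
    (h : ∀ k, ⟪f, sinL a b k⟫_ℝ = ⟪g, sinL a b k⟫_ℝ) : f = g :=
  sub_eq_zero.1 (eq_zero_of_inner_sinL hab _ fun k => by rw [inner_sub_left, h, sub_self])

theorem norm_cosC_le (hab : a < b) (k : ℕ) : ‖cosC a b k‖ ≤ √(2 / (b - a)) := by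
  have hL : 0 < b - a := sub_pos.2 hab
  refine (BoundedContinuousFunction.norm_le (Real.sqrt_nonneg _)).2 fun x => ?_
  rw [cosC_apply, norm_mul]
  have h1 : ‖(if k = 0 then √(1 / (b - a)) else √(2 / (b - a)))‖ ≤ √(2 / (b - a)) := by
    split_ifs
    · rw [Real.norm_of_nonneg (Real.sqrt_nonneg _)]
      gcongr; norm_num
    · rw [Real.norm_of_nonneg (Real.sqrt_nonneg _)]
  calc _ ≤ √(2 / (b - a)) * 1 := by
        gcongr
        exact Real.abs_cos_le_one _
    _ = _ := mul_one _

theorem sum_inv_sq_le {A d : ℝ} (hA : 0 < A) (hd : A ≤ d) (n : ℕ) :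
    ∑ k ∈ Finset.range n, 1 / (A * k + d) ^ 2 ≤ 2 / (A * d) := by
  have hd0 : 0 < d := hA.trans_le hd
  have h1 : ∀ n : ℕ, ∑ k ∈ Finset.range n, 1 / (A * k + d) ^ 2 ≤
      1 / A * (1 / (d - A / 2) - 1 / (A * n + d - A / 2)) := by
    intro n
    induction n with
    | zero => simp
    | succ n ih =>
      rw [Finset.sum_range_succ]
      have hn : 0 ≤ A * n := by positivity
      have p1 : 0 < A * n + d - A / 2 := by linarith
      have p2 : 0 < A * n + d + A / 2 := by linarith
      have p3 : 0 < A * n + d := by linarith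
      have h2 : 1 / (A * n + d) ^ 2 ≤
          1 / A * (1 / (A * n + d - A / 2) - 1 / (A * n + d + A / 2)) := by
        have e : 1 / A * (1 / (A * n + d - A / 2) - 1 / (A * n + d + A / 2)) =
            1 / ((A * n + d - A / 2) * (A * n + d + A / 2)) := by
          have e1 : A = (A * n + d + A / 2) - (A * n + d - A / 2) := by ring
          rw [div_sub_div _ _ p1.ne' p2.ne', one_mul, mul_one, ← e1]
          field_simp
        rw [e]
        apply one_div_le_one_div_of_le (by positivity)
        nlinarith [sq_nonneg A]
      have e2 : A * ((n + 1 : ℕ) : ℝ) + d - A / 2 = A * n + d + A / 2 := by push_cast; ring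
      rw [e2]
      have e3 : 1 / A * (1 / (d - A / 2) - 1 / (A * n + d + A / 2)) =
        1 / A * (1 / (d - A / 2) - 1 / (A * n + d - A / 2)) +
          1 / A * (1 / (A * n + d - A / 2) - 1 / (A * n + d + A / 2)) := by ring
      linarith
  have hn : 0 ≤ A * n := by positivity
  have p0 : 0 < d - A / 2 := by linarith
  have p1 : 0 < A * n + d - A / 2 := by linarith
  calc _ ≤ _ := h1 n
    _ ≤ 1 / A * (1 / (d / 2) - 0) := by
      gcongr
      · linarith
      · positivity
    _ = _ := by field_simp; ring

/-- Interpolation estimate for the absolute sum of coefficients. -/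
theorem sum_abs_sq_le {q : ℝ} (hq : 0 < q) (hq1 : q ≤ 1) (θ y : SeqE) (h : ∀ k, |θ k| ≤ |y k|)
    (h' : ∀ k : ℕ, q * k * |θ k| ≤ |y k|) (n : ℕ) :
    (∑ k ∈ Finset.range n, |θ k|) ^ 2 ≤ 8 / q * (‖θ‖ * ‖y‖) := by
  have hle : ‖θ‖ ≤ ‖y‖ := by
    refine abs_le_of_sq_le_sq' ?_ (norm_nonneg _) |>.2
    exact hasSum_le (fun k => sq_le_sq.2 (h k)) (seq_hasSum_sq θ) (seq_hasSum_sq y)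
  rcases (norm_nonneg θ).eq_or_lt with h0 | h0
  · have : θ = 0 := norm_eq_zero.1 h0.symm
    subst this
    simp
  obtain ⟨α, hα⟩ : ∃ α, α = ‖θ‖ := ⟨_, rfl⟩
  obtain ⟨d, hd⟩ : ∃ d, d = ‖y‖ := ⟨_, rfl⟩
  rw [← hα] at hle h0 ⊢
  rw [← hd] at hle ⊢
  have hd0 : 0 < d := h0.trans_le hle
  have hA : 0 < α * q := by positivity
  have hAd : α * q ≤ d := (mul_le_of_le_one_right h0.le hq1).trans hle
  have h1 := Finset.sum_sq_le_sum_mul_sum_of_sq_le_mul (Finset.range n)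
    (r := fun k => |θ k|) (f := fun k => (α * q * k + d) ^ 2 * θ k ^ 2)
    (g := fun k => 1 / (α * q * k + d) ^ 2) (fun k _ => by positivity) (fun k _ => by positivity)
    (fun k _ => by
      have : 0 < α * q * k + d := by positivity
      refine le_of_eq ?_
      rw [sq_abs]; field_simp)
  have h2 : ∑ k ∈ Finset.range n, (α * q * k + d) ^ 2 * θ k ^ 2 ≤ 4 * α ^ 2 * d ^ 2 := by
    have k1 : ∀ k ∈ Finset.range n, (α * q * k + d) ^ 2 * θ k ^ 2 ≤
        2 * α ^ 2 * y k ^ 2 + 2 * d ^ 2 * θ k ^ 2 := by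
      intro k _
      have e1 : (q * k * |θ k|) ^ 2 ≤ |y k| ^ 2 := by
        have := h' k
        gcongr
      rw [sq_abs, mul_pow, sq_abs] at e1
      have e2 := mul_le_mul_of_nonneg_left e1 (sq_nonneg α)
      have e3 : (α * q * k + d) ^ 2 ≤ 2 * (α * q * k) ^ 2 + 2 * d ^ 2 := by
        nlinarith [sq_nonneg (α * q * k - d)]
      have e4 := mul_le_mul_of_nonneg_right e3 (sq_nonneg (θ k))
      linarith
    refine (Finset.sum_le_sum k1).trans ?_
    rw [Finset.sum_add_distrib, ← Finset.mul_sum, ← Finset.mul_sum]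
    have s1 := sum_le_hasSum (Finset.range n) (fun k _ => sq_nonneg _) (seq_hasSum_sq θ)
    have s2 := sum_le_hasSum (Finset.range n) (fun k _ => sq_nonneg _) (seq_hasSum_sq y)
    rw [← hα] at s1
    rw [← hd] at s2
    nlinarith [mul_le_mul_of_nonneg_left s2 (sq_nonneg α),
      mul_le_mul_of_nonneg_left s1 (sq_nonneg d)]
  calc _ ≤ _ := h1
    _ ≤ 4 * α ^ 2 * d ^ 2 * (2 / (α * q * d)) := by
      gcongr
      exact sum_inv_sq_le hA hAd n
    _ = _ := by field_simp; ring

end Synthesis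

section Frequencies

/-- The multiplier `√(1 + λ²)`. -/
def omF (a b : ℝ) (k : ℕ) : ℝ := √(1 + freq a b k ^ 2)

variable {a b : ℝ}

theorem omF_sq (k : ℕ) : omF a b k ^ 2 = 1 + freq a b k ^ 2 := Real.sq_sqrt (by positivity)

theorem one_le_omF (k : ℕ) : 1 ≤ omF a b k :=
  Real.one_le_sqrt.2 (by nlinarith [sq_nonneg (freq a b k)])

theorem omF_pos (k : ℕ) : 0 < omF a b k := zero_lt_one.trans_le (one_le_omF k)

theorem omF_zero : omF a b 0 = 1 := by simp [omF, freq_zero]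

theorem freq_le_omF (k : ℕ) : |freq a b k| ≤ omF a b k := by
  rw [← Real.sqrt_sq_eq_abs]
  exact Real.sqrt_le_sqrt (by linarith)

theorem abs_one_div_omF_le (k : ℕ) : |1 / omF a b k| ≤ 1 := by
  rw [abs_of_pos (one_div_pos.2 (omF_pos k)), div_le_one (omF_pos k)]
  exact one_le_omF k

theorem abs_freq_div_omF_le (k : ℕ) : |freq a b k / omF a b k| ≤ 1 := by
  rw [abs_div, abs_of_pos (omF_pos k), div_le_one (omF_pos k)]
  exact freq_le_omF k

/-- The multiplier `1 / √(1 + λ²)`. -/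
def invOm (a b : ℝ) : SeqE →L[ℝ] SeqE := diagL fun k => 1 / omF a b k

theorem invOm_apply (y : SeqE) (k : ℕ) : invOm a b y k = 1 / omF a b k * y k :=
  diagL_apply abs_one_div_omF_le y k

/-- The multiplier `λ / √(1 + λ²)`. -/
def freqOm (a b : ℝ) : SeqE →L[ℝ] SeqE := diagL fun k => freq a b k / omF a b k

theorem freqOm_apply (y : SeqE) (k : ℕ) : freqOm a b y k = freq a b k / omF a b k * y k :=
  diagL_apply abs_freq_div_omF_le y k

/-- Embedding of `W^{1,2}` coordinates into `L²`. -/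
def opJ (hab : a < b) : SeqE →L[ℝ] L2Om a b := (cosS hab).comp (invOm a b)

/-- The derivative in `W^{1,2}` coordinates. -/
def opD (hab : a < b) : SeqE →L[ℝ] L2Om a b := -(sinS hab).comp (freqOm a b)

theorem opJ_apply (hab : a < b) (y : SeqE) : opJ hab y = cosS hab (invOm a b y) := rfl

theorem opD_apply (hab : a < b) (y : SeqE) : opD hab y = -sinS hab (freqOm a b y) := rfl

theorem inner_opJ (hab : a < b) (y : SeqE) (k : ℕ) :
    ⟪opJ hab y, cosL a b k⟫_ℝ = 1 / omF a b k * y k := by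
  rw [opJ_apply, inner_cosS, invOm_apply]

theorem inner_opD (hab : a < b) (y : SeqE) (k : ℕ) :
    ⟪opD hab y, sinL a b k⟫_ℝ = -(freq a b k / omF a b k * y k) := by
  rw [opD_apply, inner_neg_left, inner_sinS, freqOm_apply]
  split_ifs with h
  · rw [h, freq_zero]; simp
  · rfl

theorem norm_sq_eq_opJ_opD (hab : a < b) (y : SeqE) :
    ‖y‖ ^ 2 = ‖opJ hab y‖ ^ 2 + ‖opD hab y‖ ^ 2 := by
  have h1 := norm_sinS_sq hab (freqOm a b y)
  have h2 : freqOm a b y 0 = 0 := by rw [freqOm_apply, freq_zero]; simp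
  rw [h2] at h1
  rw [opJ_apply, norm_cosS, opD_apply, norm_neg]
  have h3 : ‖y‖ ^ 2 = ‖invOm a b y‖ ^ 2 + ‖freqOm a b y‖ ^ 2 := by
    refine (seq_hasSum_sq y).unique (((seq_hasSum_sq (invOm a b y)).add
      (seq_hasSum_sq (freqOm a b y))).congr_fun fun k => ?_)
    rw [invOm_apply, freqOm_apply]
    have := omF_sq (a := a) (b := b) k
    have h0 := (omF_pos (a := a) (b := b) k).ne'
    field_simp
    rw [this]
  linarith

/-- A pair satisfying the weak Neumann relation comes from `W^{1,2}` coordinates. -/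
theorem exists_coordinates (hab : a < b) (Θ g : L2Om a b)
    (h : ∀ k, ⟪g, sinL a b k⟫_ℝ = -(freq a b k * ⟪Θ, cosL a b k⟫_ℝ)) :
    ∃ y, opJ hab y = Θ ∧ opD hab y = g := by
  have hs : Summable fun k => (freq a b k * ⟪Θ, cosL a b k⟫_ℝ) ^ 2 := by
    have h1 := (seq_hasSum_sq ((sinBasis hab).repr g)).summable
    refine (summable_nat_add_iff 1).1 (h1.congr fun k => ?_)
    rw [HilbertBasis.repr_apply_apply, sinBasis_apply, real_inner_comm, h]
    ring
  have hc : Summable fun k => ⟪Θ, cosL a b k⟫_ℝ ^ 2 :=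
    (seq_hasSum_sq ((cosBasis hab).repr Θ)).summable.congr fun k => by rw [cosBasis_repr_apply]
  have hy : Summable fun k => (omF a b k * ⟪Θ, cosL a b k⟫_ℝ) ^ 2 :=
    (hc.add hs).congr fun k => by rw [mul_pow, mul_pow, omF_sq]; ring
  refine ⟨seqMk _ hy, eq_of_inner_cosL hab fun k => ?_, eq_of_inner_sinL hab fun k => ?_⟩
  · have h0 := (omF_pos (a := a) (b := b) k).ne'
    rw [inner_opJ, seqMk_apply]
    field_simp
  · have h0 := (omF_pos (a := a) (b := b) k).ne'
    rw [inner_opD, seqMk_apply, h]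
    field_simp

theorem summable_abs_invOm (hab : a < b) (y : SeqE) :
    (Summable fun k => |invOm a b y k|) ∧
      (∑' k, |invOm a b y k|) ^ 2 ≤
        8 / min (Real.pi / (b - a)) 1 * (‖invOm a b y‖ * ‖y‖) := by
  have hq : 0 < Real.pi / (b - a) := div_pos Real.pi_pos (sub_pos.2 hab)
  have hq1 : 0 < min (Real.pi / (b - a)) 1 := lt_min hq one_pos
  have h := sum_abs_sq_le hq1 (min_le_right _ _) (invOm a b y) y
    (fun k => by
      rw [invOm_apply, abs_mul]
      exact mul_le_of_le_one_left (abs_nonneg _) (abs_one_div_omF_le k))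
    (fun k => by
      rw [invOm_apply, abs_mul, ← mul_assoc]
      refine mul_le_of_le_one_left (abs_nonneg _) ?_
      refine le_trans ?_ (abs_freq_div_omF_le (a := a) (b := b) k)
      rw [abs_div, abs_div, abs_one, mul_one_div]
      gcongr
      rw [abs_of_nonneg (freq_nonneg hab k), freq, mul_comm]
      gcongr
      exact min_le_left _ _)
  have hs : Summable fun k => |invOm a b y k| := by
    refine summable_of_sum_range_le (c := √(8 / min (Real.pi / (b - a)) 1 *
      (‖invOm a b y‖ * ‖y‖))) (fun k => abs_nonneg _) fun n => Real.le_sqrt_of_sq_le (h n)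
  exact ⟨hs, le_of_tendsto' (hs.hasSum.tendsto_sum_nat.pow 2) h⟩

theorem summable_cosC (hab : a < b) (y : SeqE) :
    Summable fun k => invOm a b y k • cosC a b k := by
  refine Summable.of_norm_bounded ((summable_abs_invOm hab y).1.mul_right √(2 / (b - a)))
    fun k => ?_
  rw [norm_smul, Real.norm_eq_abs]
  gcongr
  exact norm_cosC_le hab k

theorem norm_tsum_cosC_le (hab : a < b) (y : SeqE) :
    ‖∑' k, invOm a b y k • cosC a b k‖ ≤ √(2 / (b - a)) * ∑' k, |invOm a b y k| := by
  have h := (summable_abs_invOm hab y).1.hasSum.mul_left √(2 / (b - a))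
  refine tsum_of_norm_bounded h fun k => ?_
  rw [norm_smul, Real.norm_eq_abs, mul_comm]
  gcongr
  exact norm_cosC_le hab k

/-- The constant of the interpolation inequality. -/
def agmonK (a b : ℝ) : ℝ := 2 / (b - a) * (8 / min (Real.pi / (b - a)) 1)

theorem agmonK_nonneg (hab : a < b) : 0 ≤ agmonK a b := by
  have hL : 0 < b - a := sub_pos.2 hab
  have hq : 0 < Real.pi / (b - a) := div_pos Real.pi_pos hL
  have hq1 : 0 < min (Real.pi / (b - a)) 1 := lt_min hq one_pos
  unfold agmonK
  positivity

theorem norm_tsum_cosC_sq_le (hab : a < b) (y : SeqE) :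
    ‖∑' k, invOm a b y k • cosC a b k‖ ^ 2 ≤ agmonK a b * ‖invOm a b y‖ * ‖y‖ := by
  have hL : 0 < b - a := sub_pos.2 hab
  calc _ ≤ (√(2 / (b - a)) * ∑' k, |invOm a b y k|) ^ 2 := by
        gcongr; exact norm_tsum_cosC_le hab y
    _ = 2 / (b - a) * (∑' k, |invOm a b y k|) ^ 2 := by
        rw [mul_pow, Real.sq_sqrt (by positivity)]
    _ ≤ 2 / (b - a) * (8 / min (Real.pi / (b - a)) 1 * (‖invOm a b y‖ * ‖y‖)) := by
        gcongr
        exact (summable_abs_invOm hab y).2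
    _ = _ := by rw [agmonK]; ring

theorem norm_invOm_le (y : SeqE) : ‖invOm a b y‖ ≤ ‖y‖ := by
  have := norm_diagL_le (abs_one_div_omF_le (a := a) (b := b)) y
  rwa [one_mul] at this

/-- Embedding of `W^{1,2}` coordinates into the continuous functions. -/
def opS (hab : a < b) : SeqE →L[ℝ] (ℝ →ᵇ ℝ) :=
  LinearMap.mkContinuous
    { toFun := fun y => ∑' k, invOm a b y k • cosC a b k
      map_add' := fun x y => by
        rw [← (summable_cosC hab x).tsum_add (summable_cosC hab y)]
        exact tsum_congr fun k => by rw [map_add, seq_add, add_smul]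
      map_smul' := fun c x => by
        rw [RingHom.id_apply, ← (summable_cosC hab x).tsum_const_smul]
        exact tsum_congr fun k => by rw [map_smul, seq_smul, smul_smul] }
    √(agmonK a b) (fun y => by
      have hK := agmonK_nonneg hab
      refine abs_le_of_sq_le_sq' ?_ (by positivity) |>.2
      refine (norm_tsum_cosC_sq_le hab y).trans ?_
      rw [mul_pow, Real.sq_sqrt hK, mul_assoc, sq]
      gcongr
      exact norm_invOm_le y)

theorem hasSum_opS (hab : a < b) (y : SeqE) :
    HasSum (fun k => invOm a b y k • cosC a b k) (opS hab y) := (summable_cosC hab y).hasSum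

theorem ofBCF_opS (hab : a < b) (y : SeqE) : L2Om.ofBCF a b (opS hab y) = opJ hab y := by
  refine HasSum.unique (f := fun k => invOm a b y k • cosL a b k) ?_ (hasSum_cosS hab _)
  refine ((hasSum_opS hab y).mapL (L2Om.ofBCF a b)).congr_fun fun k => ?_
  rw [map_smul, cosL]

theorem coeFn_opJ (hab : a < b) (y : SeqE) :
    opJ hab y =ᵐ[volume.restrict (Ioo a b)] opS hab y := by
  rw [← ofBCF_opS]
  exact L2Om.coeFn_ofBCF _

end Frequencies

section Nonlinearity

/-- Linear extension of `f` to the left of zero. -/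
def extLin (f f' : ℝ → ℝ) (s : ℝ) : ℝ := f (max s 0) + f' 0 * min s 0

/-- Constant extension of `f'` to the left of zero. -/
def extConst (f' : ℝ → ℝ) (s : ℝ) : ℝ := f' (max s 0)

theorem extLin_of_nonneg {f f' : ℝ → ℝ} {s : ℝ} (hs : 0 ≤ s) : extLin f f' s = f s := by
  simp [extLin, hs]

theorem extConst_of_nonneg {f' : ℝ → ℝ} {s : ℝ} (hs : 0 ≤ s) : extConst f' s = f' s := by
  simp [extConst, hs]

theorem abs_max_sub_add_abs_min_sub (s t : ℝ) :
    |max s 0 - max t 0| + |min s 0 - min t 0| = |s - t| := by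
  rcases le_total s 0 with hs | hs <;> rcases le_total t 0 with ht | ht <;>
    simp only [hs, ht, max_eq_left, max_eq_right, min_eq_left, min_eq_right]
  · simp
  · rw [abs_of_nonpos (by linarith), abs_of_nonpos (by linarith), abs_of_nonpos (by linarith)]
    ring
  · rw [abs_of_nonneg (by linarith), abs_of_nonneg (by linarith), abs_of_nonneg (by linarith)]
    ring
  · simp

variable {f f' f'' : ℝ → ℝ}

theorem abs_sub_le_of_hasDerivWithinAt {M : ℝ} (h : ∀ x ∈ Ici (0 : ℝ), HasDerivWithinAt f (f' x) (Ici 0) x)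
    (hM : ∀ x ∈ Ici (0 : ℝ), |f' x| ≤ M) {x y : ℝ} (hx : 0 ≤ x) (hy : 0 ≤ y) :
    |f x - f y| ≤ M * |x - y| :=
  (convex_Ici (0 : ℝ)).norm_image_sub_le_of_norm_hasDerivWithin_le h hM hy hx

theorem HypF.exists_lipschitz (hf : HypF f f' f'') : ∃ M : ℝ≥0,
    LipschitzWith M (extLin f f') ∧ LipschitzWith M (extConst f') ∧
      ∀ x, |extConst f' x| ≤ M := by
  obtain ⟨M, hM⟩ := hf.bdd
  have hM0 : 0 ≤ M := (abs_nonneg _).trans (hM 0 self_mem_Ici).1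
  refine ⟨⟨M, hM0⟩, LipschitzWith.of_dist_le_mul fun x y => ?_,
    LipschitzWith.of_dist_le_mul fun x y => ?_, fun x => (hM _ (mem_Ici.2 (le_max_right _ _))).1⟩
  · have h1 := abs_sub_le_of_hasDerivWithinAt hf.hasDeriv₁ (fun x hx => (hM x hx).1)
      (le_max_right x 0) (le_max_right y 0)
    have h2 := mul_le_mul_of_nonneg_right (hM 0 self_mem_Ici).1 (abs_nonneg (min x 0 - min y 0))
    rw [← abs_mul] at h2
    rw [Real.dist_eq, Real.dist_eq, ← abs_max_sub_add_abs_min_sub x y]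
    change _ ≤ M * _
    have e : extLin f f' x - extLin f f' y =
      (f (max x 0) - f (max y 0)) + f' 0 * (min x 0 - min y 0) := by unfold extLin; ring
    rw [e, mul_add]
    exact (abs_add_le _ _).trans (add_le_add h1 h2)
  · have h1 := abs_sub_le_of_hasDerivWithinAt hf.hasDeriv₂ (fun x hx => (hM x hx).2)
      (le_max_right x 0) (le_max_right y 0)
    rw [Real.dist_eq, Real.dist_eq]
    change _ ≤ M * _
    refine h1.trans (mul_le_mul_of_nonneg_left ?_ hM0)
    have := abs_max_sub_add_abs_min_sub x y
    linarith [abs_nonneg (min x 0 - min y 0)]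

theorem HypF.extLin_zero (hf : HypF f f' f'') : extLin f f' 0 = 0 := by
  simp [extLin, hf.zero]

theorem norm_comp_sub_le {M : ℝ≥0} {φ : ℝ → ℝ} (hφ : LipschitzWith M φ) (c d : ℝ →ᵇ ℝ) :
    ‖BoundedContinuousFunction.comp φ hφ c - BoundedContinuousFunction.comp φ hφ d‖ ≤
      M * ‖c - d‖ := by
  rw [← dist_eq_norm, ← dist_eq_norm]
  exact (BoundedContinuousFunction.lipschitz_comp hφ).dist_le_mul c d

end Nonlinearity

/-- The thermoelastic model on the interval `(a,b)` with nonlinearities `φ` and `ψ`. -/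
def trigModel {a b : ℝ} (hab : a < b) {M : ℝ≥0} {φ ψ : ℝ → ℝ} (hφ : LipschitzWith M φ)
    (hψ : LipschitzWith M ψ) (hφ0 : φ 0 = 0) (hψb : ∀ x, |ψ x| ≤ M) :
    Model (L2Om a b) (ℝ →ᵇ ℝ) where
  om := omF a b
  lam := freq a b
  one_le_om := one_le_omF
  J := opJ hab
  D := opD hab
  V := sinS hab
  S := opS hab
  mul := L2Om.mul a b
  F := BoundedContinuousFunction.comp φ hφ
  F' := BoundedContinuousFunction.comp ψ hψ
  M := M
  K := agmonK a b
  M_nonneg := M.2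
  K_nonneg := agmonK_nonneg hab
  norm_sq := norm_sq_eq_opJ_opD hab
  inner_J := fun y z => inner_cosS_cosS hab _ _
  norm_V_le := norm_sinS_le hab
  agmon := fun y => by
    have h := norm_tsum_cosC_sq_le hab y
    rwa [← norm_cosS hab] at h
  norm_mul_le := L2Om.norm_mul_le
  mul_symm := L2Om.mul_symm
  F_lip := norm_comp_sub_le hφ
  F'_lip := norm_comp_sub_le hψ
  F'_le := fun c => (BoundedContinuousFunction.norm_le M.2).2 fun x => hψb _
  F_zero := by ext x; simpa using hφ0

theorem hasFDerivAt_of_norm_sub_le {E : Type*} [NormedAddCommGroup E] [NormedSpace ℝ E] {F : E → ℝ}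
    {x : E} {L : E →L[ℝ] ℝ} (h : ∀ y, |F y - F x - L (y - x)| ≤ ‖y - x‖ ^ 2) :
    HasFDerivAt F L x := by
  rw [hasFDerivAt_iff_isLittleO]
  refine Asymptotics.IsBigO.trans_isLittleO (g := fun y => ‖y - x‖ ^ 2)
    (Asymptotics.IsBigO.of_bound 1 (Eventually.of_forall fun y => ?_)) ?_
  · rw [one_mul, Real.norm_eq_abs, Real.norm_of_nonneg (by positivity)]
    exact h y
  · have h1 : Tendsto (fun y => y - x) (nhds x) (nhds 0) :=
      tendsto_sub_nhds_zero_iff.2 tendsto_id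
    exact (Asymptotics.isLittleO_norm_pow_id (n := 2) one_lt_two).comp_tendsto h1

/-- Differentiability of half the squared norm of a projection onto a convex cone. -/
theorem hasFDerivAt_half_norm_sq {E : Type*} [NormedAddCommGroup E] [InnerProductSpace ℝ E]
    {N : E → E} (h1 : ∀ f, ⟪N f, f⟫_ℝ = ‖N f‖ ^ 2) (h2 : ∀ f g, 0 ≤ ⟪N f, N g - g⟫_ℝ)
    (h3 : ∀ f g, ‖N f - N g‖ ≤ ‖f - g‖) (f : E) :
    HasFDerivAt (fun f => 1 / 2 * ‖N f‖ ^ 2) (innerSL ℝ (N f)) f := by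
  have key : ∀ f g, 0 ≤ 1 / 2 * ‖N g‖ ^ 2 - 1 / 2 * ‖N f‖ ^ 2 - ⟪N f, g - f⟫_ℝ := by
    intro f g
    have e := norm_sub_sq_real (N g) (N f)
    have e2 := h2 f g
    rw [inner_sub_right, real_inner_comm] at e2
    rw [inner_sub_right, h1]
    nlinarith [sq_nonneg ‖N g - N f‖]
  refine hasFDerivAt_of_norm_sub_le fun g => ?_
  rw [innerSL_apply_apply, abs_of_nonneg (key f g)]
  have k1 := key g f
  have k2 := real_inner_le_norm (N g - N f) (g - f)
  rw [inner_sub_left] at k2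
  have k3 := mul_le_mul_of_nonneg_right (h3 g f) (norm_nonneg (g - f))
  have k4 : ⟪N g, f - g⟫_ℝ = -⟪N g, g - f⟫_ℝ := by rw [← inner_neg_right, neg_sub]
  rw [k4] at k1
  nlinarith

theorem abs_min_zero_sub_le (s t : ℝ) : |min s 0 - min t 0| ≤ |s - t| := by
  linarith [abs_max_sub_add_abs_min_sub s t, abs_nonneg (max s 0 - max t 0)]

/-- Half the square of the negative part. -/
def halfNegSq (s : ℝ) : ℝ := 1 / 2 * min s 0 ^ 2

theorem hasDerivAt_halfNegSq (s : ℝ) : HasDerivAt halfNegSq (min s 0) s := by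
  have h := hasFDerivAt_half_norm_sq (N := fun s : ℝ => min s 0)
    (fun f => by
      rcases le_total f 0 with h | h <;> simp [h, sq])
    (fun f g => by
      simp only [RCLike.inner_apply, conj_trivial]
      exact mul_nonneg_of_nonpos_of_nonpos (by linarith [min_le_left g 0]) (min_le_right f 0))
    abs_min_zero_sub_le s
  have h' := h.hasDerivAt
  refine (h'.congr_deriv ?_).congr_of_eventuallyEq (Eventually.of_forall fun x => ?_)
  · simp [innerSL_apply_apply]
  · simp [halfNegSq]

/-- Difference quotients of `halfNegSq`. -/
def regNeg (ε s : ℝ) : ℝ := ε⁻¹ • (halfNegSq (s + ε) - halfNegSq s)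

/-- The derivative of `regNeg`. -/
def regNegDeriv (ε s : ℝ) : ℝ := ε⁻¹ * (min (s + ε) 0 - min s 0)

theorem hasDerivAt_regNeg (ε s : ℝ) : HasDerivAt (regNeg ε) (regNegDeriv ε s) s := by
  have h1 := (hasDerivAt_halfNegSq (s + ε)).comp_add_const s ε
  exact (h1.sub (hasDerivAt_halfNegSq s)).const_mul ε⁻¹

theorem abs_regNegDeriv_le {ε : ℝ} (hε : 0 < ε) (s : ℝ) : |regNegDeriv ε s| ≤ 1 := by
  rw [regNegDeriv, abs_mul, abs_of_pos (inv_pos.2 hε), inv_mul_le_one₀ hε]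
  have := abs_min_zero_sub_le (s + ε) s
  rwa [add_sub_cancel_left, abs_of_pos hε] at this

theorem lipschitzWith_regNeg {ε : ℝ} (hε : 0 < ε) : LipschitzWith 1 (regNeg ε) := by
  refine lipschitzWith_of_nnnorm_deriv_le (fun s => (hasDerivAt_regNeg ε s).differentiableAt)
    fun s => ?_
  rw [(hasDerivAt_regNeg ε s).deriv]
  exact abs_regNegDeriv_le hε s

theorem lipschitzWith_regNegDeriv {ε : ℝ} (hε : 0 < ε) :
    LipschitzWith (Real.toNNReal (2 * ε⁻¹)) (regNegDeriv ε) := by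
  refine LipschitzWith.of_dist_le_mul fun s t => ?_
  rw [Real.coe_toNNReal _ (by positivity), Real.dist_eq, Real.dist_eq]
  have h1 := abs_min_zero_sub_le (s + ε) (t + ε)
  have h2 := abs_min_zero_sub_le s t
  rw [add_sub_add_right_eq_sub] at h1
  have e : regNegDeriv ε s - regNegDeriv ε t =
      ε⁻¹ * ((min (s + ε) 0 - min (t + ε) 0) - (min s 0 - min t 0)) := by
    unfold regNegDeriv; ring
  rw [e, abs_mul, abs_of_pos (inv_pos.2 hε), mul_comm 2, mul_assoc]
  gcongr
  exact (abs_sub _ _).trans (by linarith)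

theorem regNeg_zero {ε : ℝ} (hε : 0 < ε) : regNeg ε 0 = 0 := by
  simp [regNeg, halfNegSq, hε.le]

theorem abs_regNeg_le {ε : ℝ} (hε : 0 < ε) (s : ℝ) : |regNeg ε s| ≤ |s| := by
  have := (lipschitzWith_regNeg hε).dist_le_mul s 0
  rw [regNeg_zero hε] at this
  simpa [Real.dist_eq] using this

theorem tendsto_regNeg (s : ℝ) :
    Tendsto (fun ε => regNeg ε s) (nhdsWithin 0 (Ioi 0)) (nhds (min s 0)) :=
  (hasDerivAt_halfNegSq s).tendsto_slope_zero_right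

theorem tendsto_regNegDeriv (s : ℝ) :
    Tendsto (fun ε => regNegDeriv ε s) (nhdsWithin 0 (Ioi 0)) (nhds (if s < 0 then 1 else 0)) := by
  refine tendsto_nhds_of_eventually_eq ?_
  split_ifs with h
  · filter_upwards [self_mem_nhdsWithin, nhdsWithin_le_nhds (Iio_mem_nhds (neg_pos.2 h))]
      with ε h1 h2
    have h1' : (0 : ℝ) < ε := h1
    have h2' : ε < -s := h2
    rw [regNegDeriv, min_eq_left (by linarith), min_eq_left h.le, add_sub_cancel_left,
      inv_mul_cancel₀ h1'.ne']
  · filter_upwards [self_mem_nhdsWithin] with ε h1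
    have h1' : (0 : ℝ) < ε := h1
    rw [regNegDeriv, min_eq_right (by linarith), min_eq_right (by linarith), sub_self, mul_zero]

section ChainRule

variable {a b : ℝ}

theorem truncL_eq_sum (n : ℕ) (y : SeqE) : truncL n y = ∑ k ∈ Finset.range n, y k • unitE k :=
  seq_ext fun j => by rw [sum_unitE_apply, truncL_apply]

theorem opS_unitE (hab : a < b) (k : ℕ) :
    opS hab (unitE k) = (1 / omF a b k) • cosC a b k := by
  refine (hasSum_opS hab (unitE k)).unique ?_
  have h := hasSum_single (f := fun j => invOm a b (unitE k) j • cosC a b j) k (fun j hj => by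
    simp [invOm_apply, unitE_apply, hj])
  simpa [invOm_apply, unitE_apply] using h

theorem opD_unitE (hab : a < b) (k : ℕ) :
    opD hab (unitE k) = -(freq a b k / omF a b k) • sinL a b k := by
  rcases k with _ | k
  · refine eq_of_inner_sinL hab fun j => ?_
    rw [inner_opD, unitE_apply]
    split_ifs with h
    · rw [h, freq_zero]; simp
    · rw [freq_zero]; simp
  · have h1 : freqOm a b (unitE (k + 1)) = (freq a b (k + 1) / omF a b (k + 1)) • unitE (k + 1) := by
      refine seq_ext fun j => ?_
      rw [freqOm_apply, seq_smul, unitE_apply]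
      split_ifs with h
      · rw [h]
      · simp
    have h2 : shiftL (unitE (k + 1)) = unitE k := by
      refine seq_ext fun j => ?_
      rw [shiftL_apply, unitE_apply, unitE_apply]
      simp
    have h3 : sinS hab (unitE (k + 1)) = sinL a b (k + 1) := by
      rw [sinS_apply, h2, ← sinBasis_apply hab, unitE]
      exact HilbertBasis.repr_symm_single _ _
    rw [opD_apply, h1, map_smul, h3, neg_smul]

theorem inner_chain_truncL (hab : a < b) {φ φ' : ℝ → ℝ} {K K' : ℝ≥0} (hφ : LipschitzWith K φ)
    (hφ' : LipschitzWith K' φ') (h : ∀ s, HasDerivAt φ (φ' s) s) (y : SeqE) (n k : ℕ) :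
    ⟪L2Om.mul a b (BoundedContinuousFunction.comp φ' hφ' (opS hab (truncL n y)))
      (opD hab (truncL n y)), sinL a b k⟫_ℝ =
      -(freq a b k * ⟪L2Om.ofBCF a b (BoundedContinuousFunction.comp φ hφ (opS hab (truncL n y))),
        cosL a b k⟫_ℝ) := by
  obtain ⟨Y, hY⟩ : ∃ Y, Y = opS hab (truncL n y) := ⟨_, rfl⟩
  obtain ⟨Z, hZ⟩ : ∃ Z : ℝ →ᵇ ℝ, Z = ∑ j ∈ Finset.range n, y j •
    (-(freq a b j / omF a b j) • sinC a b j) := ⟨_, rfl⟩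
  have hYs : Y = ∑ j ∈ Finset.range n, y j • ((1 / omF a b j) • cosC a b j) := by
    rw [hY, truncL_eq_sum, map_sum]
    exact Finset.sum_congr rfl fun j _ => by rw [map_smul, opS_unitE]
  have hD : opD hab (truncL n y) = L2Om.ofBCF a b Z := by
    rw [hZ, truncL_eq_sum, map_sum, map_sum]
    exact Finset.sum_congr rfl fun j _ => by rw [map_smul, opD_unitE, map_smul, map_smul, sinL]
  have hder : ∀ x, HasDerivAt Y (Z x) x := by
    intro x
    have h1 : HasDerivAt (fun x => ∑ j ∈ Finset.range n, y j * ((1 / omF a b j) * cosC a b j x))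
        (∑ j ∈ Finset.range n, y j * ((1 / omF a b j) * -(freq a b j * sinC a b j x))) x :=
      HasDerivAt.fun_sum fun j _ => ((hasDerivAt_cosC j x).const_mul _).const_mul _
    refine (h1.congr_deriv ?_).congr_of_eventuallyEq (Eventually.of_forall fun t => ?_)
    · rw [hZ, BoundedContinuousFunction.sum_apply]
      refine Finset.sum_congr rfl fun j _ => ?_
      simp only [BoundedContinuousFunction.coe_smul, smul_eq_mul]
      ring
    · rw [hYs, BoundedContinuousFunction.sum_apply]
      rfl
  have hu : ∀ x, HasDerivAt (fun x => φ (Y x) * sinC a b k x)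
      (φ' (Y x) * Z x * sinC a b k x + φ (Y x) * (freq a b k * cosC a b k x)) x := fun x =>
    (((h (Y x)).comp x (hder x)).mul (hasDerivAt_sinC k x))
  have hc1 : Continuous φ := hφ.continuous
  have hc2 : Continuous φ' := hφ'.continuous
  have i1 : Continuous fun x => φ' (Y x) * Z x * sinC a b k x := by fun_prop
  have i2 : Continuous fun x => φ (Y x) * (freq a b k * cosC a b k x) := by fun_prop
  have hint := intervalIntegral.integral_eq_sub_of_hasDerivAt (a := a) (b := b) (fun x _ => hu x)
    ((i1.add i2).intervalIntegrable _ _)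
  rw [sinC_left, sinC_right hab, intervalIntegral.integral_add (i1.intervalIntegrable _ _)
    (i2.intervalIntegrable _ _), ← setIntegral_Ioo_eq hab.le, ← setIntegral_Ioo_eq hab.le] at hint
  rw [← hY, hD]
  have e1 : L2Om.mul a b (BoundedContinuousFunction.comp φ' hφ' Y) (L2Om.ofBCF a b Z)
      =ᵐ[volume.restrict (Ioo a b)] fun x => φ' (Y x) * Z x := by
    filter_upwards [L2Om.coeFn_mul (BoundedContinuousFunction.comp φ' hφ' Y) (L2Om.ofBCF a b Z),
      L2Om.coeFn_ofBCF (a := a) (b := b) Z] with x h1 h2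
    rw [h1, h2]; rfl
  rw [sinL, cosL, L2Om.inner_eq_of_ae e1 (L2Om.coeFn_ofBCF _),
    L2Om.inner_eq_of_ae (L2Om.coeFn_ofBCF _) (L2Om.coeFn_ofBCF _), ← integral_const_mul]
  have e2 : ∀ x, freq a b k * (BoundedContinuousFunction.comp φ hφ Y x * cosC a b k x) =
    φ (Y x) * (freq a b k * cosC a b k x) := fun x => by
      rw [BoundedContinuousFunction.comp_apply]; ring
  simp_rw [e2]
  linarith

/-- The weak chain rule. -/
theorem inner_chain (hab : a < b) {φ φ' : ℝ → ℝ} {K K' : ℝ≥0} (hφ : LipschitzWith K φ)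
    (hφ' : LipschitzWith K' φ') (h : ∀ s, HasDerivAt φ (φ' s) s) (y : SeqE) (k : ℕ) :
    ⟪L2Om.mul a b (BoundedContinuousFunction.comp φ' hφ' (opS hab y)) (opD hab y), sinL a b k⟫_ℝ =
      -(freq a b k * ⟪L2Om.ofBCF a b (BoundedContinuousFunction.comp φ hφ (opS hab y)),
        cosL a b k⟫_ℝ) := by
  have c1 : Continuous fun y => BoundedContinuousFunction.comp φ hφ (opS hab y) :=
    (BoundedContinuousFunction.lipschitz_comp hφ).continuous.comp (opS hab).continuous
  have c2 : Continuous fun y => BoundedContinuousFunction.comp φ' hφ' (opS hab y) :=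
    (BoundedContinuousFunction.lipschitz_comp hφ').continuous.comp (opS hab).continuous
  have t := tendsto_truncL y
  have c3 : Continuous fun y => ⟪L2Om.mul a b (BoundedContinuousFunction.comp φ' hφ' (opS hab y))
      (opD hab y), sinL a b k⟫_ℝ :=
    ((((L2Om.mul a b).continuous.comp c2).clm_apply (opD hab).continuous).inner continuous_const)
  have c4 : Continuous fun y =>
      -(freq a b k * ⟪L2Om.ofBCF a b (BoundedContinuousFunction.comp φ hφ (opS hab y)),
        cosL a b k⟫_ℝ) :=
    ((((L2Om.ofBCF a b).continuous.comp c1).inner continuous_const).const_mul _).neg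
  refine tendsto_nhds_unique ((c3.tendsto y).comp t) (((c4.tendsto y).comp t).congr fun n => ?_)
  exact (inner_chain_truncL hab hφ hφ' h y n k).symm

end ChainRule

section NegativePart

variable {a b : ℝ}

theorem lipschitzWith_min_zero : LipschitzWith 1 fun s : ℝ => min s 0 :=
  LipschitzWith.of_dist_le_mul fun s t => by
    rw [NNReal.coe_one, one_mul]; exact abs_min_zero_sub_le s t

namespace L2Om

/-- The nonpositive part `min f 0`. -/
def negPt (f : L2Om a b) : L2Om a b := lipschitzWith_min_zero.compLp (by simp) f

theorem coeFn_negPt (f : L2Om a b) :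
    negPt f =ᵐ[volume.restrict (Ioo a b)] fun x => min (f x) 0 :=
  lipschitzWith_min_zero.coeFn_compLp _ f

theorem inner_negPt_self (f : L2Om a b) : ⟪negPt f, f⟫_ℝ = ‖negPt f‖ ^ 2 := by
  rw [← real_inner_self_eq_norm_sq, inner_eq_of_ae (coeFn_negPt f) (ae_eq_refl _),
    inner_eq_of_ae (coeFn_negPt f) (coeFn_negPt f)]
  refine integral_congr_ae (Eventually.of_forall fun x => ?_)
  rcases le_total (f x) 0 with h | h <;> simp [h]

theorem inner_negPt_sub_nonneg (f g : L2Om a b) : 0 ≤ ⟪negPt f, negPt g - g⟫_ℝ := by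
  have h : (negPt g - g : L2Om a b) =ᵐ[volume.restrict (Ioo a b)] fun x => min (g x) 0 - g x := by
    filter_upwards [Lp.coeFn_sub (negPt g) g, coeFn_negPt g] with x h1 h2
    rw [h1, Pi.sub_apply, h2]
  rw [inner_eq_of_ae (coeFn_negPt f) h]
  refine integral_nonneg fun x => mul_nonneg_of_nonpos_of_nonpos (min_le_right _ _) ?_
  simp

theorem norm_negPt_sub_le (f g : L2Om a b) : ‖negPt f - negPt g‖ ≤ ‖f - g‖ := by
  have := lipschitzWith_min_zero.norm_compLp_sub_le (by simp) f g
  rwa [NNReal.coe_one, one_mul] at this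

theorem nonneg_of_negPt_eq_zero {f : L2Om a b} (h : negPt f = 0) :
    ∀ᵐ x ∂volume.restrict (Ioo a b), 0 ≤ f x := by
  have h0 : negPt f =ᵐ[volume.restrict (Ioo a b)] 0 := by rw [h]; exact Lp.coeFn_zero _ _ _
  filter_upwards [coeFn_negPt f, h0] with x h1 h2
  rw [h1] at h2
  exact min_eq_right_iff.1 h2

theorem negPt_eq_zero {f : L2Om a b} (h : ∀ᵐ x ∂volume.restrict (Ioo a b), 0 ≤ f x) :
    negPt f = 0 := by
  refine Lp.ext ?_
  filter_upwards [coeFn_negPt f, h, Lp.coeFn_zero ℝ 2 (volume.restrict (Ioo a b))] with x h1 h2 h3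
  rw [h1, h3, min_eq_right h2]; rfl

end L2Om

theorem exists_indicator (c : ℝ →ᵇ ℝ) (f : L2Om a b) :
    ∃ g : L2Om a b, g =ᵐ[volume.restrict (Ioo a b)] fun x => (if c x < 0 then 1 else 0) * f x := by
  have hm : MeasurableSet {x | c x < 0} :=
    (isOpen_lt c.continuous continuous_const).measurableSet
  refine ⟨((Lp.memLp f).indicator hm).toLp _, ?_⟩
  filter_upwards [((Lp.memLp f).indicator hm).coeFn_toLp] with x hx
  rw [hx, Set.indicator_apply]
  simp only [mem_ofPred_eq]
  split_ifs <;> simp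

theorem exists_negPt_coordinates (hab : a < b) (y : SeqE) :
    ∃ χ, opJ hab χ = L2Om.negPt (opJ hab y) ∧ opD hab χ =ᵐ[volume.restrict (Ioo a b)]
      fun x => (if opS hab y x < 0 then 1 else 0) * opD hab y x := by
  obtain ⟨g, hg⟩ := exists_indicator (opS hab y) (opD hab y)
  suffices h : ∃ χ, opJ hab χ = L2Om.negPt (opJ hab y) ∧ opD hab χ = g by
    obtain ⟨χ, h1, h2⟩ := h
    exact ⟨χ, h1, h2 ▸ hg⟩
  refine exists_coordinates hab _ _ fun k => ?_
  have hN : L2Om.negPt (opJ hab y) =ᵐ[volume.restrict (Ioo a b)]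
      fun x => min (opS hab y x) 0 := by
    filter_upwards [L2Om.coeFn_negPt (opJ hab y), coeFn_opJ hab y] with x h1 h2
    rw [h1, h2]
  rw [sinL, cosL, L2Om.inner_eq_of_ae hg (L2Om.coeFn_ofBCF _),
    L2Om.inner_eq_of_ae hN (L2Om.coeFn_ofBCF _)]
  have hi := L2Om.integrable_mul_bcf (opD hab y) (sinC a b k)
  have hj : IntegrableOn (fun x => opS hab y x * cosC a b k x) (Ioo a b) := by
    refine (L2Om.integrable_mul_bcf (opJ hab y) (cosC a b k)).congr ?_
    filter_upwards [coeFn_opJ hab y] with x hx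
    rw [hx]
  have t1 : Tendsto (fun ε => ∫ x in Ioo a b, regNegDeriv ε (opS hab y x) * opD hab y x *
      sinC a b k x) (nhdsWithin 0 (Ioi 0)) (nhds (∫ x in Ioo a b,
        (if opS hab y x < 0 then 1 else 0) * opD hab y x * sinC a b k x)) := by
    refine tendsto_integral_filter_of_dominated_convergence
      (fun x => ‖opD hab y x * sinC a b k x‖) ?_ ?_ hi.norm ?_
    · filter_upwards [self_mem_nhdsWithin] with ε hε
      have hc : Continuous (regNegDeriv ε) := (lipschitzWith_regNegDeriv hε).continuous
      exact (((hc.comp (opS hab y).continuous).aestronglyMeasurable).mul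
        (Lp.aestronglyMeasurable _)).mul (sinC a b k).continuous.aestronglyMeasurable
    · filter_upwards [self_mem_nhdsWithin] with ε hε
      refine Eventually.of_forall fun x => ?_
      rw [mul_assoc, norm_mul]
      exact mul_le_of_le_one_left (norm_nonneg _) (abs_regNegDeriv_le hε _)
    · exact Eventually.of_forall fun x => ((tendsto_regNegDeriv _).mul_const _).mul_const _
  have t2 : Tendsto (fun ε => -(freq a b k * ∫ x in Ioo a b, regNeg ε (opS hab y x) *
      cosC a b k x)) (nhdsWithin 0 (Ioi 0)) (nhds (-(freq a b k * ∫ x in Ioo a b,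
        min (opS hab y x) 0 * cosC a b k x))) := by
    refine (Tendsto.const_mul _ ?_).neg
    refine tendsto_integral_filter_of_dominated_convergence
      (fun x => ‖opS hab y x * cosC a b k x‖) ?_ ?_ hj.norm ?_
    · filter_upwards [self_mem_nhdsWithin] with ε hε
      have hc : Continuous (regNeg ε) := (lipschitzWith_regNeg hε).continuous
      exact ((hc.comp (opS hab y).continuous).aestronglyMeasurable).mul
        (cosC a b k).continuous.aestronglyMeasurable
    · filter_upwards [self_mem_nhdsWithin] with ε hε
      refine Eventually.of_forall fun x => ?_
      rw [norm_mul, norm_mul]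
      exact mul_le_mul_of_nonneg_right (abs_regNeg_le hε _) (norm_nonneg _)
    · exact Eventually.of_forall fun x => (tendsto_regNeg _).mul_const _
  refine tendsto_nhds_unique t1 (t2.congr' ?_)
  filter_upwards [self_mem_nhdsWithin] with ε hε
  have h := inner_chain hab (lipschitzWith_regNeg hε) (lipschitzWith_regNegDeriv hε)
    (hasDerivAt_regNeg ε) y k
  rw [sinL, cosL, L2Om.inner_eq_of_ae (L2Om.coeFn_mul _ _) (L2Om.coeFn_ofBCF _),
    L2Om.inner_eq_of_ae (L2Om.coeFn_ofBCF _) (L2Om.coeFn_ofBCF _)] at h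
  simpa only [BoundedContinuousFunction.comp_apply] using h.symm

/-- Coordinates of the nonpositive part. -/
def negCoord (hab : a < b) (y : SeqE) : SeqE := (exists_negPt_coordinates hab y).choose

theorem opJ_negCoord (hab : a < b) (y : SeqE) :
    opJ hab (negCoord hab y) = L2Om.negPt (opJ hab y) :=
  (exists_negPt_coordinates hab y).choose_spec.1

theorem coeFn_opD_negCoord (hab : a < b) (y : SeqE) :
    opD hab (negCoord hab y) =ᵐ[volume.restrict (Ioo a b)]
      fun x => (if opS hab y x < 0 then 1 else 0) * opD hab y x :=
  (exists_negPt_coordinates hab y).choose_spec.2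

theorem opS_negCoord_ae (hab : a < b) (y : SeqE) :
    ∀ᵐ x ∂volume.restrict (Ioo a b), opS hab (negCoord hab y) x = min (opS hab y x) 0 := by
  filter_upwards [coeFn_opJ hab (negCoord hab y), coeFn_opJ hab y,
    L2Om.coeFn_negPt (opJ hab y)] with x h1 h2 h3
  rw [← h1, opJ_negCoord, h3, h2]

theorem inner_opJ_add_inner_opD (hab : a < b) (y z : SeqE) :
    ⟪y, z⟫_ℝ = ⟪opJ hab y, opJ hab z⟫_ℝ + ⟪opD hab y, opD hab z⟫_ℝ := by
  have h1 := norm_sq_eq_opJ_opD hab (y + z)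
  have h2 := norm_sq_eq_opJ_opD hab y
  have h3 := norm_sq_eq_opJ_opD hab z
  rw [map_add, map_add, norm_add_sq_real, norm_add_sq_real, norm_add_sq_real] at h1
  linarith

theorem inner_negCoord (hab : a < b) (y : SeqE) :
    ⟪y, negCoord hab y⟫_ℝ = ‖negCoord hab y‖ ^ 2 := by
  rw [inner_opJ_add_inner_opD hab, norm_sq_eq_opJ_opD hab, opJ_negCoord, real_inner_comm,
    L2Om.inner_negPt_self, ← real_inner_self_eq_norm_sq (opD hab _),
    L2Om.inner_eq_of_ae (ae_eq_refl _) (coeFn_opD_negCoord hab y),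
    L2Om.inner_eq_of_ae (coeFn_opD_negCoord hab y) (coeFn_opD_negCoord hab y)]
  congr 1
  refine integral_congr_ae (Eventually.of_forall fun x => ?_)
  dsimp only
  split_ifs <;> simp

theorem mul_opS_negCoord (hab : a < b) (y : SeqE) (c : ℝ →ᵇ ℝ) :
    L2Om.mul a b (opS hab (negCoord hab y)) (L2Om.mul a b c (opD hab y)) =
      L2Om.mul a b c (L2Om.mul a b (opS hab (negCoord hab y)) (opD hab (negCoord hab y))) := by
  refine Lp.ext ?_
  filter_upwards [L2Om.coeFn_mul (opS hab (negCoord hab y)) (L2Om.mul a b c (opD hab y)),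
    L2Om.coeFn_mul c (opD hab y), L2Om.coeFn_mul c (L2Om.mul a b (opS hab (negCoord hab y))
      (opD hab (negCoord hab y))),
    L2Om.coeFn_mul (opS hab (negCoord hab y)) (opD hab (negCoord hab y)),
    coeFn_opD_negCoord hab y, opS_negCoord_ae hab y] with x h1 h2 h3 h4 h5 h6
  rw [h1, h2, h3, h4, h5, h6]
  split_ifs with h
  · ring
  · rw [min_eq_right (not_lt.1 h)]; ring

theorem mul_comp_opS_negCoord (hab : a < b) (y : SeqE) {φ : ℝ → ℝ} {M : ℝ≥0}
    (hφ : LipschitzWith M φ) :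
    L2Om.mul a b (BoundedContinuousFunction.comp φ hφ (opS hab y)) (opD hab (negCoord hab y)) =
      L2Om.mul a b (BoundedContinuousFunction.comp φ hφ (opS hab (negCoord hab y)))
        (opD hab (negCoord hab y)) := by
  refine Lp.ext ?_
  filter_upwards [L2Om.coeFn_mul (BoundedContinuousFunction.comp φ hφ (opS hab y))
      (opD hab (negCoord hab y)),
    L2Om.coeFn_mul (BoundedContinuousFunction.comp φ hφ (opS hab (negCoord hab y)))
      (opD hab (negCoord hab y)),
    coeFn_opD_negCoord hab y, opS_negCoord_ae hab y] with x h1 h2 h3 h4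
  rw [h1, h2, h3, BoundedContinuousFunction.comp_apply, BoundedContinuousFunction.comp_apply, h4]
  split_ifs with h
  · rw [min_eq_left h.le]
  · simp

theorem opS_unitE_zero (hab : a < b) (x : ℝ) : opS hab (unitE 0) x = √(1 / (b - a)) := by
  rw [opS_unitE, omF_zero]
  simp [cosC_apply, freq_zero]

theorem apply_zero_eq_integral (hab : a < b) (x : SeqE) :
    x 0 = √(1 / (b - a)) * ∫ z in Ioo a b, cosS hab x z := by
  rw [← inner_cosS hab, cosL, L2Om.inner_ofBCF, ← integral_const_mul]
  refine integral_congr_ae (Eventually.of_forall fun z => ?_)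
  simp [cosC_apply, freq_zero, mul_comm]

/-- The positivity structure of the thermoelastic model. -/
def trigPositivity {a b : ℝ} (hab : a < b) {M : ℝ≥0} {φ ψ : ℝ → ℝ} (hφ : LipschitzWith M φ)
    (hψ : LipschitzWith M ψ) (hφ0 : φ 0 = 0) (hψb : ∀ x, |ψ x| ≤ M) :
    (trigModel hab hφ hψ hφ0 hψb).Positivity where
  g := fun θ => (cosBasis hab).repr (L2Om.negPt (cosS hab θ))
  χ := negCoord hab
  s₀ := √(1 / (b - a))
  s₀_pos := Real.sqrt_pos.2 (one_div_pos.2 (sub_pos.2 hab))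
  om_zero := omF_zero
  hasFDerivAt := by
    have h : ∀ f g : SeqE, ⟪(cosBasis hab).repr (L2Om.negPt (cosS hab f)), g⟫_ℝ =
        ⟪L2Om.negPt (cosS hab f), cosS hab g⟫_ℝ := fun f g => by
      rw [← inner_cosS_cosS hab, cosS_repr]
    refine hasFDerivAt_half_norm_sq (fun f => ?_) (fun f g => ?_) (fun f g => ?_)
    · rw [h, LinearIsometryEquiv.norm_map, L2Om.inner_negPt_self]
    · rw [h, map_sub, cosS_repr]
      exact L2Om.inner_negPt_sub_nonneg _ _
    · rw [← map_sub, LinearIsometryEquiv.norm_map]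
      refine (L2Om.norm_negPt_sub_le _ _).trans ?_
      rw [← map_sub, norm_cosS]
  cont_g := (cosBasis hab).repr.continuous.comp
    ((lipschitzWith_min_zero.continuous_compLp (by simp)).comp (cosS hab).continuous)
  inner_g := fun θ => by
    rw [← inner_cosS_cosS hab, cosS_repr, LinearIsometryEquiv.norm_map, real_inner_comm,
      L2Om.inner_negPt_self]
  χ_apply := fun y k => by
    change negCoord hab y k = omF a b k * (cosBasis hab).repr (L2Om.negPt (opJ hab y)) k
    rw [cosBasis_repr_apply, ← opJ_negCoord, inner_opJ]
    have := (omF_pos (a := a) (b := b) k).ne'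
    field_simp
  inner_χ := inner_negCoord hab
  A_χ := fun y v => by
    change |⟪L2Om.mul a b (BoundedContinuousFunction.comp ψ hψ (opS hab y)) (opD hab y),
      L2Om.mul a b (opS hab (negCoord hab y)) (sinS hab v)⟫_ℝ| ≤
        M * ‖opS hab (negCoord hab y)‖ * ‖negCoord hab y‖ * ‖v‖
    rw [← L2Om.mul_symm, mul_opS_negCoord]
    refine (abs_real_inner_le_norm _ _).trans ?_
    have h1 := norm_sinS_le hab v
    have h2 := (trigModel hab hφ hψ hφ0 hψb).norm_D_le (negCoord hab y)
    gcongr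
    refine (L2Om.norm_mul_le _ _).trans ?_
    rw [mul_assoc]
    gcongr
    · exact (trigModel hab hφ hψ hφ0 hψb).F'_le _
    · refine (L2Om.norm_mul_le _ _).trans ?_
      gcongr
      exact h2
  F_χ := fun y v => by
    change |⟪L2Om.mul a b (BoundedContinuousFunction.comp φ hφ (opS hab y)) (sinS hab v),
      opD hab (negCoord hab y)⟫_ℝ| ≤ M * ‖opS hab (negCoord hab y)‖ * ‖negCoord hab y‖ * ‖v‖
    rw [L2Om.mul_symm, mul_comp_opS_negCoord, real_inner_comm]
    refine (abs_real_inner_le_norm _ _).trans ?_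
    have h1 := norm_sinS_le hab v
    have h2 := (trigModel hab hφ hψ hφ0 hψb).norm_D_le (negCoord hab y)
    gcongr
    refine (L2Om.norm_mul_le _ _).trans ?_
    gcongr
    · exact (trigModel hab hφ hψ hφ0 hψb).norm_F_le _
    · exact h2
  D_zero := by
    change opD hab (unitE 0) = 0
    rw [opD_unitE, freq_zero]; simp
  mul_S_zero := fun p => by
    change L2Om.mul a b (opS hab (unitE 0)) p = √(1 / (b - a)) • p
    refine Lp.ext ?_
    filter_upwards [L2Om.coeFn_mul (opS hab (unitE 0)) p, Lp.coeFn_smul √(1 / (b - a)) p]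
      with x h1 h2
    rw [h1, h2, opS_unitE_zero]; rfl
  nonneg_of_g := fun θ h => by
    have h1 := L2Om.nonneg_of_negPt_eq_zero ((LinearIsometryEquiv.map_eq_zero_iff _).1 h)
    rw [apply_zero_eq_integral hab]
    exact mul_nonneg (Real.sqrt_nonneg _) (integral_nonneg_of_ae h1)
  interp := fun y h => by
    change (cosBasis hab).repr (L2Om.negPt (opJ hab y)) = 0 at h
    have h1 := L2Om.nonneg_of_negPt_eq_zero ((LinearIsometryEquiv.map_eq_zero_iff _).1 h)
    have h2 := apply_zero_eq_integral hab (invOm a b y)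
    rw [invOm_apply, omF_zero, one_div_one, one_mul, ← opJ_apply] at h2
    change ‖opJ hab y‖ ^ 2 ≤ y 0 / √(1 / (b - a)) * ‖opS hab y‖
    have h0 : 0 < √(1 / (b - a)) := Real.sqrt_pos.2 (one_div_pos.2 (sub_pos.2 hab))
    rw [h2, mul_div_cancel_left₀ _ h0.ne', ← real_inner_self_eq_norm_sq,
      L2Om.inner_eq_of_ae (ae_eq_refl _) (coeFn_opJ hab y), ← integral_mul_const]
    have hi : IntegrableOn (fun x => opJ hab y x) (Ioo a b) := by
      have := L2Om.integrable_mul_bcf (opJ hab y) (BoundedContinuousFunction.const ℝ 1)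
      simpa using this
    refine integral_mono_ae (L2Om.integrable_mul_bcf _ _) (hi.mul_const _) ?_
    filter_upwards [h1] with x hx
    have h3 := (opS hab y).norm_coe_le_norm x
    rw [Real.norm_eq_abs] at h3
    exact mul_le_mul_of_nonneg_left ((le_abs_self _).trans h3) hx

end NegativePart

section JointRepresentative

variable {a b : ℝ}

theorem tendsto_difference_quotient {F : ℝ → ℝ} {x d : ℝ} (h : HasDerivAt F d x) :
    Tendsto (fun n : ℕ => ((n : ℝ) + 1) * (F (x + 1 / ((n : ℝ) + 1)) - F x)) atTop (nhds d) := by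
  have h1 := hasDerivAt_iff_tendsto_slope_zero.1 h
  have h2 : Tendsto (fun n : ℕ => 1 / ((n : ℝ) + 1)) atTop (nhdsWithin 0 {0}ᶜ) :=
    tendsto_nhdsWithin_iff.2 ⟨tendsto_one_div_add_atTop_nhds_zero_nat,
      Eventually.of_forall fun n => by
        simp only [mem_compl_iff, mem_singleton_iff]
        positivity⟩
  refine (h1.comp h2).congr fun n => ?_
  simp

theorem L2Om.integrableOn (f : L2Om a b) : IntegrableOn (fun x => f x) (Ioo a b) := by
  have := L2Om.integrable_mul_bcf f (BoundedContinuousFunction.const ℝ 1)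
  simpa using this

/-- A strongly measurable curve in `L²(a,b)` has a jointly measurable representative. -/
theorem exists_joint_representative {g : ℝ → L2Om a b} (hg : StronglyMeasurable g) :
    ∃ r : ℝ → ℝ → ℝ, StronglyMeasurable (uncurry r) ∧
      ∀ t, (fun x => r x t) =ᵐ[volume.restrict (Ioo a b)] g t := by
  have hint : ∀ t, Integrable ((Ioo a b).indicator (g t)) volume := fun t =>
    (integrable_indicator_iff measurableSet_Ioo).2 (L2Om.integrableOn (g t))
  obtain ⟨G, hG⟩ : ∃ G : ℝ → ℝ → ℝ, ∀ x t, G x t = ∫ s in Iic x, (Ioo a b).indicator (g t) s :=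
    ⟨_, fun _ _ => rfl⟩
  have hGd : ∀ t x, G x t = G 0 t + ∫ s in (0 : ℝ)..x, (Ioo a b).indicator (g t) s := by
    intro t x
    rw [hG, hG, ← intervalIntegral.integral_Iic_sub_Iic (hint t).integrableOn (hint t).integrableOn]
    ring
  have hGc : ∀ t, Continuous fun x => G x t := by
    intro t
    rw [show (fun x => G x t) = fun x => G 0 t + ∫ s in (0 : ℝ)..x, (Ioo a b).indicator (g t) s from
      funext (hGd t)]
    exact continuous_const.add (intervalIntegral.continuous_primitive
      (fun _ _ => (hint t).intervalIntegrable) 0)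
  have hGm : ∀ x, StronglyMeasurable (G x) := by
    intro x
    have e : G x = fun t => ⟪indicatorConstLp 2 (μ := volume.restrict (Ioo a b))
        (measurableSet_Iic (a := x)) (measure_ne_top _ _) (1 : ℝ), g t⟫_ℝ := by
      funext t
      rw [L2.inner_indicatorConstLp_one, hG, integral_indicator measurableSet_Ioo,
        Measure.restrict_restrict measurableSet_Ioo, Measure.restrict_restrict measurableSet_Iic,
        inter_comm]
    rw [e]
    exact stronglyMeasurable_const.inner hg
  have hGu : StronglyMeasurable (uncurry G) :=
    stronglyMeasurable_uncurry_of_continuous_of_stronglyMeasurable hGc hGm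
  refine ⟨fun x t => limUnder atTop fun n : ℕ =>
    ((n : ℝ) + 1) * (G (x + 1 / ((n : ℝ) + 1)) t - G x t), ?_, fun t => ?_⟩
  · refine StronglyMeasurable.limUnder
      (f := fun (n : ℕ) (p : ℝ × ℝ) => ((n : ℝ) + 1) * (G (p.1 + 1 / ((n : ℝ) + 1)) p.2 - G p.1 p.2))
      fun n => ?_
    have h1 : Measurable fun p : ℝ × ℝ => (p.1 + 1 / ((n : ℝ) + 1), p.2) := by fun_prop
    exact (hGu.comp_measurable h1 |>.sub hGu).const_mul _
  · have h1 := ae_restrict_of_ae (s := Ioo a b)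
      (LocallyIntegrable.ae_hasDerivAt_integral (hint t).locallyIntegrable)
    filter_upwards [h1, ae_restrict_mem measurableSet_Ioo] with x hx hxm
    have h2 : HasDerivAt (fun x => G x t) (g t x) x := by
      have := (hx 0).const_add (G 0 t)
      rw [indicator_of_mem hxm] at this
      rwa [← show (fun x => G x t) = fun x => G 0 t + ∫ s in (0 : ℝ)..x, (Ioo a b).indicator (g t) s
        from funext (hGd t)] at this
    exact (tendsto_difference_quotient h2).limUnder_eq

end JointRepresentative

section Slices

variable {a b T : ℝ}

/-- `r` is a jointly measurable representative on `(a,b) × (0,T)` of the square integrable curve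
`g` in `L²(a,b)`. -/
structure IsRep (a b T : ℝ) (r : ℝ → ℝ → ℝ) (g : ℝ → L2Om a b) : Prop where
  meas : AEStronglyMeasurable (uncurry r) (volume.restrict (Ioo a b ×ˢ Ioo 0 T))
  slice : ∀ᵐ t ∂volume.restrict (Ioo 0 T),
    (fun x => r x t) =ᵐ[volume.restrict (Ioo a b)] g t
  mem : L2T T g

theorem volume_restrict_prod (s t : Set ℝ) : (volume : Measure (ℝ × ℝ)).restrict (s ×ˢ t) =
    (volume.restrict s).prod (volume.restrict t) := by
  rw [Measure.volume_eq_prod, Measure.prod_restrict]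

namespace IsRep

variable {r q : ℝ → ℝ → ℝ} {g h : ℝ → L2Om a b}

theorem integrable_sq (hr : IsRep a b T r g) :
    IntegrableOn (fun p : ℝ × ℝ => r p.1 p.2 ^ 2) (Ioo a b ×ˢ Ioo 0 T) := by
  have hm := hr.meas
  rw [volume_restrict_prod] at hm
  rw [IntegrableOn, volume_restrict_prod, integrable_prod_iff' (f := fun p : ℝ × ℝ => r p.1 p.2 ^ 2) (hm.pow 2)]
  refine ⟨?_, ?_⟩
  · filter_upwards [hr.slice] with t ht
    refine (L2Om.integrable_mul (g t) (g t)).congr ?_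
    filter_upwards [ht] with x hx
    rw [← hx, sq]
  · have := hr.mem.integrable_norm_pow two_ne_zero
    rw [← IntegrableOn, integrableOn_Ioc_iff_integrableOn_Ioo] at this
    refine this.congr ?_
    filter_upwards [hr.slice] with t ht
    rw [← real_inner_self_eq_norm_sq, L2Om.inner_eq]
    refine integral_congr_ae ?_
    filter_upwards [ht] with x hx
    rw [← hx]
    simp [sq]

theorem memLp (hr : IsRep a b T r g) :
    MemLp (uncurry r) 2 (volume.restrict (Ioo a b ×ˢ Ioo 0 T)) :=
  (memLp_two_iff_integrable_sq hr.meas).2 hr.integrable_sq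

theorem integrable_mul (hr : IsRep a b T r g) (hq : IsRep a b T q h) :
    IntegrableOn (fun p : ℝ × ℝ => r p.1 p.2 * q p.1 p.2) (Ioo a b ×ˢ Ioo 0 T) :=
  hr.memLp.integrable_mul hq.memLp

theorem integrable (hr : IsRep a b T r g) :
    IntegrableOn (fun p : ℝ × ℝ => r p.1 p.2) (Ioo a b ×ˢ Ioo 0 T) := by
  have : IsFiniteMeasure ((volume : Measure (ℝ × ℝ)).restrict (Ioo a b ×ˢ Ioo 0 T)) := by
    rw [volume_restrict_prod]
    infer_instance
  exact hr.memLp.integrable one_le_two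

theorem intOmT_mul (hT : 0 ≤ T) (hr : IsRep a b T r g) (hq : IsRep a b T q h) :
    intOmT a b T (fun x t => r x t * q x t) = ∫ t in (0 : ℝ)..T, ⟪g t, h t⟫_ℝ := by
  have hi := hr.integrable_mul hq
  rw [IntegrableOn, volume_restrict_prod] at hi
  rw [intOmT, volume_restrict_prod, integral_prod_symm _ hi,
    intervalIntegral.integral_of_le hT, integral_Ioc_eq_integral_Ioo]
  refine integral_congr_ae ?_
  filter_upwards [hr.slice, hq.slice] with t h1 h2
  exact (L2Om.inner_eq_of_ae h1.symm h2.symm).symm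

theorem congr_curve (hr : IsRep a b T r g)
    (hgh : ∀ᵐ t ∂volume.restrict (Ioc 0 T), g t = h t) :
    IsRep a b T r h := by
  refine ⟨hr.meas, ?_, (memLp_congr_ae hgh).1 hr.mem⟩
  filter_upwards [hr.slice, ae_restrict_of_ae_restrict_of_subset Ioo_subset_Ioc_self hgh] with t h2 h3
  rwa [← h3]

end IsRep

end Slices

theorem IsPrim.of_coord {T : ℝ} {X r : ℝ → SeqE} (hr : IntervalIntegrable r volume 0 T)
    (h : ∀ k, IsPrim T (fun t => X t k) (fun t => r t k)) : IsPrim T X r := by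
  refine ⟨hr, fun t ht => seq_ext fun k => ?_⟩
  have h1 := (h k).2 t ht
  beta_reduce at h1
  rw [seq_add, h1, ← coordL_apply k (∫ s in (0 : ℝ)..t, r s),
    ← (coordL k).intervalIntegral_comp_comm (hr.sub_right ht)]
  rfl

section WeakEquations

variable {a b T : ℝ}

theorem sinS_unitE (hab : a < b) (k : ℕ) : sinS hab (unitE k) = sinL a b k := by
  refine eq_of_inner_sinL hab fun j => ?_
  rw [inner_sinS, unitE_apply]
  rcases j with _ | j
  · simp [sinL_zero]
  · rcases k with _ | k
    · simp [sinL_zero]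
    · rw [orthonormal_iff_ite.1 (orthonormal_sinL hab) k j]
      simp [eq_comm]

theorem cosS_unitE (hab : a < b) (k : ℕ) : cosS hab (unitE k) = cosL a b k := by
  refine eq_of_inner_cosL hab fun j => ?_
  rw [inner_cosS, unitE_apply, orthonormal_iff_ite.1 (orthonormal_cosL hab) k j]
  simp [eq_comm]

/-- Sine coefficients. -/
def sinCoef (hab : a < b) : L2Om a b →L[ℝ] SeqE := ContinuousLinearMap.adjoint (sinS hab)

/-- Cosine coefficients. -/
def cosCoef (hab : a < b) : L2Om a b →L[ℝ] SeqE := ContinuousLinearMap.adjoint (cosS hab)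

theorem sinCoef_apply (hab : a < b) (Φ : L2Om a b) (k : ℕ) :
    sinCoef hab Φ k = ⟪Φ, sinL a b k⟫_ℝ := by
  rw [← inner_unitE, sinCoef, ContinuousLinearMap.adjoint_inner_left, sinS_unitE]

theorem cosCoef_apply (hab : a < b) (Φ : L2Om a b) (k : ℕ) :
    cosCoef hab Φ k = ⟪Φ, cosL a b k⟫_ℝ := by
  rw [← inner_unitE, cosCoef, ContinuousLinearMap.adjoint_inner_left, cosS_unitE]

theorem inner_sinCoef (hab : a < b) (v : SeqE) (Φ : L2Om a b) :
    ⟪v, sinCoef hab Φ⟫_ℝ = ⟪sinS hab v, Φ⟫_ℝ := ContinuousLinearMap.adjoint_inner_right _ _ _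

theorem inner_cosCoef (hab : a < b) (v : SeqE) (Φ : L2Om a b) :
    ⟪v, cosCoef hab Φ⟫_ℝ = ⟪cosS hab v, Φ⟫_ℝ := ContinuousLinearMap.adjoint_inner_right _ _ _

theorem sinS_sinCoef (hab : a < b) (Φ : L2Om a b) : sinS hab (sinCoef hab Φ) = Φ := by
  refine eq_of_inner_sinL hab fun k => ?_
  rw [inner_sinS, sinCoef_apply]
  split_ifs with h
  · rw [h, sinL_zero, inner_zero_right]
  · rfl

theorem cosS_cosCoef (hab : a < b) (Φ : L2Om a b) : cosS hab (cosCoef hab Φ) = Φ := by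
  refine eq_of_inner_cosL hab fun k => ?_
  rw [inner_cosS, cosCoef_apply]

/-- The coordinates of a function with given value and derivative. -/
def pairCoord (hab : a < b) (Φ Φx : L2Om a b) : SeqE :=
  ContinuousLinearMap.adjoint (opJ hab) Φ + ContinuousLinearMap.adjoint (opD hab) Φx

theorem pairCoord_spec (hab : a < b) {Φ Φx : L2Om a b}
    (h : ∀ k, ⟪Φx, sinL a b k⟫_ℝ = -(freq a b k * ⟪Φ, cosL a b k⟫_ℝ)) :
    opJ hab (pairCoord hab Φ Φx) = Φ ∧ opD hab (pairCoord hab Φ Φx) = Φx := by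
  obtain ⟨y, rfl, rfl⟩ := exists_coordinates hab Φ Φx h
  suffices e : pairCoord hab (opJ hab y) (opD hab y) = y by rw [e]; exact ⟨rfl, rfl⟩
  refine ext_inner_right ℝ fun z => ?_
  rw [pairCoord, inner_add_left, ContinuousLinearMap.adjoint_inner_left,
    ContinuousLinearMap.adjoint_inner_left, ← inner_opJ_add_inner_opD]

theorem IsPrim.pairCoord (hab : a < b) {Φ Φt Φx Φxt : ℝ → L2Om a b} (h : IsPrim T Φ Φt)
    (h' : IsPrim T Φx Φxt) : IsPrim T (fun t => pairCoord hab (Φ t) (Φx t))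
      (fun t => _root_.pairCoord hab (Φt t) (Φxt t)) :=
  (h.clm _).add (h'.clm _)

theorem HeatSol.weak (hab : a < b) (hT : 0 ≤ T) {θ y ρ z z' : ℝ → SeqE}
    (h : HeatSol (omF a b) T θ y ρ) (hz : IsPrim T z z') (hzT : z T = 0) :
    ∫ t in (0 : ℝ)..T, (⟪cosS hab (θ t), opJ hab (z' t)⟫_ℝ + ⟪ρ t - y t, z t⟫_ℝ) =
      -⟪cosS hab (θ 0), opJ hab (z 0)⟫_ℝ := by
  have hW : ∀ x u : SeqE, ⟪invOm a b x, u⟫_ℝ = ⟪cosS hab x, opJ hab u⟫_ℝ := fun x u => by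
    rw [opJ_apply, inner_cosS_cosS]
    exact inner_diagL abs_one_div_omF_le x u
  have hp : IsPrim T (fun t => invOm a b (θ t)) (fun t => ρ t - y t) := by
    refine IsPrim.of_coord (L2T.intervalIntegrable hT (MemLp.sub h.ρ2 h.y2)) fun k => ?_
    have h1 := (h.mode k).const_mul (1 / omF a b k)
    simp only [invOm_apply]
    convert h1 using 2 with t
    rw [seq_sub, ← mul_assoc, one_div_mul_cancel (omF_pos k).ne', one_mul]
  have h2 := (hp.inner hT hz).2 T (right_mem_Icc.2 hT)
  beta_reduce at h2
  rw [hzT, inner_zero_right] at h2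
  simp only [hW] at h2
  linarith

theorem one_div_omF_mul_add (k : ℕ) (s : ℝ) :
    1 / omF a b k * s + freq a b k / omF a b k * (freq a b k * s) = omF a b k * s := by
  have h1 := omF_sq (a := a) (b := b) k
  have h2 := (omF_pos (a := a) (b := b) k).ne'
  field_simp
  rw [h1]
  ring

theorem WaveSol.weak (hab : a < b) (hT : 0 ≤ T) {v w h : ℝ → SeqE} {Φ Φt Φx Φxt : ℝ → L2Om a b}
    (hs : WaveSol (freq a b) T v w h) (hΦ : IsPrim T Φ Φt) (hΦx : IsPrim T Φx Φxt)
    (hx : ∀ t k, ⟪Φx t, cosL a b k⟫_ℝ = freq a b k * ⟪Φ t, sinL a b k⟫_ℝ)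
    (hxt : ∀ t k, ⟪Φxt t, cosL a b k⟫_ℝ = freq a b k * ⟪Φt t, sinL a b k⟫_ℝ)
    (h0 : Φ T = 0) (hx0 : Φx T = 0) :
    ∫ t in (0 : ℝ)..T, (⟪sinS hab (v t), Φt t⟫_ℝ +
      (-⟪cosS hab (w t), Φx t⟫_ℝ + ⟪h t, sinCoef hab (Φ t)⟫_ℝ)) = -⟪sinS hab (v 0), Φ 0⟫_ℝ := by
  obtain ⟨Q, hQ⟩ : ∃ Q : L2Om a b → L2Om a b → SeqE, ∀ f g, Q f g =
      invOm a b (sinCoef hab f) + freqOm a b (cosCoef hab g) := ⟨_, fun _ _ => rfl⟩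
  have hQk : ∀ f g, (∀ k, ⟪g, cosL a b k⟫_ℝ = freq a b k * ⟪f, sinL a b k⟫_ℝ) → ∀ k,
      Q f g k = omF a b k * ⟪f, sinL a b k⟫_ℝ := by
    intro f g hfg k
    rw [hQ, seq_add, invOm_apply, freqOm_apply, sinCoef_apply, cosCoef_apply, hfg,
      one_div_omF_mul_add]
  have hQ1 : ∀ f g, (∀ k, ⟪g, cosL a b k⟫_ℝ = freq a b k * ⟪f, sinL a b k⟫_ℝ) →
      invOm a b (Q f g) = sinCoef hab f := by
    intro f g hfg
    refine seq_ext fun k => ?_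
    rw [invOm_apply, hQk f g hfg, sinCoef_apply, ← mul_assoc,
      one_div_mul_cancel (omF_pos k).ne', one_mul]
  have hQ2 : ∀ f g, (∀ k, ⟪g, cosL a b k⟫_ℝ = freq a b k * ⟪f, sinL a b k⟫_ℝ) →
      freqOm a b (Q f g) = cosCoef hab g := by
    intro f g hfg
    refine seq_ext fun k => ?_
    rw [freqOm_apply, hQk f g hfg, cosCoef_apply, hfg, ← mul_assoc,
      div_mul_cancel₀ _ (omF_pos k).ne']
  have hq : IsPrim T (fun t => Q (Φ t) (Φx t)) (fun t => Q (Φt t) (Φxt t)) := by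
    simp only [hQ]
    exact (hΦ.clm ((invOm a b).comp (sinCoef hab))).add (hΦx.clm ((freqOm a b).comp (cosCoef hab)))
  have hw : IntervalIntegrable (fun t => -freqOm a b (w t) + invOm a b (h t)) volume 0 T := by
    refine IntervalIntegrable.add (IntervalIntegrable.neg ?_) ?_
    · exact (L2T.of_continuousOn ((freqOm a b).continuous.comp_continuousOn hs.contw)
        ).intervalIntegrable hT
    · exact L2T.intervalIntegrable hT ((invOm a b).comp_memLp' hs.h2)
  have hp : IsPrim T (fun t => invOm a b (v t)) (fun t => -freqOm a b (w t) + invOm a b (h t)) := by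
    refine IsPrim.of_coord hw fun k => ?_
    have h1 := (hs.modev k).const_mul (1 / omF a b k)
    simp only [invOm_apply]
    convert h1 using 2 with t
    rw [seq_add, ← neg_one_smul ℝ (freqOm a b (w t)), seq_smul, freqOm_apply, invOm_apply]
    ring
  have h2 := (hp.inner hT hq).2 T (right_mem_Icc.2 hT)
  have hQ0 : Q (Φ T) (Φx T) = 0 := by rw [hQ, h0, hx0]; simp
  have hi : ∀ x u : SeqE, ⟪invOm a b x, u⟫_ℝ = ⟪x, invOm a b u⟫_ℝ :=
    inner_diagL abs_one_div_omF_le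
  have hf : ∀ x u : SeqE, ⟪freqOm a b x, u⟫_ℝ = ⟪x, freqOm a b u⟫_ℝ :=
    inner_diagL abs_freq_div_omF_le
  beta_reduce at h2
  rw [hQ0, inner_zero_right, hi, hQ1 _ _ (hx 0), inner_sinCoef] at h2
  have h3 : ∀ t, ⟪invOm a b (v t), Q (Φt t) (Φxt t)⟫_ℝ +
      ⟪-freqOm a b (w t) + invOm a b (h t), Q (Φ t) (Φx t)⟫_ℝ = ⟪sinS hab (v t), Φt t⟫_ℝ +
      (-⟪cosS hab (w t), Φx t⟫_ℝ + ⟪h t, sinCoef hab (Φ t)⟫_ℝ) := by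
    intro t
    rw [hi, hQ1 _ _ (hxt t), inner_sinCoef, inner_add_left, inner_neg_left, hf, hQ2 _ _ (hx t),
      inner_cosCoef, hi, hQ1 _ _ (hx t)]
  simp only [h3] at h2
  linarith

/-- The inverse of the nonzero frequencies. -/
def invFreq (a b : ℝ) : SeqE →L[ℝ] SeqE := diagL fun k => 1 / freq a b k

theorem invFreq_apply (hab : a < b) (y : SeqE) (k : ℕ) :
    invFreq a b y k = 1 / freq a b k * y k := by
  refine diagL_apply (C := 1 / freq a b 1) (fun k => ?_) y k
  have h1 := freq_pos hab one_ne_zero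
  rw [abs_of_nonneg (one_div_nonneg.2 (freq_nonneg hab k))]
  rcases eq_or_ne k 0 with rfl | hk
  · rw [freq_zero, div_zero]
    positivity
  · refine one_div_le_one_div_of_le h1 ?_
    have h2 : (1 : ℝ) ≤ k := by exact_mod_cast Nat.one_le_iff_ne_zero.2 hk
    rw [freq, freq]
    have h3 : 0 < Real.pi / (b - a) := div_pos Real.pi_pos (sub_pos.2 hab)
    push_cast
    nlinarith

/-- The function vanishing at the endpoints whose derivative has the given cosine coefficients. -/
def opU (hab : a < b) : SeqE →L[ℝ] L2Om a b := (sinS hab).comp (invFreq a b)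

theorem inner_opU (hab : a < b) (w : SeqE) (k : ℕ) :
    ⟪opU hab w, sinL a b k⟫_ℝ = 1 / freq a b k * w k := by
  rw [opU, ContinuousLinearMap.comp_apply, inner_sinS, invFreq_apply hab]
  split_ifs with h
  · rw [h, freq_zero]; simp
  · rfl

theorem WaveSol.isPrim_opU (hab : a < b) (hT : 0 ≤ T) {v w h : ℝ → SeqE}
    (hs : WaveSol (freq a b) T v w h) :
    IsPrim T (fun t => opU hab (w t)) (fun t => sinS hab (v t)) := by
  have hi : IntervalIntegrable (fun t => sinS hab (v t)) volume 0 T :=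
    (L2T.of_continuousOn ((sinS hab).continuous.comp_continuousOn hs.contv)).intervalIntegrable hT
  refine ⟨hi, fun t ht => eq_of_inner_sinL hab fun k => ?_⟩
  have h1 := ((hs.modew k).const_mul (1 / freq a b k)).2 t ht
  have h2 := (innerSL ℝ (sinL a b k)).intervalIntegral_comp_comm (hi.sub_right ht)
  simp only [innerSL_apply_apply] at h2
  beta_reduce at h1
  rw [inner_add_left, inner_opU, inner_opU, h1, real_inner_comm (sinL a b k) (∫ _ in _.._, _), ← h2]
  congr 1
  refine intervalIntegral.integral_congr fun s _ => ?_
  rw [real_inner_comm, inner_sinS]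
  split_ifs with h
  · rw [h, freq_zero]; simp
  · rw [← mul_assoc, one_div_mul_cancel (freq_pos hab h).ne', one_mul]

/-- Integration by parts against a function whose derivative has sine coefficients `-λ ψ`. -/
theorem inner_opU_eq (hab : a < b) {w : SeqE} (hw : w 0 = 0) {ψ ψx : L2Om a b}
    (h : ∀ k, ⟪ψx, sinL a b k⟫_ℝ = -(freq a b k * ⟪ψ, cosL a b k⟫_ℝ)) :
    ⟪opU hab w, ψx⟫_ℝ = -⟪cosS hab w, ψ⟫_ℝ := by
  rw [opU, ContinuousLinearMap.comp_apply, ← inner_sinCoef, ← inner_cosCoef, seq_inner, seq_inner,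
    ← tsum_neg]
  refine tsum_congr fun k => ?_
  rw [invFreq_apply hab, sinCoef_apply, cosCoef_apply, h]
  rcases eq_or_ne k 0 with rfl | hk
  · rw [hw]; ring
  · have := (freq_pos hab hk).ne'
    field_simp

end WeakEquations

section TestCurves

variable {a b T : ℝ} {φ φ' : ℝ → ℝ → ℝ}

/-- The time slice of a continuous function, frozen outside `[a,b]`. -/
def sliceC (hab : a < b) (hφ : Continuous (uncurry φ)) (t : ℝ) : ℝ →ᵇ ℝ :=
  (BoundedContinuousFunction.mkOfCompact
    ((ContinuousMap.curry ⟨fun p : ℝ × Icc a b => φ p.2 p.1,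
      hφ.comp (by fun_prop : Continuous fun p : ℝ × Icc a b => ((p.2 : ℝ), p.1))⟩) t)).compContinuous
    ⟨projIcc a b hab.le, continuous_projIcc⟩

theorem sliceC_apply (hab : a < b) (hφ : Continuous (uncurry φ)) (t x : ℝ) :
    sliceC hab hφ t x = φ (projIcc a b hab.le x) t := rfl

theorem sliceC_of_mem (hab : a < b) (hφ : Continuous (uncurry φ)) (t : ℝ) {x : ℝ}
    (hx : x ∈ Icc a b) : sliceC hab hφ t x = φ x t := by
  rw [sliceC_apply, projIcc_of_mem hab.le hx]

theorem continuous_sliceC (hab : a < b) (hφ : Continuous (uncurry φ)) :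
    Continuous (sliceC hab hφ) :=
  (BoundedContinuousFunction.continuous_compContinuous _).comp
    ((ContinuousMap.isometryEquivBoundedOfCompact (Icc a b) ℝ).continuous.comp
      (ContinuousMap.continuous _))

theorem isPrim_sliceC (hab : a < b) (hφ : Continuous (uncurry φ))
    (hφ' : Continuous (uncurry φ')) (h : ∀ x t, HasDerivAt (φ x) (φ' x t) t) :
    IsPrim T (sliceC hab hφ) (sliceC hab hφ') := by
  have hi : ∀ t, IntervalIntegrable (sliceC hab hφ') volume 0 t :=
    fun t => (continuous_sliceC hab hφ').intervalIntegrable _ _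
  refine ⟨hi T, fun t ht => ?_⟩
  ext x
  have h1 := (BoundedContinuousFunction.evalCLM ℝ x).intervalIntegral_comp_comm (hi t)
  change ∫ s in (0 : ℝ)..t, sliceC hab hφ' s x = (∫ s in (0 : ℝ)..t, sliceC hab hφ' s) x at h1
  rw [BoundedContinuousFunction.add_apply, ← h1]
  simp only [sliceC_apply]
  rw [intervalIntegral.integral_eq_sub_of_hasDerivAt (fun s _ => h _ s)]
  · ring
  · exact (hφ'.comp (by fun_prop : Continuous fun s : ℝ =>
      ((projIcc a b hab.le x : ℝ), s))).intervalIntegrable _ _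

/-- The time slice of a continuous function as an element of `L²(a,b)`. -/
def sliceL (hab : a < b) (hφ : Continuous (uncurry φ)) (t : ℝ) : L2Om a b :=
  L2Om.ofBCF a b (sliceC hab hφ t)

theorem coeFn_sliceL (hab : a < b) (hφ : Continuous (uncurry φ)) (t : ℝ) :
    sliceL hab hφ t =ᵐ[volume.restrict (Ioo a b)] fun x => φ x t := by
  filter_upwards [L2Om.coeFn_ofBCF (sliceC hab hφ t), ae_restrict_mem measurableSet_Ioo]
    with x hx hm
  rw [sliceL, hx, sliceC_of_mem hab hφ t (Ioo_subset_Icc_self hm)]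

theorem continuous_sliceL (hab : a < b) (hφ : Continuous (uncurry φ)) :
    Continuous (sliceL hab hφ) :=
  (L2Om.ofBCF a b).continuous.comp (continuous_sliceC hab hφ)

theorem isPrim_sliceL (hab : a < b) (hφ : Continuous (uncurry φ))
    (hφ' : Continuous (uncurry φ')) (h : ∀ x t, HasDerivAt (φ x) (φ' x t) t) :
    IsPrim T (sliceL hab hφ) (sliceL hab hφ') :=
  (isPrim_sliceC hab hφ hφ' h).clm _

theorem isRep_sliceL (hab : a < b) (hφ : Continuous (uncurry φ)) :
    IsRep a b T φ (sliceL hab hφ) :=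
  ⟨hφ.aestronglyMeasurable, Eventually.of_forall fun t => (coeFn_sliceL hab hφ t).symm,
    L2T.of_continuousOn (continuous_sliceL hab hφ).continuousOn⟩

theorem sliceL_eq_zero (hab : a < b) (hφ : Continuous (uncurry φ)) {t : ℝ}
    (h : ∀ x, φ x t = 0) : sliceL hab hφ t = 0 := by
  have : sliceC hab hφ t = 0 := by ext x; exact h _
  rw [sliceL, this, map_zero]

theorem inner_sliceL_bcf (hab : a < b) (hφ : Continuous (uncurry φ)) (t : ℝ) (c : ℝ →ᵇ ℝ) :
    ⟪sliceL hab hφ t, L2Om.ofBCF a b c⟫_ℝ = ∫ x in a..b, c x * φ x t := by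
  rw [L2Om.inner_eq_of_ae (coeFn_sliceL hab hφ t) (L2Om.coeFn_ofBCF c), setIntegral_Ioo_eq hab.le]
  simp only [mul_comm]

theorem continuous_slice (hφ : Continuous (uncurry φ)) (t : ℝ) : Continuous fun x => φ x t :=
  hφ.comp (by fun_prop : Continuous fun x : ℝ => (x, t))

theorem inner_sliceL_cosL (hab : a < b) (hφ : Continuous (uncurry φ))
    (hφ' : Continuous (uncurry φ')) {t : ℝ} (h : ∀ x, HasDerivAt (fun x => φ x t) (φ' x t) x)
    (ha : φ a t = 0) (hb : φ b t = 0) (k : ℕ) :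
    ⟪sliceL hab hφ' t, cosL a b k⟫_ℝ = freq a b k * ⟪sliceL hab hφ t, sinL a b k⟫_ℝ := by
  rw [cosL, sinL, inner_sliceL_bcf, inner_sliceL_bcf,
    intervalIntegral.integral_mul_deriv_eq_deriv_mul (fun x _ => hasDerivAt_cosC k x)
      (fun x _ => h x) (Continuous.intervalIntegrable (by fun_prop) _ _)
      ((continuous_slice hφ' t).intervalIntegrable _ _), ha, hb,
    ← intervalIntegral.integral_const_mul, mul_zero, mul_zero, sub_zero, zero_sub,
    ← intervalIntegral.integral_neg]
  exact intervalIntegral.integral_congr fun x _ => by ring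

theorem inner_sliceL_sinL (hab : a < b) (hφ : Continuous (uncurry φ))
    (hφ' : Continuous (uncurry φ')) {t : ℝ} (h : ∀ x, HasDerivAt (fun x => φ x t) (φ' x t) x)
    (k : ℕ) :
    ⟪sliceL hab hφ' t, sinL a b k⟫_ℝ = -(freq a b k * ⟪sliceL hab hφ t, cosL a b k⟫_ℝ) := by
  rw [cosL, sinL, inner_sliceL_bcf, inner_sliceL_bcf,
    intervalIntegral.integral_mul_deriv_eq_deriv_mul (fun x _ => hasDerivAt_sinC k x)
      (fun x _ => h x) (Continuous.intervalIntegrable (by fun_prop) _ _)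
      ((continuous_slice hφ' t).intervalIntegrable _ _), sinC_left, sinC_right hab,
    ← intervalIntegral.integral_const_mul, zero_mul, zero_mul, sub_zero, zero_sub]
  exact congrArg Neg.neg (intervalIntegral.integral_congr fun x _ => by ring)

end TestCurves

section PartialDerivatives

variable {φ : ℝ → ℝ → ℝ}

theorem hasDerivAt_pdt_fderiv (h : ContDiff ℝ (⊤ : ℕ∞) (uncurry φ)) (x t : ℝ) :
    HasDerivAt (φ x) (fderiv ℝ (uncurry φ) (x, t) (0, 1)) t := by
  have h1 := ((h.differentiable (by simp)) (x, t)).hasFDerivAt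
  exact h1.comp_hasDerivAt t ((hasDerivAt_const t x).prodMk (hasDerivAt_id t))

theorem hasDerivAt_pdx_fderiv (h : ContDiff ℝ (⊤ : ℕ∞) (uncurry φ)) (x t : ℝ) :
    HasDerivAt (fun x => φ x t) (fderiv ℝ (uncurry φ) (x, t) (1, 0)) x := by
  have h1 := ((h.differentiable (by simp)) (x, t)).hasFDerivAt
  exact h1.comp_hasDerivAt x ((hasDerivAt_id x).prodMk (hasDerivAt_const x t))

theorem uncurry_pdt (h : ContDiff ℝ (⊤ : ℕ∞) (uncurry φ)) :
    uncurry (pdt φ) = fun p => fderiv ℝ (uncurry φ) p (0, 1) :=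
  funext fun p => (hasDerivAt_pdt_fderiv h p.1 p.2).deriv

theorem uncurry_pdx (h : ContDiff ℝ (⊤ : ℕ∞) (uncurry φ)) :
    uncurry (pdx φ) = fun p => fderiv ℝ (uncurry φ) p (1, 0) :=
  funext fun p => (hasDerivAt_pdx_fderiv h p.1 p.2).deriv

theorem contDiff_pdt (h : ContDiff ℝ (⊤ : ℕ∞) (uncurry φ)) :
    ContDiff ℝ (⊤ : ℕ∞) (uncurry (pdt φ)) := by
  rw [uncurry_pdt h]
  exact (h.fderiv_right (m := (⊤ : ℕ∞)) (by simp)).clm_apply contDiff_const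

theorem contDiff_pdx (h : ContDiff ℝ (⊤ : ℕ∞) (uncurry φ)) :
    ContDiff ℝ (⊤ : ℕ∞) (uncurry (pdx φ)) := by
  rw [uncurry_pdx h]
  exact (h.fderiv_right (m := (⊤ : ℕ∞)) (by simp)).clm_apply contDiff_const

theorem hasDerivAt_pdt (h : ContDiff ℝ (⊤ : ℕ∞) (uncurry φ)) (x t : ℝ) :
    HasDerivAt (φ x) (pdt φ x t) t :=
  (hasDerivAt_pdt_fderiv h x t).differentiableAt.hasDerivAt

theorem hasDerivAt_pdx (h : ContDiff ℝ (⊤ : ℕ∞) (uncurry φ)) (x t : ℝ) :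
    HasDerivAt (fun x => φ x t) (pdx φ x t) x :=
  (hasDerivAt_pdx_fderiv h x t).differentiableAt.hasDerivAt

theorem pdx_pdt_comm (h : ContDiff ℝ (⊤ : ℕ∞) (uncurry φ)) : pdx (pdt φ) = pdt (pdx φ) := by
  have h2 : Differentiable ℝ (fderiv ℝ (uncurry φ)) :=
    (h.fderiv_right (m := (⊤ : ℕ∞)) (by simp)).differentiable (by simp)
  have h3 : ∀ (p u v : ℝ × ℝ), fderiv ℝ (fun p => fderiv ℝ (uncurry φ) p u) p v =
      fderiv ℝ (fderiv ℝ (uncurry φ)) p v u := by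
    intro p u v
    rw [((h2 p).hasFDerivAt.clm_apply (hasFDerivAt_const u p)).fderiv]
    simp
  ext x t
  have h4 := congrFun (uncurry_pdx (contDiff_pdt h)) (x, t)
  have h5 := congrFun (uncurry_pdt (contDiff_pdx h)) (x, t)
  rw [uncurry_pdt h] at h4
  rw [uncurry_pdx h] at h5
  simp only [uncurry_apply_pair, h3] at h4 h5
  rw [h4, h5]
  exact (h.contDiffAt.isSymmSndFDerivAt (by
    simpa using WithTop.coe_le_coe.2 (le_top : (2 : ℕ∞) ≤ ⊤))).eq _ _

end PartialDerivatives

section SmoothTests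

variable {a b T : ℝ} {φ : ℝ → ℝ → ℝ}

theorem pdx_eq_zero {t : ℝ} (h : ∀ x, φ x t = 0) (x : ℝ) : pdx φ x t = 0 := by
  rw [pdx, funext h, deriv_const]

theorem pdt_eq_zero {T' t : ℝ} (ht : T' < t) (h : ∀ x s, T' ≤ s → φ x s = 0) (x : ℝ) :
    pdt φ x t = 0 := by
  have : φ x =ᶠ[nhds t] fun _ => 0 := by
    filter_upwards [Ioi_mem_nhds ht] with s hs
    exact h x s (le_of_lt hs)
  rw [pdt, this.deriv_eq, deriv_const]

theorem pdt_eq_zero_of_forall {x : ℝ} (h : ∀ t, φ x t = 0) (t : ℝ) : pdt φ x t = 0 := by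
  rw [pdt]
  change deriv (φ x) t = 0
  rw [funext h, deriv_const]

theorem isPrim_sliceL_pdx (hab : a < b) (hc : ContDiff ℝ (⊤ : ℕ∞) (uncurry φ)) :
    IsPrim T (sliceL hab (contDiff_pdx hc).continuous)
      (sliceL hab (contDiff_pdx (contDiff_pdt hc)).continuous) :=
  isPrim_sliceL hab _ _ fun x t => by
    rw [pdx_pdt_comm hc]; exact hasDerivAt_pdt (contDiff_pdx hc) x t

/-- Integration by parts in space against functions vanishing at the endpoints. -/
theorem inner_opJ_eq (hab : a < b) {ψ ψx : L2Om a b} (y : SeqE)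
    (h : ∀ k, ⟪ψx, cosL a b k⟫_ℝ = freq a b k * ⟪ψ, sinL a b k⟫_ℝ) :
    ⟪opJ hab y, ψx⟫_ℝ = -⟪opD hab y, ψ⟫_ℝ := by
  rw [opJ_apply, opD_apply, inner_neg_left, neg_neg, ← inner_sinCoef, ← inner_cosCoef, seq_inner,
    seq_inner]
  refine tsum_congr fun k => ?_
  rw [invOm_apply, freqOm_apply, sinCoef_apply, cosCoef_apply, h]
  ring

theorem opS_pairCoord (hab : a < b) {c : ℝ →ᵇ ℝ} {Φx : L2Om a b}
    (h : ∀ k, ⟪Φx, sinL a b k⟫_ℝ = -(freq a b k * ⟪L2Om.ofBCF a b c, cosL a b k⟫_ℝ))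
    (g : L2Om a b) :
    L2Om.mul a b (opS hab (pairCoord hab (L2Om.ofBCF a b c) Φx)) g = L2Om.mul a b c g := by
  refine Lp.ext ?_
  have h1 := coeFn_opJ hab (pairCoord hab (L2Om.ofBCF a b c) Φx)
  rw [(pairCoord_spec hab h).1] at h1
  filter_upwards [h1, L2Om.coeFn_ofBCF (a := a) (b := b) c, L2Om.coeFn_mul c g,
    L2Om.coeFn_mul (opS hab (pairCoord hab (L2Om.ofBCF a b c) Φx)) g] with x e1 e2 e3 e4
  rw [e3, e4, ← e1, e2]

end SmoothTests

section CurveEquations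

variable {a b T : ℝ} {φ : ℝ → ℝ → ℝ} {M : ℝ≥0} {f₁ f₂ : ℝ → ℝ} {θ v w y : ℝ → SeqE}

theorem trigModel_weak_heat (hab : a < b) (hf₁ : LipschitzWith M f₁) (hf₂ : LipschitzWith M f₂)
    (h0 : f₁ 0 = 0) (hb : ∀ x, |f₂ x| ≤ M) (hT : 0 ≤ T)
    (hs : (trigModel hab hf₁ hf₂ h0 hb).Sol T θ v w y) (hc : ContDiff ℝ (⊤ : ℕ∞) (uncurry φ))
    (hφT : ∀ x, φ x T = 0) :
    ∫ t in (0 : ℝ)..T, (⟪cosS hab (θ t), sliceL hab (contDiff_pdt hc).continuous t⟫_ℝ +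
      (-⟪opD hab (y t), sliceL hab (contDiff_pdx hc).continuous t⟫_ℝ +
      (⟪L2Om.mul a b (BoundedContinuousFunction.comp f₂ hf₂ (opS hab (y t))) (opD hab (y t)),
        L2Om.mul a b (sliceC hab hc.continuous t) (sinS hab (v t))⟫_ℝ +
      ⟪L2Om.mul a b (BoundedContinuousFunction.comp f₁ hf₁ (opS hab (y t))) (sinS hab (v t)),
        sliceL hab (contDiff_pdx hc).continuous t⟫_ℝ))) =
      -⟪cosS hab (θ 0), sliceL hab hc.continuous 0⟫_ℝ := by
  have hp : IsPrim T (sliceL hab hc.continuous) (sliceL hab (contDiff_pdt hc).continuous) :=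
    isPrim_sliceL hab _ _ (hasDerivAt_pdt hc)
  have e1 : ∀ t k, ⟪sliceL hab (contDiff_pdx hc).continuous t, sinL a b k⟫_ℝ =
      -(freq a b k * ⟪sliceL hab hc.continuous t, cosL a b k⟫_ℝ) := fun t k =>
    inner_sliceL_sinL hab _ _ (fun x => hasDerivAt_pdx hc x t) k
  have e2 : ∀ t k, ⟪sliceL hab (contDiff_pdx (contDiff_pdt hc)).continuous t, sinL a b k⟫_ℝ =
      -(freq a b k * ⟪sliceL hab (contDiff_pdt hc).continuous t, cosL a b k⟫_ℝ) := fun t k =>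
    inner_sliceL_sinL hab _ _ (fun x => hasDerivAt_pdx (contDiff_pdt hc) x t) k
  have hz := hp.pairCoord hab (isPrim_sliceL_pdx (T := T) hab hc)
  have hzT : pairCoord hab (sliceL hab hc.continuous T)
      (sliceL hab (contDiff_pdx hc).continuous T) = 0 := by
    rw [sliceL_eq_zero hab _ hφT, sliceL_eq_zero hab _ (pdx_eq_zero hφT), pairCoord]
    simp
  have hh : HeatSol (omF a b) T θ y fun t => (trigModel hab hf₁ hf₂ h0 hb).B (y t) (v t) := hs.heat
  have h1 := hh.weak hab hT hz hzT
  rw [(pairCoord_spec hab (e1 0)).1] at h1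
  rw [← h1]
  refine intervalIntegral.integral_congr fun t _ => ?_
  have h2 : ∀ z, ⟪(trigModel hab hf₁ hf₂ h0 hb).B (y t) (v t), z⟫_ℝ =
      ⟪opJ hab (y t), opJ hab z⟫_ℝ +
      ⟪L2Om.mul a b (BoundedContinuousFunction.comp f₂ hf₂ (opS hab (y t))) (opD hab (y t)),
        L2Om.mul a b (opS hab z) (sinS hab (v t))⟫_ℝ +
      ⟪L2Om.mul a b (BoundedContinuousFunction.comp f₁ hf₁ (opS hab (y t))) (sinS hab (v t)),
        opD hab z⟫_ℝ :=
    (trigModel hab hf₁ hf₂ h0 hb).inner_B (y t) (v t)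
  have h3 : L2Om.mul a b (opS hab (pairCoord hab (sliceL hab hc.continuous t)
      (sliceL hab (contDiff_pdx hc).continuous t))) (sinS hab (v t)) =
      L2Om.mul a b (sliceC hab hc.continuous t) (sinS hab (v t)) := opS_pairCoord hab (e1 t) _
  rw [(pairCoord_spec hab (e2 t)).1, inner_sub_left, h2, inner_opJ_add_inner_opD hab (y t),
    (pairCoord_spec hab (e1 t)).1, (pairCoord_spec hab (e1 t)).2, h3]
  ring

theorem trigModel_weak_wave (hab : a < b) (hf₁ : LipschitzWith M f₁) (hf₂ : LipschitzWith M f₂)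
    (h0 : f₁ 0 = 0) (hb : ∀ x, |f₂ x| ≤ M) (hT : 0 ≤ T)
    (hs : (trigModel hab hf₁ hf₂ h0 hb).Sol T θ v w y) (hc : ContDiff ℝ (⊤ : ℕ∞) (uncurry φ))
    (hφT : ∀ x, φ x T = 0) (hφa : ∀ t, φ a t = 0) (hφb : ∀ t, φ b t = 0) :
    ∫ t in (0 : ℝ)..T, (⟪sinS hab (v t), sliceL hab (contDiff_pdt hc).continuous t⟫_ℝ +
      (-⟪cosS hab (w t), sliceL hab (contDiff_pdx hc).continuous t⟫_ℝ +
      -⟪L2Om.mul a b (BoundedContinuousFunction.comp f₂ hf₂ (opS hab (y t))) (opD hab (y t)),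
        sliceL hab hc.continuous t⟫_ℝ)) =
      -⟪sinS hab (v 0), sliceL hab hc.continuous 0⟫_ℝ := by
  have hp : IsPrim T (sliceL hab hc.continuous) (sliceL hab (contDiff_pdt hc).continuous) :=
    isPrim_sliceL hab _ _ (hasDerivAt_pdt hc)
  have hh : WaveSol (freq a b) T v w fun t => (trigModel hab hf₁ hf₂ h0 hb).h (y t) := hs.wave
  have h1 := hh.weak hab hT hp (isPrim_sliceL_pdx (T := T) hab hc)
    (fun t k => inner_sliceL_cosL hab _ _ (fun x => hasDerivAt_pdx hc x t) (hφa t) (hφb t) k)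
    (fun t k => inner_sliceL_cosL hab _ _ (fun x => hasDerivAt_pdx (contDiff_pdt hc) x t)
      (pdt_eq_zero_of_forall hφa t) (pdt_eq_zero_of_forall hφb t) k)
    (sliceL_eq_zero hab _ hφT) (sliceL_eq_zero hab _ (pdx_eq_zero hφT))
  rw [← h1]
  refine intervalIntegral.integral_congr fun t _ => ?_
  have h2 : ∀ ν, ⟪(trigModel hab hf₁ hf₂ h0 hb).h (y t), ν⟫_ℝ =
      -⟪L2Om.mul a b (BoundedContinuousFunction.comp f₂ hf₂ (opS hab (y t))) (opD hab (y t)),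
        sinS hab ν⟫_ℝ := (trigModel hab hf₁ hf₂ h0 hb).inner_h (y t)
  rw [h2, sinS_sinCoef]

theorem WaveSol.apply_zero_eq {h : ℝ → SeqE} (hs : WaveSol (freq a b) T v w h)
    (h0 : w 0 0 = 0) {t : ℝ} (ht : t ∈ Icc 0 T) : w t 0 = 0 := by
  have h1 := (hs.modew 0).2 t ht
  simp only [freq_zero, zero_mul, intervalIntegral.integral_zero, add_zero] at h1
  rw [h1, h0]

/-- The coefficients of a displacement are determined by those of its derivative. -/
theorem opU_cosCoef (hab : a < b) {U Ux : L2Om a b}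
    (h : ∀ k, ⟪Ux, cosL a b k⟫_ℝ = freq a b k * ⟪U, sinL a b k⟫_ℝ) :
    opU hab (cosCoef hab Ux) = U := by
  refine eq_of_inner_sinL hab fun k => ?_
  rw [inner_opU, cosCoef_apply, h]
  rcases eq_or_ne k 0 with rfl | hk
  · simp [freq_zero, sinL_zero]
  · rw [← mul_assoc, one_div_mul_cancel (freq_pos hab hk).ne', one_mul]

end CurveEquations

section Representatives

variable {a b T : ℝ} {r p : ℝ → ℝ → ℝ} {g : ℝ → L2Om a b} {J : Set ℝ}

theorem L2Om.memL2_of_ae {f : L2Om a b} {F : ℝ → ℝ} (h : F =ᵐ[volume.restrict (Ioo a b)] f) :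
    MemL2 a b F := by
  refine ⟨(Lp.aestronglyMeasurable f).congr h.symm, (L2Om.integrable_mul f f).congr ?_⟩
  filter_upwards [h] with x hx
  rw [hx, sq]

theorem L2Om.integral_sub_sq {f g : L2Om a b} {F G : ℝ → ℝ}
    (hF : F =ᵐ[volume.restrict (Ioo a b)] f) (hG : G =ᵐ[volume.restrict (Ioo a b)] g) :
    ∫ x in Ioo a b, (F x - G x) ^ 2 = ‖f - g‖ ^ 2 := by
  have h : (f - g : L2Om a b) =ᵐ[volume.restrict (Ioo a b)] fun x => F x - G x := by
    filter_upwards [Lp.coeFn_sub f g, hF, hG] with x h1 h2 h3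
    rw [h1, Pi.sub_apply, h2, h3]
  rw [← real_inner_self_eq_norm_sq, L2Om.inner_eq_of_ae h h]
  simp only [sq]

theorem contL2_of_slice (hg : ContinuousOn g J)
    (hr : ∀ t ∈ J, (fun x => r x t) =ᵐ[volume.restrict (Ioo a b)] g t) : ContL2 a b J r := by
  refine ⟨fun t ht => L2Om.memL2_of_ae (hr t ht), fun t₀ ht₀ => ?_⟩
  have h1 : Tendsto (fun t => ‖g t - g t₀‖ ^ 2) (nhdsWithin t₀ J) (nhds 0) := by
    have := (((hg t₀ ht₀).sub_const (g t₀)).norm.pow 2)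
    simpa using this
  refine h1.congr' ?_
  filter_upwards [self_mem_nhdsWithin] with t ht
  exact (L2Om.integral_sub_sq (hr t ht) (hr t₀ ht₀)).symm

theorem L2Om.integral_abs_sub_le {f g : L2Om a b} {F G : ℝ → ℝ}
    (hF : F =ᵐ[volume.restrict (Ioo a b)] f) (hG : G =ᵐ[volume.restrict (Ioo a b)] g) :
    ∫ x in Ioo a b, |F x - G x| ≤
      ‖f - g‖ * ‖L2Om.ofBCF a b (BoundedContinuousFunction.const ℝ 1)‖ := by
  have h : (|f - g| : L2Om a b) =ᵐ[volume.restrict (Ioo a b)] fun x => |F x - G x| := by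
    filter_upwards [Lp.coeFn_abs (f - g), Lp.coeFn_sub f g, hF, hG] with x h0 h1 h2 h3
    rw [h0, h1, Pi.sub_apply, h2, h3]
  have h1 := L2Om.inner_eq_of_ae h (L2Om.coeFn_ofBCF (BoundedContinuousFunction.const ℝ (1 : ℝ)))
  simp only [BoundedContinuousFunction.const_apply, mul_one] at h1
  rw [← h1, ← norm_abs_eq_norm (f - g)]
  exact real_inner_le_norm _ _

theorem tendsto_integral_abs_sub (hg : ContinuousOn g J)
    (hr : ∀ t ∈ J, (fun x => r x t) =ᵐ[volume.restrict (Ioo a b)] g t) {t₀ : ℝ} (ht₀ : t₀ ∈ J) :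
    Tendsto (fun t => ∫ x in Ioo a b, |r x t - r x t₀|) (nhdsWithin t₀ J) (nhds 0) := by
  have h1 : Tendsto (fun t => ‖g t - g t₀‖ *
      ‖L2Om.ofBCF a b (BoundedContinuousFunction.const ℝ 1)‖) (nhdsWithin t₀ J) (nhds 0) := by
    have := ((hg t₀ ht₀).sub_const (g t₀)).norm.mul_const
      ‖L2Om.ofBCF a b (BoundedContinuousFunction.const ℝ 1)‖
    simpa using this
  refine squeeze_zero' (Eventually.of_forall fun t => integral_nonneg fun x => abs_nonneg _) ?_ h1
  filter_upwards [self_mem_nhdsWithin] with t ht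
  exact L2Om.integral_abs_sub_le (hr t ht) (hr t₀ ht₀)

theorem continuousOn_Ici_of_Icc {Z : Type*} [TopologicalSpace Z] {g : ℝ → Z}
    (h : ∀ T, 0 ≤ T → ContinuousOn g (Icc 0 T)) : ContinuousOn g (Ici 0) := by
  intro t ht
  have h0 : (0 : ℝ) ≤ t := ht
  refine (h (t + 1) (by linarith) t ⟨h0, by linarith⟩).mono_of_mem_nhdsWithin ?_
  rw [← Ici_inter_Iic]
  exact inter_mem self_mem_nhdsWithin (mem_nhdsWithin_of_mem_nhds (Iic_mem_nhds (by linarith)))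

theorem exists_rep_of_continuousOn (hg : ContinuousOn g (Ici 0)) :
    ∃ r : ℝ → ℝ → ℝ, StronglyMeasurable (uncurry r) ∧
      ∀ t, 0 ≤ t → (fun x => r x t) =ᵐ[volume.restrict (Ioo a b)] g t := by
  have hc : Continuous fun t => g (max t 0) :=
    hg.comp_continuous (by fun_prop) fun t => le_max_right t 0
  obtain ⟨r, hm, hr⟩ := exists_joint_representative hc.stronglyMeasurable
  refine ⟨r, hm, fun t ht => ?_⟩
  have := hr t
  rwa [max_eq_left ht] at this

theorem IsRep.of_slices (hm : StronglyMeasurable (uncurry r))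
    (hr : ∀ t, 0 ≤ t → (fun x => r x t) =ᵐ[volume.restrict (Ioo a b)] g t)
    (hg : ContinuousOn g (Ici 0)) : IsRep a b T r g := by
  refine ⟨hm.aestronglyMeasurable, ?_, L2T.of_continuousOn (hg.mono Icc_subset_Ici_self)⟩
  filter_upwards [ae_restrict_mem measurableSet_Ioo] with t ht
  exact hr t ht.1.le

theorem exists_rep_of_L2T (hg : ∀ T, 0 ≤ T → L2T T g) :
    ∃ r : ℝ → ℝ → ℝ, ∀ T, 0 ≤ T → IsRep a b T r g := by
  have h1 : AEStronglyMeasurable g (volume.restrict (⋃ n : ℕ, Ioc 0 (n : ℝ))) :=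
    aestronglyMeasurable_iUnion_iff.2 fun n => (hg n n.cast_nonneg).aestronglyMeasurable
  obtain ⟨r, hm, hr⟩ := exists_joint_representative h1.stronglyMeasurable_mk
  refine ⟨r, fun T hT => ?_⟩
  have h2 : ∀ᵐ t ∂volume.restrict (Ioc 0 T), h1.mk g t = g t := by
    obtain ⟨n, hn⟩ := exists_nat_ge T
    exact ae_restrict_of_ae_restrict_of_subset
      ((Ioc_subset_Ioc_right hn).trans (subset_iUnion (fun n : ℕ => Ioc 0 (n : ℝ)) n))
      (h1.ae_eq_mk.symm)
  have h3 : IsRep a b T r (h1.mk g) :=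
    ⟨hm.aestronglyMeasurable, Eventually.of_forall hr, (memLp_congr_ae h2).2 (hg T hT)⟩
  exact h3.congr_curve h2

theorem IsRep.mul_bcf {c : ℝ → ℝ →ᵇ ℝ}
    (hpm : AEStronglyMeasurable (uncurry p) (volume.restrict (Ioo a b ×ˢ Ioo 0 T)))
    (hp : ∀ᵐ t ∂volume.restrict (Ioo 0 T),
      (fun x => p x t) =ᵐ[volume.restrict (Ioo a b)] c t)
    (hr : IsRep a b T r g) (hm : L2T T fun t => L2Om.mul a b (c t) (g t)) :
    IsRep a b T (fun x t => p x t * r x t) fun t => L2Om.mul a b (c t) (g t) := by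
  refine ⟨hpm.mul hr.meas, ?_, hm⟩
  filter_upwards [hp, hr.slice] with t h1 h2
  filter_upwards [h1, h2, L2Om.coeFn_mul (c t) (g t)] with x h3 h4 h5
  rw [h5, ← h3, ← h4]

end Representatives

section WeakForms

variable {a b T : ℝ} {M : ℝ≥0} {f₁ f₂ : ℝ → ℝ} {θ v w y : ℝ → SeqE} {φ : ℝ → ℝ → ℝ}
  {u ut ux Θ Θx G F : ℝ → ℝ → ℝ}

theorem intOm_mul_sliceL (hab : a < b) (hφ : Continuous (uncurry φ)) {f : L2Om a b} {F : ℝ → ℝ}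
    (hF : f =ᵐ[volume.restrict (Ioo a b)] F) (t : ℝ) :
    intOm a b (fun x => F x * φ x t) = ⟪f, sliceL hab hφ t⟫_ℝ :=
  (L2Om.inner_eq_of_ae hF (coeFn_sliceL hab hφ t)).symm

theorem weakDerivZ_opU (hab : a < b) {w : SeqE} (hw : w 0 = 0) {g g' : ℝ → ℝ}
    (hg : g =ᵐ[volume.restrict (Ioo a b)] opU hab w)
    (hg' : g' =ᵐ[volume.restrict (Ioo a b)] cosS hab w) : WeakDerivZ a b g g' := by
  intro ψ hψ
  have c1 : Continuous (uncurry fun x (_ : ℝ) => ψ x) := hψ.continuous.comp continuous_fst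
  have c2 : Continuous (uncurry fun x (_ : ℝ) => deriv ψ x) :=
    (hψ.continuous_deriv (by simp)).comp continuous_fst
  have h := inner_opU_eq hab hw (inner_sliceL_sinL hab c1 c2 (t := 0) fun x =>
    ((hψ.differentiable (by simp)) x).hasDerivAt)
  rw [← intOm_mul_sliceL hab c2 hg.symm, ← intOm_mul_sliceL hab c1 hg'.symm] at h
  exact h

theorem weakDerivI_opJ (hab : a < b) {y : SeqE} {g g' : ℝ → ℝ}
    (hg : g =ᵐ[volume.restrict (Ioo a b)] opJ hab y)
    (hg' : g' =ᵐ[volume.restrict (Ioo a b)] opD hab y) : WeakDerivI a b g g' := by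
  intro ψ hψ hs
  have c1 : Continuous (uncurry fun x (_ : ℝ) => ψ x) := hψ.continuous.comp continuous_fst
  have c2 : Continuous (uncurry fun x (_ : ℝ) => deriv ψ x) :=
    (hψ.continuous_deriv (by simp)).comp continuous_fst
  have ha : ψ a = 0 := image_eq_zero_of_notMem_tsupport fun h => lt_irrefl _ (hs h).1
  have hb : ψ b = 0 := image_eq_zero_of_notMem_tsupport fun h => lt_irrefl _ (hs h).2
  have h := inner_opJ_eq hab y (inner_sliceL_cosL hab c1 c2 (t := 0) (fun x =>
    ((hψ.differentiable (by simp)) x).hasDerivAt) ha hb)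
  rw [← intOm_mul_sliceL hab c2 hg.symm, ← intOm_mul_sliceL hab c1 hg'.symm] at h
  exact h

theorem integral_add_neg_add_add {A B C D : ℝ → ℝ} (hA : IntervalIntegrable A volume 0 T)
    (hB : IntervalIntegrable B volume 0 T) (hC : IntervalIntegrable C volume 0 T)
    (hD : IntervalIntegrable D volume 0 T) :
    ∫ t in (0 : ℝ)..T, (A t + (-B t + (C t + D t))) = (∫ t in (0 : ℝ)..T, A t) +
      (-(∫ t in (0 : ℝ)..T, B t) + ((∫ t in (0 : ℝ)..T, C t) + ∫ t in (0 : ℝ)..T, D t)) := by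
  have hB' : IntervalIntegrable (fun t => -B t) volume 0 T := hB.neg
  rw [intervalIntegral.integral_add hA (hB'.add (hC.add hD)),
    intervalIntegral.integral_add hB' (hC.add hD), intervalIntegral.integral_add hC hD,
    intervalIntegral.integral_neg]

theorem weak_heat_of_isRep (hab : a < b) (hf₁ : LipschitzWith M f₁) (hf₂ : LipschitzWith M f₂)
    (h0 : f₁ 0 = 0) (hb : ∀ x, |f₂ x| ≤ M) (hT : 0 ≤ T)
    (hs : (trigModel hab hf₁ hf₂ h0 hb).Sol T θ v w y) {Θ0 : ℝ → ℝ}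
    (hΘ0 : cosS hab (θ 0) =ᵐ[volume.restrict (Ioo a b)] Θ0)
    (hΘ : IsRep a b T Θ fun t => cosS hab (θ t)) (hΘx : IsRep a b T Θx fun t => opD hab (y t))
    (hut : IsRep a b T ut fun t => sinS hab (v t))
    (hG : IsRep a b T G fun t => L2Om.mul a b
      (BoundedContinuousFunction.comp f₂ hf₂ (opS hab (y t))) (opD hab (y t)))
    (hF : IsRep a b T F fun t => L2Om.mul a b
      (BoundedContinuousFunction.comp f₁ hf₁ (opS hab (y t))) (sinS hab (v t)))
    (hφ : TestT T φ) :
    -intOmT a b T (fun x t => Θ x t * pdt φ x t) - intOm a b (fun x => Θ0 x * φ x 0) =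
      -intOmT a b T (fun x t => Θx x t * pdx φ x t) +
        intOmT a b T (fun x t => G x t * ut x t * φ x t) +
        intOmT a b T (fun x t => F x t * pdx φ x t) := by
  obtain ⟨T', hT', hφT⟩ := hφ.suppt
  have hc := hφ.smooth
  have hv : ContinuousOn (fun t => L2Om.mul a b (sliceC hab hc.continuous t) (sinS hab (v t)))
      (Icc 0 T) :=
    ((L2Om.mul a b).continuous.comp (continuous_sliceC hab hc.continuous)).continuousOn.clm_apply
      ((sinS hab).continuous.comp_continuousOn hs.wave.contv)
  have r1 : IsRep a b T φ (sliceL hab hc.continuous) := isRep_sliceL hab _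
  have r2 : IsRep a b T (pdx φ) (sliceL hab (contDiff_pdx hc).continuous) := isRep_sliceL hab _
  have r3 : IsRep a b T (pdt φ) (sliceL hab (contDiff_pdt hc).continuous) := isRep_sliceL hab _
  have r4 : IsRep a b T (fun x t => φ x t * ut x t)
      fun t => L2Om.mul a b (sliceC hab hc.continuous t) (sinS hab (v t)) :=
    hut.mul_bcf hc.continuous.aestronglyMeasurable (Eventually.of_forall fun t => by
      filter_upwards [ae_restrict_mem measurableSet_Ioo] with x hx
      rw [sliceC_of_mem hab _ t (Ioo_subset_Icc_self hx)]) (L2T.of_continuousOn hv)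
  have h := trigModel_weak_heat hab hf₁ hf₂ h0 hb hT hs hc (hφT · T hT'.le)
  have e : (fun x t => G x t * ut x t * φ x t) = fun x t => G x t * (φ x t * ut x t) := by
    funext x t; ring
  rw [e, hΘ.intOmT_mul hT r3, hΘx.intOmT_mul hT r2, hG.intOmT_mul hT r4, hF.intOmT_mul hT r2,
    intOm_mul_sliceL hab hc.continuous hΘ0]
  rw [integral_add_neg_add_add (L2T.inner hT hΘ.mem r3.mem) (L2T.inner hT hΘx.mem r2.mem)
    (L2T.inner hT hG.mem r4.mem) (L2T.inner hT hF.mem r2.mem)] at h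
  linarith

/-- Integration by parts in time for the displacement. -/
theorem integral_displacement (hab : a < b) (hT : 0 ≤ T) {h : ℝ → SeqE}
    (hs : WaveSol (freq a b) T v w h)
    (hu : IsRep a b T u fun t => opU hab (w t)) (hut : IsRep a b T ut fun t => sinS hab (v t))
    (hc : ContDiff ℝ (⊤ : ℕ∞) (uncurry φ)) (hφT : ∀ x, φ x T = 0) :
    intOmT a b T (fun x t => u x t * pdt φ x t) + intOmT a b T (fun x t => ut x t * φ x t) =
      -⟪opU hab (w 0), sliceL hab hc.continuous 0⟫_ℝ := by
  have r1 : IsRep a b T φ (sliceL hab hc.continuous) := isRep_sliceL hab _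
  have r3 : IsRep a b T (pdt φ) (sliceL hab (contDiff_pdt hc).continuous) := isRep_sliceL hab _
  have h1 := ((hs.isPrim_opU hab hT).inner hT
    (isPrim_sliceL hab hc.continuous (contDiff_pdt hc).continuous (hasDerivAt_pdt hc))).2 T
    (right_mem_Icc.2 hT)
  beta_reduce at h1
  rw [sliceL_eq_zero hab hc.continuous hφT, inner_zero_right, intervalIntegral.integral_add
    (L2T.inner hT hu.mem r3.mem) (L2T.inner hT hut.mem r1.mem)] at h1
  rw [hu.intOmT_mul hT r3, hut.intOmT_mul hT r1]
  linarith

theorem weak_wave_of_isRep (hab : a < b) (hf₁ : LipschitzWith M f₁) (hf₂ : LipschitzWith M f₂)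
    (h0 : f₁ 0 = 0) (hb : ∀ x, |f₂ x| ≤ M) (hT : 0 ≤ T)
    (hs : (trigModel hab hf₁ hf₂ h0 hb).Sol T θ v w y) {u0 u0t : ℝ → ℝ}
    (hu0 : opU hab (w 0) =ᵐ[volume.restrict (Ioo a b)] u0)
    (hu0t : sinS hab (v 0) =ᵐ[volume.restrict (Ioo a b)] u0t)
    (hu : IsRep a b T u fun t => opU hab (w t)) (hut : IsRep a b T ut fun t => sinS hab (v t))
    (hux : IsRep a b T ux fun t => cosS hab (w t))
    (hG : IsRep a b T G fun t => L2Om.mul a b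
      (BoundedContinuousFunction.comp f₂ hf₂ (opS hab (y t))) (opD hab (y t)))
    (hφ : TestU a b T φ) :
    intOmT a b T (fun x t => u x t * pdt (pdt φ) x t) - intOm a b (fun x => u0t x * φ x 0) +
        intOm a b (fun x => u0 x * pdt φ x 0) =
      -intOmT a b T (fun x t => ux x t * pdx φ x t) -
        intOmT a b T (fun x t => G x t * φ x t) := by
  obtain ⟨T', hT', hφT⟩ := hφ.suppt
  obtain ⟨K, -, hK, hφK⟩ := hφ.suppx
  have hc := hφ.smooth
  have r1 : IsRep a b T φ (sliceL hab hc.continuous) := isRep_sliceL hab _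
  have r2 : IsRep a b T (pdx φ) (sliceL hab (contDiff_pdx hc).continuous) := isRep_sliceL hab _
  have r3 : IsRep a b T (pdt φ) (sliceL hab (contDiff_pdt hc).continuous) := isRep_sliceL hab _
  have h := trigModel_weak_wave hab hf₁ hf₂ h0 hb hT hs hc (hφT · T hT'.le)
    (fun t => hφK a t fun h => lt_irrefl _ (hK h).1)
    (fun t => hφK b t fun h => lt_irrefl _ (hK h).2)
  have hh : WaveSol (freq a b) T v w fun t => (trigModel hab hf₁ hf₂ h0 hb).h (y t) := hs.wave
  have h2 := integral_displacement hab hT hh hu hut (contDiff_pdt hc) (pdt_eq_zero hT' hφT)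
  rw [hut.intOmT_mul hT r3] at h2
  rw [hux.intOmT_mul hT r2, hG.intOmT_mul hT r1, intOm_mul_sliceL hab hc.continuous hu0t,
    intOm_mul_sliceL hab (contDiff_pdt hc).continuous hu0]
  have hB := (L2T.inner hT hux.mem r2.mem).neg
  have hC := (L2T.inner hT hG.mem r1.mem).neg
  simp only [Pi.neg_def] at hB hC
  rw [intervalIntegral.integral_add (L2T.inner hT hut.mem r3.mem) (hB.add hC),
    intervalIntegral.integral_add hB hC, intervalIntegral.integral_neg,
    intervalIntegral.integral_neg] at h
  linarith

theorem weak_time_derivative_of_isRep (hab : a < b) (hT : 0 ≤ T) {h : ℝ → SeqE}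
    (hs : WaveSol (freq a b) T v w h)
    (hu : IsRep a b T u fun t => opU hab (w t)) (hut : IsRep a b T ut fun t => sinS hab (v t))
    (hφ : TestInt a b T φ) :
    intOmT a b T (fun x t => u x t * pdt φ x t) = -intOmT a b T (fun x t => ut x t * φ x t) := by
  obtain ⟨K, -, hK, hφK⟩ := hφ.supptime
  have h := integral_displacement hab hT hs hu hut hφ.smooth
    fun x => hφK x T fun h => lt_irrefl _ (hK h).2
  rw [sliceL_eq_zero hab _ fun x => hφK x 0 fun h => lt_irrefl _ (hK h).1, inner_zero_right] at h
  linarith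

end WeakForms

section GlobalSolution

variable {a b T : ℝ} {M : ℝ≥0} {f₁ f₂ : ℝ → ℝ} {θ v w y : ℝ → SeqE}

theorem MemL2.exists_ae_eq {F : ℝ → ℝ} (h : MemL2 a b F) :
    ∃ f : L2Om a b, f =ᵐ[volume.restrict (Ioo a b)] F :=
  ⟨((memLp_two_iff_integrable_sq h.1).2 h.2).toLp F, MemLp.coeFn_toLp _⟩

theorem WeakDerivZ.inner_cosL {u u' : ℝ → ℝ} (h : WeakDerivZ a b u u') {U Ux : L2Om a b}
    (hU : U =ᵐ[volume.restrict (Ioo a b)] u) (hUx : Ux =ᵐ[volume.restrict (Ioo a b)] u') (k : ℕ) :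
    ⟪Ux, cosL a b k⟫_ℝ = freq a b k * ⟪U, sinL a b k⟫_ℝ := by
  have hd : deriv (cosC a b k) = fun x => -(freq a b k * sinC a b k x) :=
    funext fun x => (hasDerivAt_cosC k x).deriv
  have hs : ContDiff ℝ (⊤ : ℕ∞) (cosC a b k) := by
    rw [show (cosC a b k : ℝ → ℝ) = _ from funext (cosC_apply k)]
    fun_prop
  have h1 := h _ hs
  rw [cosL, sinL, L2Om.inner_eq_of_ae hUx (L2Om.coeFn_ofBCF _),
    L2Om.inner_eq_of_ae hU (L2Om.coeFn_ofBCF _), ← integral_const_mul, ← neg_neg (∫ _ in _, _),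
    ← h1, hd, ← integral_neg]
  exact integral_congr_ae (Eventually.of_forall fun x => by ring)

theorem l2T_mul_comp_opD (hab : a < b) (hf₁ : LipschitzWith M f₁) (hf₂ : LipschitzWith M f₂)
    (h0 : f₁ 0 = 0) (hb : ∀ x, |f₂ x| ≤ M)
    (hs : (trigModel hab hf₁ hf₂ h0 hb).Sol T θ v w y) :
    L2T T fun t => L2Om.mul a b (BoundedContinuousFunction.comp f₂ hf₂ (opS hab (y t)))
      (opD hab (y t)) :=
  MemLp.of_le_mul (c := (trigModel hab hf₁ hf₂ h0 hb).M) hs.heat.y2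
    ((trigModel hab hf₁ hf₂ h0 hb).continuous_A.comp_aestronglyMeasurable
      hs.heat.y2.aestronglyMeasurable)
    (Eventually.of_forall fun t => (trigModel hab hf₁ hf₂ h0 hb).norm_A_le (y t))

theorem l2T_mul_comp_sinS (hab : a < b) (hf₁ : LipschitzWith M f₁) (hf₂ : LipschitzWith M f₂)
    (h0 : f₁ 0 = 0) (hb : ∀ x, |f₂ x| ≤ M)
    (hs : (trigModel hab hf₁ hf₂ h0 hb).Sol T θ v w y) :
    L2T T fun t => L2Om.mul a b (BoundedContinuousFunction.comp f₁ hf₁ (opS hab (y t)))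
      (sinS hab (v t)) := by
  obtain ⟨C, hC⟩ := isCompact_Icc.exists_bound_of_continuousOn hs.wave.contv
  have hM := (trigModel hab hf₁ hf₂ h0 hb).M_nonneg
  have hK := (trigModel hab hf₁ hf₂ h0 hb).K_nonneg
  refine MemLp.of_le_mul (c := (trigModel hab hf₁ hf₂ h0 hb).M *
    (1 + (trigModel hab hf₁ hf₂ h0 hb).K) * C) hs.heat.y2 ?_ ?_
  · have h1 : Continuous fun z => L2Om.mul a b
        (BoundedContinuousFunction.comp f₁ hf₁ (opS hab z)) :=
      (L2Om.mul a b).continuous.comp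
        ((trigModel hab hf₁ hf₂ h0 hb).continuous_F.comp (opS hab).continuous)
    have h2 : AEStronglyMeasurable (fun t => sinS hab (v t)) (volume.restrict (Ioc 0 T)) :=
      (L2T.of_continuousOn
        ((sinS hab).continuous.comp_continuousOn hs.wave.contv)).aestronglyMeasurable
    exact ((continuous_fst.clm_apply continuous_snd).comp_aestronglyMeasurable
      ((h1.comp_aestronglyMeasurable hs.heat.y2.aestronglyMeasurable).prodMk h2) :)
  · filter_upwards [ae_restrict_mem measurableSet_Ioc] with t ht
    refine ((trigModel hab hf₁ hf₂ h0 hb).norm_mulF_le (y t) (v t)).trans ?_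
    refine (mul_le_mul (mul_le_mul_of_nonneg_left
      ((trigModel hab hf₁ hf₂ h0 hb).norm_S_le (y t)) hM) (hC t (Ioc_subset_Icc_self ht))
      (norm_nonneg _) (by positivity)).trans (le_of_eq ?_)
    ring

theorem HeatSol.opJ_eq (hab : a < b) {ρ : ℝ → SeqE} (hs : HeatSol (omF a b) T θ y ρ) :
    ∀ᵐ t ∂volume.restrict (Ioc 0 T), opJ hab (y t) = cosS hab (θ t) := by
  filter_upwards [hs.yθ] with t ht
  rw [opJ_apply]
  congr 1
  refine seq_ext fun k => ?_
  rw [invOm_apply, ht, ← mul_assoc, one_div_mul_cancel (omF_pos k).ne', one_mul]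

end GlobalSolution

theorem exists_curves {a b : ℝ} (hab : a < b) {M : ℝ≥0} {f₁ f₂ : ℝ → ℝ}
    (hf₁ : LipschitzWith M f₁) (hf₂ : LipschitzWith M f₂) (h0 : f₁ 0 = 0) (hb : ∀ x, |f₂ x| ≤ M)
    {u0 u0x u0t Θ0 : ℝ → ℝ} (hdata : DataI a b u0 u0x u0t Θ0) :
    ∃ θ v w y : ℝ → SeqE, (∀ T, 0 ≤ T → (trigModel hab hf₁ hf₂ h0 hb).Sol T θ v w y) ∧
      cosS hab (θ 0) =ᵐ[volume.restrict (Ioo a b)] Θ0 ∧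
      sinS hab (v 0) =ᵐ[volume.restrict (Ioo a b)] u0t ∧
      opU hab (w 0) =ᵐ[volume.restrict (Ioo a b)] u0 ∧
      (∀ t, 0 ≤ t → w t 0 = 0) ∧
      ∀ t, 0 ≤ t → ∀ᵐ x ∂volume.restrict (Ioo a b), 0 ≤ cosS hab (θ t) x := by
  obtain ⟨U, hU⟩ := hdata.u0_L2.exists_ae_eq
  obtain ⟨Ux, hUx⟩ := hdata.u0x_L2.exists_ae_eq
  obtain ⟨V, hV⟩ := hdata.u0t_L2.exists_ae_eq
  obtain ⟨Q, hQ⟩ := hdata.Θ0_L2.exists_ae_eq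
  have hUU := hdata.u0_W0.inner_cosL hU hUx
  have hQ0 : ∀ᵐ x ∂volume.restrict (Ioo a b), 0 ≤ Q x := by
    filter_upwards [hQ, hdata.Θ0_nonneg] with x h1 h2
    rwa [h1]
  have hg : (trigPositivity hab hf₁ hf₂ h0 hb).g (cosCoef hab Q) = 0 := by
    change (cosBasis hab).repr (L2Om.negPt (cosS hab (cosCoef hab Q))) = 0
    rw [cosS_cosCoef, L2Om.negPt_eq_zero hQ0, map_zero]
  obtain ⟨θ, v, w, y, h⟩ := (trigPositivity hab hf₁ hf₂ h0 hb).exists_sol (cosCoef hab Q)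
    (sinCoef hab V) (cosCoef hab Ux) hg
  obtain ⟨-, hθ, hv, hw, -⟩ := h 0 le_rfl
  refine ⟨θ, v, w, y, fun T hT => (h T hT).1, ?_, ?_, ?_, fun t ht => ?_, fun t ht => ?_⟩
  · rwa [hθ, cosS_cosCoef]
  · rwa [hv, sinS_sinCoef]
  · rwa [hw, opU_cosCoef hab hUU]
  · have hh : WaveSol (freq a b) t v w fun t => (trigModel hab hf₁ hf₂ h0 hb).h (y t) :=
      (h t ht).1.wave
    refine hh.apply_zero_eq ?_ (right_mem_Icc.2 ht)
    rw [hw, cosCoef_apply, hUU, freq_zero, zero_mul]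
  · exact L2Om.nonneg_of_negPt_eq_zero
      ((LinearIsometryEquiv.map_eq_zero_iff (cosBasis hab).repr).1 (h t ht).2.2.2.2)

/-- Lemma 4.10: existence of a global weak solution in the regularity
class (R) for general data satisfying (I). -/
theorem statement19
    (a b : ℝ) (hab : a < b)
    (f f' f'' : ℝ → ℝ) (hf : HypF f f' f'')
    (u0 u0x u0t Θ0 : ℝ → ℝ) (hdata : DataI a b u0 u0x u0t Θ0) :
    ∃ u ut ux Θ Θx : ℝ → ℝ → ℝ,
      (∀ T > (0 : ℝ), IsWeakSol a b T f f' u0 u0t Θ0 u ut ux Θ Θx) ∧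
      (∀ T > (0 : ℝ), RegT a b T u ut ux Θ Θx) := by
  obtain ⟨M, hf₁, hf₂, hb⟩ := hf.exists_lipschitz
  obtain ⟨θ, v, w, y, hs, hθ0, hv0, hw0, hwz, hpos⟩ :=
    exists_curves hab hf₁ hf₂ hf.extLin_zero hb hdata
  have hheat : ∀ T, 0 ≤ T → HeatSol (omF a b) T θ y fun t =>
    (trigModel hab hf₁ hf₂ hf.extLin_zero hb).B (y t) (v t) := fun T hT => (hs T hT).heat
  have hwave : ∀ T, 0 ≤ T → WaveSol (freq a b) T v w fun t =>
    (trigModel hab hf₁ hf₂ hf.extLin_zero hb).h (y t) := fun T hT => (hs T hT).wave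
  have cθ : ContinuousOn (fun t => cosS hab (θ t)) (Ici 0) :=
    (cosS hab).continuous.comp_continuousOn (continuousOn_Ici_of_Icc fun T hT => (hheat T hT).cont)
  have cv : ContinuousOn (fun t => sinS hab (v t)) (Ici 0) :=
    (sinS hab).continuous.comp_continuousOn (continuousOn_Ici_of_Icc fun T hT => (hwave T hT).contv)
  have cw : ContinuousOn w (Ici 0) := continuousOn_Ici_of_Icc fun T hT => (hwave T hT).contw
  have cU : ContinuousOn (fun t => opU hab (w t)) (Ici 0) :=
    (opU hab).continuous.comp_continuousOn cw
  have cW : ContinuousOn (fun t => cosS hab (w t)) (Ici 0) :=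
    (cosS hab).continuous.comp_continuousOn cw
  obtain ⟨u, mu, su⟩ := exists_rep_of_continuousOn cU
  obtain ⟨ut, mUt, sut⟩ := exists_rep_of_continuousOn cv
  obtain ⟨ux, mux, sux⟩ := exists_rep_of_continuousOn cW
  obtain ⟨Θr, mΘr, sΘr⟩ := exists_rep_of_continuousOn cθ
  obtain ⟨Θx, rΘx⟩ := exists_rep_of_L2T (a := a) (b := b) (g := fun t => opD hab (y t))
    fun T hT => (opD hab).comp_memLp' (hheat T hT).y2
  obtain ⟨Θ, hΘ⟩ : ∃ Θ : ℝ → ℝ → ℝ, ∀ x t, Θ x t = max (Θr x t) 0 := ⟨_, fun _ _ => rfl⟩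
  have hΘ0 : ∀ x t, 0 ≤ Θ x t := fun x t => by rw [hΘ]; exact le_max_right _ _
  have mΘ : StronglyMeasurable (uncurry Θ) := by
    rw [show uncurry Θ = fun p => max (uncurry Θr p) 0 from funext fun p => hΘ _ _]
    exact mΘr.sup stronglyMeasurable_const
  have sΘ : ∀ t, 0 ≤ t → (fun x => Θ x t) =ᵐ[volume.restrict (Ioo a b)] cosS hab (θ t) := by
    intro t ht
    filter_upwards [sΘr t ht, hpos t ht] with x h1 h2
    rw [hΘ, h1, max_eq_left h2]
  have eJ : ∀ T, 0 ≤ T → ∀ᵐ t ∂volume.restrict (Ioo 0 T), opJ hab (y t) = cosS hab (θ t) :=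
    fun T hT => ae_restrict_of_ae_restrict_of_subset Ioo_subset_Ioc_self ((hheat T hT).opJ_eq hab)
  have eS : ∀ T, 0 ≤ T → ∀ᵐ t ∂volume.restrict (Ioo 0 T),
      (fun x => Θ x t) =ᵐ[volume.restrict (Ioo a b)] opS hab (y t) := by
    intro T hT
    filter_upwards [eJ T hT, ae_restrict_mem measurableSet_Ioo] with t h1 ht
    refine (sΘ t ht.1.le).trans ?_
    rw [← h1]
    exact coeFn_opJ hab (y t)
  have ru : ∀ T, IsRep a b T u fun t => opU hab (w t) := fun T => IsRep.of_slices mu su cU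
  have rut : ∀ T, IsRep a b T ut fun t => sinS hab (v t) := fun T => IsRep.of_slices mUt sut cv
  have rux : ∀ T, IsRep a b T ux fun t => cosS hab (w t) := fun T => IsRep.of_slices mux sux cW
  have rΘ : ∀ T, IsRep a b T Θ fun t => cosS hab (θ t) := fun T => IsRep.of_slices mΘ sΘ cθ
  have ef : ∀ x t, f (Θ x t) = extLin f f' (Θ x t) := fun x t => (extLin_of_nonneg (hΘ0 x t)).symm
  have ef' : ∀ x t, f' (Θ x t) = extConst f' (Θ x t) :=
    fun x t => (extConst_of_nonneg (hΘ0 x t)).symm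
  have rG : ∀ T, 0 ≤ T → IsRep a b T (fun x t => f' (Θ x t) * Θx x t) fun t => L2Om.mul a b
      (BoundedContinuousFunction.comp (extConst f') hf₂ (opS hab (y t))) (opD hab (y t)) := by
    intro T hT
    simp only [ef']
    refine IsRep.mul_bcf (p := fun x t => extConst f' (Θ x t))
      (hf₂.continuous.comp_stronglyMeasurable mΘ).aestronglyMeasurable ?_ (rΘx T hT)
      (l2T_mul_comp_opD hab hf₁ hf₂ hf.extLin_zero hb (hs T hT))
    filter_upwards [eS T hT] with t ht
    filter_upwards [ht] with x hx
    exact congrArg _ hx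
  have rF : ∀ T, 0 ≤ T → IsRep a b T (fun x t => f (Θ x t) * ut x t) fun t => L2Om.mul a b
      (BoundedContinuousFunction.comp (extLin f f') hf₁ (opS hab (y t))) (sinS hab (v t)) := by
    intro T hT
    simp only [ef]
    refine IsRep.mul_bcf (p := fun x t => extLin f f' (Θ x t))
      (hf₁.continuous.comp_stronglyMeasurable mΘ).aestronglyMeasurable ?_ (rut T)
      (l2T_mul_comp_sinS hab hf₁ hf₂ hf.extLin_zero hb (hs T hT))
    filter_upwards [eS T hT] with t ht
    filter_upwards [ht] with x hx
    exact congrArg _ hx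
  have hW : ∀ t, 0 ≤ t → WeakDerivZ a b (fun x => u x t) (fun x => ux x t) :=
    fun t ht => weakDerivZ_opU hab (hwz t ht) (su t ht) (sux t ht)
  refine ⟨u, ut, ux, Θ, Θx, fun T hT => ?_, fun T hT => ?_⟩
  · exact
    { u_sliceL1 := fun t ht => (L2Om.integrableOn (opU hab (w t))).congr (su t ht.1).symm
      u_contL1 := fun t₀ ht₀ => tendsto_integral_abs_sub (cU.mono Icc_subset_Ici_self)
        (fun t ht => su t ht.1) ht₀
      u_int := (ru T).integrable
      ux_int := (rux T).integrable
      u_W0 := by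
        filter_upwards [ae_restrict_mem measurableSet_Ioo] with t ht
        exact hW t ht.1.le
      Θ_int := (rΘ T).integrable
      Θx_int := (rΘx T hT.le).integrable
      Θ_W := by
        filter_upwards [eJ T hT.le, (rΘx T hT.le).slice, ae_restrict_mem measurableSet_Ioo]
          with t h1 h2 ht
        have h3 := sΘ t ht.1.le
        rw [← h1] at h3
        exact weakDerivI_opJ hab h3 h2
      Θ_nonneg := Eventually.of_forall fun p => hΘ0 _ _
      ut_weak := fun φ hφ =>
        weak_time_derivative_of_isRep hab hT.le (hwave T hT.le) (ru T) (rut T) hφ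
      ut_int := (rut T).integrable
      g1_int := (rG T hT.le).integrable
      g2_int := (rG T hT.le).integrable_mul (rut T)
      g3_int := (rF T hT.le).integrable
      weak_u := fun φ hφ => weak_wave_of_isRep hab hf₁ hf₂ hf.extLin_zero hb hT.le (hs T hT.le)
        hw0 hv0 (ru T) (rut T) (rux T) (rG T hT.le) hφ
      weak_Θ := fun φ hφ => weak_heat_of_isRep hab hf₁ hf₂ hf.extLin_zero hb hT.le (hs T hT.le)
        hθ0 (rΘ T) (rΘx T hT.le) (rut T) (rG T hT.le) (rF T hT.le) hφ }
  · exact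
    { u_cont := contL2_of_slice (cU.mono Icc_subset_Ici_self) fun t ht => su t ht.1
      ux_cont := contL2_of_slice (cW.mono Icc_subset_Ici_self) fun t ht => sux t ht.1
      u_W0 := fun t ht => hW t ht.1
      ut_cont := contL2_of_slice (cv.mono Icc_subset_Ici_self) fun t ht => sut t ht.1
      Θ_cont := contL2_of_slice (cθ.mono Icc_subset_Ici_self) fun t ht => sΘ t ht.1
      Θ_sq_int := (rΘ T).integrable_sq
      Θx_sq_int := (rΘx T hT.le).integrable_sq }
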